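/- Let p be a regular prime (p odd and p does not divide the class number of Q(ζ_p)) and N a prime with N ≡ 1 (mod p); let L = Q(ζ_p, N^{1/p}). Fix an element f of order p in F_N^×, and for an integer 0 < k < p-1 define M_k = ∏_{a=1}^{p-1} (1 - f^a)^{a^k} in F_N^×. Let α be the number of even integers i with 0 < i < p-1 such that M_{p-1-i} is a p-th power in F_N^×. Then (p-1)/2 + α ≤ rk_p(Cl(L)) ≤ (p-1)(p-2) - (p-1)·((p-1)/2 - 1 - α). -/

import Mathlib

open NumberField Polynomial

/-- The `p`-rank of a finite abelian group `G`: the `𝔽_p`-dimension of `G ⊗ 𝔽_p`,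
equivalently of `G[p]`. -/
noncomputable def pRank (p : ℕ) (G : Type*) [Group G] : ℕ :=
  (Nat.card {g : G // g ^ p = 1}).factorization p

section PartA1

theorem ambig_abs {X I : Type*} [CommGroup X] [CommGroup I] (D Nm : X →* X) (DI : I →* I)
    (dv : X →* I) (IK : Subgroup I)
    (h1 : Nm.ker = D.range)
    (h2 : ∀ x, DI (dv x) = dv (D x))
    (h3 : ∀ x, Nm x ∈ dv.ker ↔ dv x ∈ DI.range)
    (hIK : IK ≤ DI.ker) (hPK : D.ker.map dv ≤ IK) :
    dv.range.relIndex (dv.range.comap DI) * (dv.ker.map D).relIndex (dv.ker ⊓ Nm.ker) =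
    (dv.ker.map Nm).relIndex (dv.ker ⊓ Nm.range) * IK.relIndex DI.ker *
      (D.ker.map dv).relIndex IK := by
  have hDk : ∀ x, Nm (D x) = 1 := fun x => by
    have : D x ∈ Nm.ker := h1 ▸ ⟨x, rfl⟩
    exact this
  have hle : dv.range ≤ dv.range.comap DI := by
    rintro _ ⟨x, rfl⟩
    exact ⟨D x, (h2 x).symm⟩
  have hle2 : DI.ker ≤ dv.range.comap DI := by
    intro a ha
    rw [MonoidHom.mem_ker] at ha
    simp only [Subgroup.mem_comap, ha]
    exact one_mem _
  have e1 := Subgroup.relIndex_mul_relIndex dv.range (dv.range ⊔ DI.ker) (dv.range.comap DI)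
    le_sup_left (sup_le hle hle2)
  have e2 : dv.range.relIndex (dv.range ⊔ DI.ker) = (dv.range ⊓ DI.ker).relIndex DI.ker := by
    rw [Subgroup.relIndex_sup_left, Subgroup.inf_relIndex_right]
  have hPKle : D.ker.map dv ≤ dv.range ⊓ DI.ker := le_inf (by
    rintro _ ⟨x, -, rfl⟩; exact ⟨x, rfl⟩) (hPK.trans hIK)
  have e3 := Subgroup.relIndex_mul_relIndex (D.ker.map dv) (dv.range ⊓ DI.ker) DI.ker hPKle
    inf_le_right
  have e4 := Subgroup.relIndex_mul_relIndex (D.ker.map dv) IK DI.ker hPK hIK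
  -- the group Λ
  have eΛ1 : dv.range ⊓ DI.ker = (dv.ker.comap D).map dv := by
    ext a
    constructor
    · rintro ⟨⟨x, rfl⟩, hx⟩
      refine ⟨x, ?_, rfl⟩
      have hx' : DI (dv x) = 1 := hx
      rw [h2] at hx'
      exact hx'
    · rintro ⟨x, hx, rfl⟩
      refine ⟨⟨x, rfl⟩, ?_⟩
      have : dv (D x) = 1 := hx
      change DI (dv x) = 1
      rw [h2, this]
  have eΛ2 : (dv.ker.comap D).map D = dv.ker ⊓ Nm.ker := by
    ext a
    constructor
    · rintro ⟨x, hx, rfl⟩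
      exact ⟨hx, hDk x⟩
    · rintro ⟨ha, hb⟩
      obtain ⟨x, rfl⟩ : a ∈ D.range := h1 ▸ hb
      exact ⟨x, ha, rfl⟩
  have hEΛ : dv.ker ≤ dv.ker.comap D := by
    intro x hx
    have hx' : dv x = 1 := hx
    change dv (D x) = 1
    rw [← h2, hx', map_one]
  have hKΛ : D.ker ≤ dv.ker.comap D := by
    intro x hx
    have hx' : D x = 1 := hx
    change dv (D x) = 1
    rw [hx', map_one]
  have e5 : (D.ker.map dv).relIndex (dv.range ⊓ DI.ker) =
      (dv.ker.map D).relIndex (dv.ker ⊓ Nm.ker) := by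
    rw [eΛ1, ← eΛ2, Subgroup.relIndex_map_map, Subgroup.relIndex_map_map,
      sup_eq_left.2 hEΛ, sup_eq_left.2 hKΛ, sup_comm]
  -- the group X
  have eX1 : (dv.range.comap DI).map DI = (dv.ker.comap Nm).map dv := by
    ext a
    constructor
    · rintro ⟨b, ⟨x, hx⟩, rfl⟩
      refine ⟨x, ?_, hx⟩
      exact (h3 x).2 ⟨b, hx.symm⟩
    · rintro ⟨x, hx, rfl⟩
      obtain ⟨b, hb⟩ := (h3 x).1 hx
      exact ⟨b, ⟨x, hb.symm⟩, hb⟩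
  have eX2 : (dv.range ⊔ DI.ker).map DI = D.range.map dv := by
    rw [Subgroup.map_sup]
    have : DI.ker.map DI = ⊥ := by
      rw [eq_bot_iff]; rintro _ ⟨x, hx, rfl⟩; exact hx
    rw [this, sup_bot_eq]
    ext a
    constructor
    · rintro ⟨_, ⟨x, rfl⟩, rfl⟩
      exact ⟨D x, ⟨x, rfl⟩, (h2 x).symm⟩
    · rintro ⟨_, ⟨x, rfl⟩, rfl⟩
      exact ⟨dv x, ⟨x, rfl⟩, h2 x⟩
  have hEX : dv.ker ≤ dv.ker.comap Nm := by
    intro x hx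
    have hx' : dv x = 1 := hx
    exact (h3 x).2 (by rw [hx']; exact one_mem _)
  have hNX : Nm.ker ≤ dv.ker.comap Nm := by
    intro x hx
    have hx' : Nm x = 1 := hx
    change dv (Nm x) = 1
    rw [hx', map_one]
  have e6 : (dv.range ⊔ DI.ker).relIndex (dv.range.comap DI) =
      (dv.ker.map Nm).relIndex (dv.ker ⊓ Nm.range) := by
    have a1 := Subgroup.relIndex_map_map DI (dv.range ⊔ DI.ker) (dv.range.comap DI)
    rw [sup_eq_left.2 hle2, sup_assoc, sup_idem] at a1
    rw [← a1, eX1, eX2, Subgroup.relIndex_map_map, sup_eq_left.2 hEX]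
    have a2 := Subgroup.relIndex_map_map Nm dv.ker (dv.ker.comap Nm)
    rw [sup_eq_left.2 hNX, Subgroup.map_comap_eq, inf_comm] at a2
    rw [a2, h1, sup_comm]
  rw [← e1, e2, e6, ← e5]
  calc _ = (dv.ker.map Nm).relIndex (dv.ker ⊓ Nm.range) *
        ((D.ker.map dv).relIndex (dv.range ⊓ DI.ker) * (dv.range ⊓ DI.ker).relIndex DI.ker) := by ring
    _ = _ := by rw [e3, ← e4]; ring

/-- the Herbrand quotient computation, abstract part -/
theorem herbrand_abs {M : Type*} [CommGroup M] (D Nm P : M →* M)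
    (hDN : ∀ x, Nm (D x) = 1) (hND : ∀ x, D (Nm x) = 1)
    (hNP : ∀ x, D x = 1 → Nm x = P x) :
    (D.ker.map P).relIndex D.ker * (D.range).relIndex Nm.ker =
     (Nm.range).relIndex D.ker * (Nm.ker.map D).relIndex Nm.ker := by
  have a1 := Subgroup.relIndex_map_map Nm (D.ker ⊔ Nm.ker) ⊤
  have a2 := Subgroup.relIndex_map_map D (D.ker ⊔ Nm.ker) ⊤
  have b1 : (D.ker ⊔ Nm.ker) ⊔ Nm.ker = D.ker ⊔ Nm.ker := by rw [sup_assoc, sup_idem]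
  have b2 : (D.ker ⊔ Nm.ker) ⊔ D.ker = D.ker ⊔ Nm.ker := by rw [sup_comm, ← sup_assoc, sup_idem]
  rw [b1, top_sup_eq] at a1
  rw [b2, top_sup_eq] at a2
  have c1 : (D.ker ⊔ Nm.ker).map Nm = D.ker.map P := by
    rw [Subgroup.map_sup]
    have : Nm.ker.map Nm = ⊥ := by
      rw [eq_bot_iff]; rintro _ ⟨x, hx, rfl⟩; exact hx
    rw [this, sup_bot_eq]
    ext a
    constructor
    · rintro ⟨x, hx, rfl⟩; exact ⟨x, hx, (hNP x hx).symm⟩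
    · rintro ⟨x, hx, rfl⟩; exact ⟨x, hx, (hNP x hx)⟩
  have c2 : (D.ker ⊔ Nm.ker).map D = Nm.ker.map D := by
    rw [Subgroup.map_sup]
    have : D.ker.map D = ⊥ := by
      rw [eq_bot_iff]; rintro _ ⟨x, hx, rfl⟩; exact hx
    rw [this, bot_sup_eq]
  rw [c1, ← MonoidHom.range_eq_map] at a1
  rw [c2, ← MonoidHom.range_eq_map] at a2
  have d1 := Subgroup.relIndex_mul_relIndex (D.ker.map P) Nm.range D.ker (by
    rintro _ ⟨x, hx, rfl⟩; exact ⟨x, hNP x hx⟩) (by rintro _ ⟨x, rfl⟩; exact hND x)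
  have d2 := Subgroup.relIndex_mul_relIndex (Nm.ker.map D) D.range Nm.ker (by
    rintro _ ⟨x, hx, rfl⟩; exact ⟨x, rfl⟩) (by rintro _ ⟨x, rfl⟩; exact hDN x)
  rw [← d1, ← d2, a1, a2]; ring

end PartA1

section PartA2

section FinsuppPerm
variable {S : Type*}

/-- permutation action on divisors -/
noncomputable def permDiv (s : Equiv.Perm S) : Multiplicative (S →₀ ℤ) →* Multiplicative (S →₀ ℤ) :=
  AddMonoidHom.toMultiplicative (Finsupp.domCongr s : (S →₀ ℤ) ≃+ (S →₀ ℤ)).toAddMonoidHom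

theorem permDiv_apply (s : Equiv.Perm S) (n : Multiplicative (S →₀ ℤ)) (P : S) :
    (Multiplicative.toAdd (permDiv s n)) P = (Multiplicative.toAdd n) (s.symm P) := rfl

noncomputable def diffDiv (s : Equiv.Perm S) : Multiplicative (S →₀ ℤ) →* Multiplicative (S →₀ ℤ) :=
  permDiv s / MonoidHom.id _

theorem diffDiv_apply (s : Equiv.Perm S) (n : Multiplicative (S →₀ ℤ)) (P : S) :
    (Multiplicative.toAdd (diffDiv s n)) P
      = (Multiplicative.toAdd n) (s.symm P) - (Multiplicative.toAdd n) P := rfl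

theorem diffDiv_single_mem (s : Equiv.Perm S) (k : ℕ) (P : S) (c : ℤ) :
    Multiplicative.ofAdd (Finsupp.single ((s ^ k) P) c - Finsupp.single P c) ∈ (diffDiv s).range := by
  classical
  induction k with
  | zero => simp
  | succ k ih =>
    have h2 : Multiplicative.ofAdd (Finsupp.single ((s ^ (k+1)) P) c - Finsupp.single ((s^k) P) c)
        ∈ (diffDiv s).range := by
      refine ⟨Multiplicative.ofAdd (Finsupp.single ((s^k) P) c), ?_⟩
      apply Multiplicative.toAdd.injective
      ext Q
      rw [diffDiv_apply]
      simp only [toAdd_ofAdd, Finsupp.sub_apply, Finsupp.single_apply, pow_succ', Equiv.Perm.mul_apply]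
      congr 2
      rw [Equiv.eq_symm_apply]
    have := mul_mem h2 ih
    rw [← ofAdd_add] at this
    simpa using this

theorem diffDiv_norm (s : Equiv.Perm S) (p : ℕ) (hs : s ^ p = 1)
    (b : Multiplicative (S →₀ ℤ)) (P : S) :
    ∑ k ∈ Finset.range p, (Multiplicative.toAdd (diffDiv s b)) ((s ^ k) P) = 0 := by
  have : ∀ k, (Multiplicative.toAdd (diffDiv s b)) ((s ^ k) P)
      = (fun k : ℕ => - (Multiplicative.toAdd b) (s.symm ((s ^ k) P))) (k+1)
        - (fun k : ℕ => - (Multiplicative.toAdd b) (s.symm ((s ^ k) P))) k := by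
    intro k
    rw [diffDiv_apply]
    simp only [pow_succ', Equiv.Perm.mul_apply, Equiv.symm_apply_apply]
    ring
  rw [Finset.sum_congr rfl (fun k _ => this k),
    Finset.sum_range_sub (fun k : ℕ => - (Multiplicative.toAdd b) (s.symm ((s ^ k) P)))]
  simp [hs]

theorem finsupp_H90 (s : Equiv.Perm S) (p : ℕ) (hp : 0 < p) (hs : s ^ p = 1) (n : S →₀ ℤ)
    (hn : ∀ P, ∑ k ∈ Finset.range p, n ((s ^ k) P) = 0) :
    Multiplicative.ofAdd n ∈ (diffDiv s).range := by
  classical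
  induction hm : (∑ P ∈ n.support, (n P).natAbs) using Nat.strong_induction_on generalizing n with
  | _ m ih =>
  subst hm
  by_cases h0 : n = 0
  · subst h0; exact one_mem _
  have hex : ∃ P, 0 < n P := by
    by_contra hcon
    push Not at hcon
    apply h0
    ext P
    have := (Finset.sum_eq_zero_iff_of_nonpos (fun k _ => hcon ((s^k) P))).1 (hn P)
    simpa using this 0 (Finset.mem_range.2 hp)
  obtain ⟨P, hP⟩ := hex
  have hex2 : ∃ k, n ((s^k) P) < 0 := by
    by_contra hcon
    push Not at hcon
    have := (Finset.sum_eq_zero_iff_of_nonneg (fun k _ => hcon k)).1 (hn P) 0 (Finset.mem_range.2 hp)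
    simp at this
    omega
  obtain ⟨k, hk⟩ := hex2
  have hne : (s^k) P ≠ P := by
    intro h; rw [h] at hk; omega
  obtain ⟨b, hb⟩ := diffDiv_single_mem s k P 1
  set n' : S →₀ ℤ := n + (Finsupp.single ((s ^ k) P) 1 - Finsupp.single P 1) with hn'
  have hb' : ∀ Q, (Finsupp.single ((s ^ k) P) (1:ℤ) - Finsupp.single P 1 : S →₀ ℤ) Q
      = (Multiplicative.toAdd (diffDiv s b)) Q := by rw [hb]; intro Q; rfl
  have hn'0 : ∀ Q, ∑ k ∈ Finset.range p, n' ((s ^ k) Q) = 0 := by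
    intro Q
    simp only [hn', Finsupp.add_apply n, hb']
    rw [Finset.sum_add_distrib, hn, diffDiv_norm s p hs, add_zero]
  have hlt : (∑ P ∈ n'.support, (n' P).natAbs) < (∑ P ∈ n.support, (n P).natAbs) := by
    rw [Finset.sum_subset (Finset.subset_union_left (s₂ := n.support)) (by simp +contextual)]
    rw [Finset.sum_subset (s₁ := n.support) (Finset.subset_union_right (s₁ := n'.support))
      (by simp +contextual)]
    have hval : ∀ Q, n' Q = n Q + ((if (s^k) P = Q then 1 else 0) - (if P = Q then 1 else 0)) := by
      intro Q
      simp [hn', Finsupp.single_apply]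
    apply Finset.sum_lt_sum
    · intro Q _
      rw [hval]
      split_ifs with h1 h2 h2
      · simp
      · subst h1; omega
      · subst h2; omega
      · simp
    · refine ⟨P, ?_, ?_⟩
      · simp; right; omega
      · rw [hval]; simp [hne]; omega
  have := ih _ hlt n' hn'0 rfl
  have h3 := mul_mem this (inv_mem (diffDiv_single_mem s k P 1))
  rw [← ofAdd_neg, ← ofAdd_add] at h3
  have h4 : n' + -(Finsupp.single ((s ^ k) P) 1 - Finsupp.single P 1) = n := by rw [hn']; abel
  rwa [h4] at h3

/-- index of divisors coming from below in the invariant divisors -/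
theorem finsupp_invariant_index {T : Type*} (s : Equiv.Perm S) (p : ℕ) [Fact p.Prime]
    (π : S → T) (hπ : Function.Surjective π) (hfib : ∀ P Q, π P = π Q → ∃ k : ℕ, Q = (s ^ k) P)
    (e : S → ℕ) (he : ∀ P, e P = 1 ∨ (e P = p ∧ s P = P))
    (hfin : {P | e P = p}.Finite)
    (J : Subgroup (Multiplicative (S →₀ ℤ)))
    (hJ : ∀ n, n ∈ J ↔ ∃ m : T → ℤ, ∀ P, (Multiplicative.toAdd n) P = e P * m (π P)) 
    (hπs : ∀ P, π (s P) = π P) (hes : ∀ P, e (s P) = e P) :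
    J ≤ (diffDiv s).ker ∧ J.relIndex (diffDiv s).ker = p ^ Nat.card {P | e P = p} := by
  classical
  have hker : ∀ n, n ∈ (diffDiv s).ker ↔ ∀ P, (Multiplicative.toAdd n) (s P) = (Multiplicative.toAdd n) P := by
    intro n
    rw [MonoidHom.mem_ker]
    constructor
    · intro h P
      have := congrArg (fun x => (Multiplicative.toAdd x) (s P)) h
      simp only [diffDiv_apply] at this
      simp at this
      linarith
    · intro h
      apply Multiplicative.toAdd.injective
      ext P
      rw [diffDiv_apply]
      have := h (s.symm P)
      simp at this
      simp [this]
  have hp1 : p ≠ 1 := (Fact.out : p.Prime).one_lt.ne'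
  have hp0 : p ≠ 0 := (Fact.out : p.Prime).ne_zero
  have hle : J ≤ (diffDiv s).ker := by
    intro n hn
    obtain ⟨m, hm⟩ := (hJ n).1 hn
    rw [hker]
    intro P
    rw [hm, hm, hπs, hes]
  refine ⟨hle, ?_⟩
  let φ : (diffDiv s).ker →* Multiplicative ({P | e P = p} → ZMod p) :=
    { toFun := fun n => Multiplicative.ofAdd (fun P => ((Multiplicative.toAdd (n : Multiplicative (S →₀ ℤ))) (P:S) : ZMod p))
      map_one' := by apply Multiplicative.toAdd.injective; ext P; simp
      map_mul' := by intro a b; apply Multiplicative.toAdd.injective; ext P; simp }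
  have hφk : φ.ker = J.subgroupOf (diffDiv s).ker := by
    ext ⟨n, hn⟩
    rw [MonoidHom.mem_ker, Subgroup.mem_subgroupOf]
    simp only
    rw [hJ]
    have h1 : φ ⟨n, hn⟩ = 1 ↔ ∀ P, e P = p → (p:ℤ) ∣ (Multiplicative.toAdd n) P := by
      constructor
      · intro h P hP
        have := congrFun (congrArg Multiplicative.toAdd h) ⟨P, hP⟩
        simpa [φ, ZMod.intCast_zmod_eq_zero_iff_dvd] using this
      · intro h
        apply Multiplicative.toAdd.injective
        ext P
        have := h P P.2
        simpa [φ, ZMod.intCast_zmod_eq_zero_iff_dvd] using this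
    rw [h1]
    have hinv : ∀ P (k:ℕ), (Multiplicative.toAdd n) ((s^k) P) = (Multiplicative.toAdd n) P := by
      intro P k
      induction k with
      | zero => rfl
      | succ k ih => rw [pow_succ', Equiv.Perm.mul_apply, (hker n).1 hn, ih]
    have heinv : ∀ P (k:ℕ), e ((s^k) P) = e P := by
      intro P k
      induction k with
      | zero => rfl
      | succ k ih => rw [pow_succ', Equiv.Perm.mul_apply, hes, ih]
    constructor
    · intro h
      refine ⟨fun t => (Multiplicative.toAdd n) (Function.surjInv hπ t) / e (Function.surjInv hπ t), ?_⟩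
      intro P
      obtain ⟨k, hk⟩ := hfib P (Function.surjInv hπ (π P)) (Function.surjInv_eq hπ _).symm
      simp only [hk, hinv, heinv]
      rcases he P with h1 | ⟨h1, -⟩
      · simp [h1]
      · rw [h1, Int.mul_ediv_cancel' (h P h1)]
    · rintro ⟨m, hm⟩ P hP
      rw [hm, hP]; exact dvd_mul_right _ _
  have hφs : Function.Surjective φ := by
    intro y
    haveI : Fintype {P | e P = p} := hfin.fintype
    refine ⟨⟨Multiplicative.ofAdd (Finsupp.onFinset hfin.toFinset (fun P => if h : e P = p then
      (((Multiplicative.toAdd y) ⟨P, h⟩ : ZMod p).val : ℤ) else 0) ?_), ?_⟩, ?_⟩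
    · intro P hP
      by_contra hc
      have : ¬ e P = p := by simpa using hc
      simp [this] at hP
    · rw [hker]
      intro P
      rcases he P with h1 | ⟨h1, h2⟩
      · have h3 : e P ≠ p := by rw [h1]; exact hp1.symm
        simp [h3, hes]
      · rw [h2]
    · apply Multiplicative.toAdd.injective
      ext P
      have h : e P = p := P.2
      haveI : NeZero p := ⟨hp0⟩
      simp [φ, h]
  rw [Subgroup.relIndex, ← hφk, Subgroup.index_ker, MonoidHom.range_eq_top.2 hφs]
  haveI : Finite {P | e P = p} := hfin
  have := Nat.card_fun (α := {P | e P = p}) (β := ZMod p)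
  rw [Nat.card_zmod] at this
  rw [← this, Subgroup.card_top]
  rfl
  
end FinsuppPerm

end PartA2

section PartA3

open IsDedekindDomain nonZeroDivisors

section Divisors
variable (F : Type*) [Field F] [NumberField F]

/-- divisor group -/
abbrev Dvs := Multiplicative (HeightOneSpectrum (𝓞 F) →₀ ℤ)

noncomputable def fracToDiv : (FractionalIdeal (𝓞 F)⁰ F)ˣ →* Dvs F where
  toFun I := Multiplicative.ofAdd (Finsupp.ofSupportFinite
    (fun v => FractionalIdeal.count F v (I : FractionalIdeal (𝓞 F)⁰ F))
    (FractionalIdeal.finite_factors (I : FractionalIdeal (𝓞 F)⁰ F)))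
  map_one' := by
    apply Multiplicative.toAdd.injective
    ext v
    simp [Finsupp.ofSupportFinite_coe, FractionalIdeal.count_one]
  map_mul' I J := by
    apply Multiplicative.toAdd.injective
    ext v
    simp [Finsupp.ofSupportFinite_coe, FractionalIdeal.count_mul F v I.ne_zero J.ne_zero]
    rfl

theorem fracToDiv_apply (I : (FractionalIdeal (𝓞 F)⁰ F)ˣ) (v : HeightOneSpectrum (𝓞 F)) :
    (Multiplicative.toAdd (fracToDiv F I)) v = FractionalIdeal.count F v (I : FractionalIdeal (𝓞 F)⁰ F) :=
  rfl

theorem fracToDiv_bij : Function.Bijective (fracToDiv F) := by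
  constructor
  · rw [injective_iff_map_eq_one]
    intro I hI
    ext1
    rw [← FractionalIdeal.finprod_heightOneSpectrum_factorization' F I.ne_zero]
    have : ∀ v, FractionalIdeal.count F v (I : FractionalIdeal (𝓞 F)⁰ F) = 0 := by
      intro v
      rw [← fracToDiv_apply, hI]; rfl
    simp [this]
  · intro n
    have hne : ((Multiplicative.toAdd n).prod (fun (v : HeightOneSpectrum (𝓞 F)) (k : ℤ) => (v.asIdeal : FractionalIdeal (𝓞 F)⁰ F) ^ k)) ≠ 0 := by
      rw [Finsupp.prod, Finset.prod_ne_zero_iff]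
      exact fun v hv ↦ zpow_ne_zero _ (FractionalIdeal.coeIdeal_ne_zero.mpr v.ne_bot)
    refine ⟨Units.mk0 _ hne, ?_⟩
    apply Multiplicative.toAdd.injective
    ext v
    rw [fracToDiv_apply, Units.val_mk0, FractionalIdeal.count_finsuppProd]

noncomputable def fracEquivDiv : (FractionalIdeal (𝓞 F)⁰ F)ˣ ≃* Dvs F :=
  MulEquiv.ofBijective (fracToDiv F) (fracToDiv_bij F)

noncomputable def dvr : Fˣ →* Dvs F := (fracToDiv F).comp (toPrincipalIdeal (𝓞 F) F)

noncomputable def clEquivDiv : ClassGroup (𝓞 F) ≃* Dvs F ⧸ (dvr F).range :=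
  (ClassGroup.equiv F).trans (QuotientGroup.congr _ _ (fracEquivDiv F) (by
    rw [dvr, MonoidHom.range_comp]; rfl))

theorem dvr_val (x : Fˣ) (v : HeightOneSpectrum (𝓞 F)) :
    v.valuation F (x : F) = WithZero.exp (-(Multiplicative.toAdd (dvr F x)) v) := by
  obtain ⟨n, d, hd, hx⟩ := IsFractionRing.div_surjective (A := 𝓞 F) (x : F)
  have hd0 : d ≠ 0 := nonZeroDivisors.ne_zero hd
  have hn0 : n ≠ 0 := by
    rintro rfl
    simp at hx
    exact x.ne_zero hx.symm
  have h1 : (Multiplicative.toAdd (dvr F x)) v = FractionalIdeal.count F v (FractionalIdeal.spanSingleton (𝓞 F)⁰ (x : F)) := by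
    rw [dvr, MonoidHom.comp_apply, fracToDiv_apply, coe_toPrincipalIdeal]
  have h2 := FractionalIdeal.count_well_defined F v (I := FractionalIdeal.spanSingleton (𝓞 F)⁰ (x : F))
    (by rw [ne_eq, FractionalIdeal.spanSingleton_eq_zero_iff]; exact x.ne_zero) (a := d) (J := Ideal.span {n}) (by
      rw [FractionalIdeal.coeIdeal_span_singleton, FractionalIdeal.spanSingleton_mul_spanSingleton, ← hx]
      congr 1; field_simp)
  rw [h1, h2, ← hx, map_div₀, HeightOneSpectrum.valuation_of_algebraMap, HeightOneSpectrum.valuation_of_algebraMap,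
    HeightOneSpectrum.intValuation_if_neg _ hd0, HeightOneSpectrum.intValuation_if_neg _ hn0, ← WithZero.exp_sub]
  congr 1
  ring

theorem dvr_ker (x : Fˣ) : x ∈ (dvr F).ker ↔ ∃ u : (𝓞 F)ˣ, x = Units.map (algebraMap (𝓞 F) F).toMonoidHom u := by
  constructor
  · intro hx
    have h1 : ∀ v : HeightOneSpectrum (𝓞 F), v.valuation F (x : F) = 1 := by
      intro v
      rw [dvr_val, MonoidHom.mem_ker.1 hx]; simp
    obtain ⟨y, hy⟩ := HeightOneSpectrum.mem_integers_of_valuation_le_one F (x : F) (fun v => (h1 v).le)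
    obtain ⟨z, hz⟩ := HeightOneSpectrum.mem_integers_of_valuation_le_one (R := 𝓞 F) F ((x⁻¹ : Fˣ) : F) (fun v => by
      simp [h1 v])
    refine ⟨⟨y, z, ?_, ?_⟩, ?_⟩
    · apply FaithfulSMul.algebraMap_injective (𝓞 F) F
      rw [map_mul, hy, hz]; simp
    · apply FaithfulSMul.algebraMap_injective (𝓞 F) F
      rw [map_mul, hy, hz]; simp
    · ext; simp [hy]
  · rintro ⟨u, rfl⟩
    rw [MonoidHom.mem_ker]
    apply Multiplicative.toAdd.injective
    ext v
    have h1 : v.valuation F ((Units.map (algebraMap (𝓞 F) F).toMonoidHom u : Fˣ) : F) = 1 := by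
      simp only [RingHom.toMonoidHom_eq_coe, Units.coe_map, MonoidHom.coe_coe]
      rw [HeightOneSpectrum.valuation_of_algebraMap]
      rw [HeightOneSpectrum.intValuation_eq_one_iff]
      intro h
      exact v.isPrime.ne_top (Ideal.eq_top_of_isUnit_mem _ h u.isUnit)
    rw [dvr_val, ← WithZero.exp_zero, WithZero.exp_inj] at h1
    simpa using h1

theorem card_cl_eq : (dvr F).range.index = Nat.card (ClassGroup (𝓞 F)) := by
  rw [Subgroup.index]
  exact (Nat.card_congr (clEquivDiv F).toEquiv).symm

end Divisors

end PartA3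

section PartA4

open IsDedekindDomain nonZeroDivisors

section GalSetup
variable {K L : Type*} [Field K] [NumberField K] [Field L] [NumberField L] [Algebra K L]

noncomputable def DL (σ : L ≃ₐ[K] L) : Lˣ →* Lˣ := Units.map (σ : L →* L) / MonoidHom.id _

theorem DL_apply (σ : L ≃ₐ[K] L) (x : Lˣ) : ((DL σ x : Lˣ) : L) = σ x / x := by
  simp [DL, MonoidHom.div_apply]

noncomputable def NL (σ : L ≃ₐ[K] L) (p : ℕ) : Lˣ →* Lˣ :=
  ∏ k ∈ Finset.range p, Units.map ((σ ^ k : L ≃ₐ[K] L) : L →* L)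

theorem NL_apply (σ : L ≃ₐ[K] L) (p : ℕ) (x : Lˣ) :
    ((NL σ p x : Lˣ) : L) = ∏ k ∈ Finset.range p, (σ ^ k) (x : L) := by
  rw [NL, MonoidHom.finset_prod_apply, Units.coe_prod]
  rfl

/-- permutation of primes -/
noncomputable def sP (σ : L ≃ₐ[K] L) : Equiv.Perm (HeightOneSpectrum (𝓞 L)) :=
  HeightOneSpectrum.equivOfRingEquiv (RingOfIntegers.mapRingEquiv σ.toRingEquiv)

theorem mem_sP (σ : L ≃ₐ[K] L) (P : HeightOneSpectrum (𝓞 L)) (x : 𝓞 L) :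
    x ∈ (sP σ P).asIdeal ↔ RingOfIntegers.mapRingEquiv σ.symm.toRingEquiv x ∈ P.asIdeal := Iff.rfl

theorem sP_mul (σ τ : L ≃ₐ[K] L) : sP (σ * τ) = sP σ * sP τ := by
  ext P x
  simp only [Equiv.Perm.mul_apply, mem_sP]
  rfl

theorem sP_one : sP (1 : L ≃ₐ[K] L) = 1 := by
  ext P x
  simp only [mem_sP]
  rfl

theorem sP_pow (σ : L ≃ₐ[K] L) (k : ℕ) : sP (σ ^ k) = sP σ ^ k := by
  induction k with
  | zero => simp [sP_one]
  | succ k ih => rw [pow_succ, pow_succ, sP_mul, ih]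

theorem mem_sP_pow (σ : L ≃ₐ[K] L) (P : HeightOneSpectrum (𝓞 L)) (x : 𝓞 L) (n : ℕ) :
    RingOfIntegers.mapRingEquiv σ.toRingEquiv x ∈ (sP σ P).asIdeal ^ n ↔ x ∈ P.asIdeal ^ n := by
  have h : (sP σ P).asIdeal = P.asIdeal.map (RingOfIntegers.mapRingEquiv σ.toRingEquiv) := by
    rw [← Ideal.comap_symm]; rfl
  rw [h, ← Ideal.map_pow, ← Ideal.comap_symm, Ideal.mem_comap]
  simp

theorem intval_sP (σ : L ≃ₐ[K] L) (P : HeightOneSpectrum (𝓞 L)) (x : 𝓞 L) :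
    (sP σ P).intValuation (RingOfIntegers.mapRingEquiv σ.toRingEquiv x) = P.intValuation x := by
  by_cases hx : x = 0
  · simp [hx]
  have hx' : RingOfIntegers.mapRingEquiv σ.toRingEquiv x ≠ 0 := by simpa using hx
  have key : ∀ n : ℕ, (sP σ P).intValuation (RingOfIntegers.mapRingEquiv σ.toRingEquiv x) ≤ WithZero.exp (-(n:ℤ))
      ↔ P.intValuation x ≤ WithZero.exp (-(n:ℤ)) := by
    intro n
    rw [HeightOneSpectrum.intValuation_le_pow_iff_mem, HeightOneSpectrum.intValuation_le_pow_iff_mem, mem_sP_pow]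
  have h1 := HeightOneSpectrum.intValuation_eq_exp_neg_multiplicity P hx
  have h2 := HeightOneSpectrum.intValuation_eq_exp_neg_multiplicity (sP σ P) hx'
  apply le_antisymm
  · rw [h1, key, h1]
  · rw [h2, ← key, h2]

theorem val_sP (σ : L ≃ₐ[K] L) (P : HeightOneSpectrum (𝓞 L)) (x : L) :
    (sP σ P).valuation L (σ x) = P.valuation L x := by
  obtain ⟨n, d, hd, rfl⟩ := IsFractionRing.div_surjective (A := 𝓞 L) x
  have h : ∀ y : 𝓞 L, σ (algebraMap (𝓞 L) L y) = algebraMap (𝓞 L) L (RingOfIntegers.mapRingEquiv σ.toRingEquiv y) :=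
    fun y => rfl
  rw [map_div₀, map_div₀, map_div₀, h, h]
  simp only [HeightOneSpectrum.valuation_of_algebraMap, intval_sP]

theorem dvr_sigma (σ : L ≃ₐ[K] L) (x : Lˣ) (P : HeightOneSpectrum (𝓞 L)) :
    (Multiplicative.toAdd (dvr L (Units.map (σ : L →* L) x))) P = (Multiplicative.toAdd (dvr L x)) ((sP σ).symm P) := by
  have h1 := dvr_val L (Units.map (σ : L →* L) x) P
  have h2 := dvr_val L x ((sP σ).symm P)
  have h3 := val_sP σ ((sP σ).symm P) (x : L)
  rw [Equiv.apply_symm_apply, h2] at h3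
  have h4 : P.valuation L ((Units.map (σ : L →* L) x : Lˣ) : L) = P.valuation L (σ (x:L)) := rfl
  rw [h4, h3, WithZero.exp_inj] at h1
  linarith

theorem diffDiv_dvr (σ : L ≃ₐ[K] L) (x : Lˣ) : diffDiv (sP σ) (dvr L x) = dvr L (DL σ x) := by
  rw [DL, MonoidHom.div_apply, _root_.map_div, MonoidHom.id_apply]
  apply Multiplicative.toAdd.injective
  ext P
  rw [diffDiv_apply, toAdd_div, Finsupp.sub_apply, dvr_sigma]

theorem ker_NL_eq (σ : L ≃ₐ[K] L) (p : ℕ) (hσ : orderOf σ = p) (hp : 0 < p) : (NL σ p).ker = (DL σ).range := by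
  have hσp : σ ^ p = 1 := by rw [← hσ]; exact pow_orderOf_eq_one σ
  apply le_antisymm
  · intro x hx
    have hx1 : ∏ k ∈ Finset.range p, (σ ^ k) (x : L) = 1 := by
      rw [← NL_apply, MonoidHom.mem_ker.1 hx]; rfl
    let c : ℕ → L := fun i => ∏ k ∈ Finset.range i, (σ ^ k) (x : L)
    have hc : ∀ i, (x : L) * σ (c i) = c (i+1) := by
      intro i
      simp only [c]
      rw [Finset.prod_range_succ', map_prod]
      simp only [pow_succ', AlgEquiv.mul_apply, pow_zero, AlgEquiv.one_apply]
      rw [mul_comm]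
    have hcne : ∀ i, c i ≠ 0 := by
      intro i
      simp only [c]
      rw [Finset.prod_ne_zero_iff]
      intro k _
      exact (map_ne_zero (σ ^ k)).2 x.ne_zero
    -- Dedekind independence
    have hli : LinearIndependent L (fun i : Fin p => (((σ ^ (i : ℕ) : L ≃ₐ[K] L) : L →* L) : L → L)) := by
      have := (linearIndependent_monoidHom L L).comp (fun i : Fin p => ((σ ^ (i : ℕ) : L ≃ₐ[K] L) : L →* L)) (by
        intro i j hij
        have h2 : σ ^ (i:ℕ) = σ ^ (j:ℕ) := by
          ext y
          exact DFunLike.congr_fun hij y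
        have := pow_injOn_Iio_orderOf (x := σ) (by simp [hσ]) (by simp [hσ]) h2
        exact Fin.ext this)
      exact this
    have hex : ∃ θ : L, ∑ i ∈ Finset.range p, c i * (σ ^ i) θ ≠ 0 := by
      by_contra hcon
      push Not at hcon
      rw [Fintype.linearIndependent_iff] at hli
      have := hli (fun i => c i) (by
        ext θ
        have := hcon θ
        rw [Finset.sum_range] at this
        simpa using this) ⟨0, hp⟩
      exact hcne _ this
    obtain ⟨θ, hθ⟩ := hex
    set b := ∑ i ∈ Finset.range p, c i * (σ ^ i) θ with hb
    have hxb : (x : L) * σ b = b := by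
      rw [hb, map_sum, Finset.mul_sum]
      have : ∀ i, (x:L) * σ (c i * (σ ^ i) θ) = (fun i => c i * (σ ^ i) θ) (i+1) := by
        intro i
        simp only
        rw [map_mul, ← mul_assoc, hc, pow_succ', AlgEquiv.mul_apply]
      rw [Finset.sum_congr rfl (fun i _ => this i)]
      have h3 := Finset.sum_range_succ (fun i => c i * (σ ^ i) θ) p
      have h4 := Finset.sum_range_succ' (fun i => c i * (σ ^ i) θ) p
      rw [h3] at h4
      have h5 : c p * (σ ^ p) θ = c 0 * (σ ^ 0) θ := by
        simp only [c]; rw [hx1, hσp]; simp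
      rw [h5] at h4
      exact (add_right_cancel h4).symm
    refine ⟨(Units.mk0 b hθ)⁻¹, ?_⟩
    ext
    rw [DL_apply]
    have hsb : σ b ≠ 0 := by simpa using hθ
    simp
    rw [inv_mul_eq_iff_eq_mul₀ hsb, mul_comm, hxb]
  · rintro _ ⟨x, rfl⟩
    rw [MonoidHom.mem_ker]
    ext
    rw [NL_apply]
    simp only [DL_apply, map_div₀]
    have : ∀ k, (σ ^ k) (σ (x:L)) = (σ ^ (k+1)) (x : L) := by
      intro k; rw [pow_succ, AlgEquiv.mul_apply]
    simp only [this, Finset.prod_div_distrib]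
    have h3 := Finset.prod_range_succ (fun i => (σ ^ i) (x:L)) p
    have h4 := Finset.prod_range_succ' (fun i => (σ ^ i) (x:L)) p
    rw [h3, hσp] at h4
    have : ∏ k ∈ Finset.range p, (σ ^ (k+1)) (x : L) = ∏ k ∈ Finset.range p, (σ ^ k) (x : L) := by
      apply mul_right_cancel₀ (b := (x : L)) x.ne_zero
      simpa using h4.symm
    rw [this, div_self]
    · rfl
    · rw [Finset.prod_ne_zero_iff]; exact fun k _ => (map_ne_zero (σ ^ k)).2 x.ne_zero

theorem NL_dvr (σ : L ≃ₐ[K] L) (p : ℕ) (hσ : σ ^ p = 1) (x : Lˣ) (P : HeightOneSpectrum (𝓞 L)) :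
    (Multiplicative.toAdd (dvr L (NL σ p x))) P
      = ∑ k ∈ Finset.range p, (Multiplicative.toAdd (dvr L x)) (((sP σ) ^ k) P) := by
  have h1 : (Multiplicative.toAdd (dvr L (NL σ p x))) P = ∑ k ∈ Finset.range p, (Multiplicative.toAdd (dvr L x)) (((sP σ) ^ k).symm P) := by
    rw [NL, MonoidHom.finset_prod_apply, map_prod, toAdd_prod, Finsupp.finset_sum_apply]
    refine Finset.sum_congr rfl fun k _ => ?_
    rw [dvr_sigma, sP_pow]
  rw [h1]
  rcases Nat.eq_zero_or_pos p with rfl | hp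
  · simp
  have hs : (sP σ) ^ p = 1 := by rw [← sP_pow, hσ, sP_one]
  -- reindex k -> (p - k) mod p
  obtain ⟨q, rfl⟩ : ∃ q, p = q + 1 := ⟨p - 1, by omega⟩
  rw [Finset.sum_range_succ', Finset.sum_range_succ', ← Finset.sum_range_reflect]
  simp only [pow_zero, Equiv.Perm.one_apply]
  congr 1
  refine Finset.sum_congr rfl fun k hk => ?_
  congr 1
  rw [Equiv.symm_apply_eq, ← Equiv.Perm.mul_apply, ← pow_add]
  have := Finset.mem_range.1 hk
  rw [show q - 1 - k + 1 + (k+1) = q + 1 by omega, hs]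
  rfl

end GalSetup

end PartA4

section PartA5

open IsDedekindDomain nonZeroDivisors
open scoped Pointwise

section Below
variable {K L : Type*} [Field K] [NumberField K] [Field L] [NumberField L] [Algebra K L]

variable (K) in
/-- prime below -/
noncomputable def prBelow (P : HeightOneSpectrum (𝓞 L)) : HeightOneSpectrum (𝓞 K) :=
  HeightOneSpectrum.under (𝓞 K) P

instance prBelow_liesOver (P : HeightOneSpectrum (𝓞 L)) : P.asIdeal.LiesOver (prBelow K P).asIdeal :=
  ⟨rfl⟩

theorem mem_prBelow (P : HeightOneSpectrum (𝓞 L)) (x : 𝓞 K) :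
    x ∈ (prBelow K P).asIdeal ↔ algebraMap (𝓞 K) (𝓞 L) x ∈ P.asIdeal := Iff.rfl

variable (K) in
noncomputable def ram (P : HeightOneSpectrum (𝓞 L)) : ℕ :=
  (prBelow K P).asIdeal.ramificationIdx' P.asIdeal

theorem ram_ne_zero (P : HeightOneSpectrum (𝓞 L)) : ram K P ≠ 0 :=
  Ideal.IsDedekindDomain.ramificationIdx'_ne_zero_of_liesOver P.asIdeal (prBelow K P).ne_bot

theorem val_below (P : HeightOneSpectrum (𝓞 L)) (x : K) :
    P.valuation L (algebraMap K L x) = (prBelow K P).valuation K x ^ ram K P :=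
  (HeightOneSpectrum.valuation_liesOver L (prBelow K P) P x).symm

theorem prBelow_sP (σ : L ≃ₐ[K] L) (P : HeightOneSpectrum (𝓞 L)) : prBelow K (sP σ P) = prBelow K P := by
  ext x
  rw [mem_prBelow, mem_prBelow, mem_sP]
  have : RingOfIntegers.mapRingEquiv σ.symm.toRingEquiv (algebraMap (𝓞 K) (𝓞 L) x) = algebraMap (𝓞 K) (𝓞 L) x := by
    ext
    exact σ.symm.commutes (x : K)
  rw [this]

theorem ram_sP (σ : L ≃ₐ[K] L) (P : HeightOneSpectrum (𝓞 L)) : ram K (sP σ P) = ram K P := by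
  obtain ⟨π, hπ⟩ := HeightOneSpectrum.valuation_exists_uniformizer K (prBelow K P)
  have h1 := val_below (sP σ P) π
  have h2 := val_below P π
  have h3 := val_sP σ P (algebraMap K L π)
  rw [AlgEquiv.commutes, h1, h2, prBelow_sP, hπ, ← WithZero.exp_nsmul, ← WithZero.exp_nsmul, WithZero.exp_inj] at h3
  simpa using h3

theorem prBelow_surj : Function.Surjective (prBelow K : HeightOneSpectrum (𝓞 L) → HeightOneSpectrum (𝓞 K)) := by
  intro v
  obtain ⟨Q, hQ, hlo⟩ := Ideal.exists_maximal_ideal_liesOver_of_isIntegral (S := 𝓞 L) v.asIdeal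
  refine ⟨⟨Q, hQ.isPrime, ?_⟩, ?_⟩
  · exact Ideal.ne_bot_of_liesOver_of_ne_bot v.ne_bot Q
  · ext1
    exact hlo.over.symm

theorem sP_smul [IsGalois K L] (σ : L ≃ₐ[K] L) (P : HeightOneSpectrum (𝓞 L)) : (sP σ P).asIdeal = σ • P.asIdeal := by
  ext x
  rw [mem_sP, Ideal.mem_pointwise_smul_iff_inv_smul_mem]
  rfl

theorem exists_sP_of_below [IsGalois K L] (P Q : HeightOneSpectrum (𝓞 L)) (h : prBelow K P = prBelow K Q) :
    ∃ τ : L ≃ₐ[K] L, Q = sP τ P := by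
  haveI := IsGaloisGroup.of_isFractionRing Gal(L/K) (𝓞 K) (𝓞 L) K L
  haveI : Q.asIdeal.LiesOver (prBelow K P).asIdeal := by rw [h]; infer_instance
  obtain ⟨τ, hτ⟩ := Ideal.exists_smul_eq_of_isGaloisGroup (prBelow K P).asIdeal P.asIdeal Q.asIdeal Gal(L/K)
  refine ⟨τ, ?_⟩
  ext1
  rw [sP_smul, hτ]

theorem ram_dvd [IsGalois K L] (P : HeightOneSpectrum (𝓞 L)) :
    ((prBelow K P).asIdeal.primesOver (𝓞 L)).ncard * ram K P ∣ Module.finrank K L := by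
  haveI := IsGaloisGroup.of_isFractionRing Gal(L/K) (𝓞 K) (𝓞 L) K L
  have h := Ideal.ncard_primesOver_mul_ramificationIdxIn_mul_inertiaDegIn (prBelow K P).asIdeal (𝓞 L) Gal(L/K)
  rw [Ideal.ramificationIdxIn_eq_ramificationIdx (prBelow K P).asIdeal P.asIdeal Gal(L/K)] at h
  rw [IsGalois.card_aut_eq_finrank] at h
  have h2 : ram K P = P.asIdeal.ramificationIdx (𝓞 K) := by
    apply Ideal.ramificationIdx'_eq_ramificationIdx'
    exact Ideal.map_ne_bot_of_ne_bot (prBelow K P).ne_bot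
  rw [h2, ← h, ← mul_assoc]
  exact dvd_mul_right _ _

theorem ram_cases [IsGalois K L] (p : ℕ) (hp : p.Prime) (hdeg : Module.finrank K L = p) (σ : L ≃ₐ[K] L)
    (P : HeightOneSpectrum (𝓞 L)) : ram K P = 1 ∨ (ram K P = p ∧ sP σ P = P) := by
  have h := ram_dvd (K := K) P
  rw [hdeg] at h
  rcases (Nat.dvd_prime hp).1 ((dvd_mul_left _ _).trans h) with h1 | h1
  · exact Or.inl h1
  · refine Or.inr ⟨h1, ?_⟩
    rw [h1] at h
    have hc : ((prBelow K P).asIdeal.primesOver (𝓞 L)).ncard = 1 := by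
      have h2 := Nat.le_of_dvd hp.pos h
      have h3 : ((prBelow K P).asIdeal.primesOver (𝓞 L)).ncard ≠ 0 := by
        intro h0
        rw [h0, zero_mul, zero_dvd_iff] at h
        exact hp.ne_zero h
      have := hp.pos
      nlinarith [Nat.pos_of_ne_zero h3]
    obtain ⟨Q, hQ⟩ := Set.ncard_eq_one.1 hc
    have e1 : P.asIdeal ∈ (prBelow K P).asIdeal.primesOver (𝓞 L) := ⟨P.isPrime, inferInstance⟩
    have e2 : (sP σ P).asIdeal ∈ (prBelow K P).asIdeal.primesOver (𝓞 L) :=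
      ⟨(sP σ P).isPrime, by rw [← prBelow_sP σ P]; infer_instance⟩
    rw [hQ] at e1 e2
    ext1
    rw [e2, e1]

theorem sigma_gen [IsGalois K L] (p : ℕ) (hp : p.Prime) (hdeg : Module.finrank K L = p) (σ : L ≃ₐ[K] L)
    (hσ : orderOf σ = p) (τ : L ≃ₐ[K] L) : ∃ k : ℕ, τ = σ ^ k := by
  have h : Nat.card (Subgroup.zpowers σ) = Nat.card (L ≃ₐ[K] L) := by
    rw [Nat.card_zpowers, hσ, IsGalois.card_aut_eq_finrank, hdeg]
  have h2 := Subgroup.eq_top_of_card_eq _ h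
  have h3 : τ ∈ Subgroup.zpowers σ := by rw [h2]; trivial
  rw [← mem_powers_iff_mem_zpowers] at h3
  obtain ⟨k, hk⟩ := h3
  exact ⟨k, hk.symm⟩

variable (K L) in
/-- extension of divisors -/
noncomputable def liftDiv [IsGalois K L] : Dvs K →* Dvs L :=
  AddMonoidHom.toMultiplicative
  { toFun := fun m => Finsupp.ofSupportFinite (fun P : HeightOneSpectrum (𝓞 L) => (ram K P : ℤ) * m (prBelow K P)) (by
      have : (Function.support fun P : HeightOneSpectrum (𝓞 L) => (ram K P : ℤ) * m (prBelow K P)) ⊆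
          ⋃ v ∈ m.support, (prBelow K ⁻¹' {v}) := by
        intro P hP
        simp only [Function.mem_support, ne_eq, mul_eq_zero, not_or] at hP
        simp [hP.2]
      refine Set.Finite.subset (Set.Finite.biUnion m.support.finite_toSet ?_) this
      intro v _
      obtain ⟨P, rfl⟩ := prBelow_surj (L := L) v
      refine (Set.finite_range (fun τ : L ≃ₐ[K] L => sP τ P)).subset ?_
      intro Q hQ
      obtain ⟨τ, hτ⟩ := exists_sP_of_below P Q hQ.symm
      exact ⟨τ, hτ.symm⟩)
    map_zero' := by ext P; simp [Finsupp.ofSupportFinite_coe]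
    map_add' := by intro a b; ext P; simp [Finsupp.ofSupportFinite_coe, mul_add] }

theorem liftDiv_apply [IsGalois K L] (m : Dvs K) (P : HeightOneSpectrum (𝓞 L)) :
    (Multiplicative.toAdd (liftDiv K L m)) P = ram K P * (Multiplicative.toAdd m) (prBelow K P) := rfl

theorem liftDiv_inj [IsGalois K L] : Function.Injective (liftDiv K L) := by
  rw [injective_iff_map_eq_one]
  intro m hm
  apply Multiplicative.toAdd.injective
  ext v
  obtain ⟨P, rfl⟩ := prBelow_surj (L := L) v
  have h := liftDiv_apply m P
  rw [hm] at h
  simp [ram_ne_zero] at h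
  simpa using h

theorem liftDiv_dvr [IsGalois K L] (x : Kˣ) :
    liftDiv K L (dvr K x) = dvr L (Units.map (algebraMap K L : K →* L) x) := by
  apply Multiplicative.toAdd.injective
  ext P
  rw [liftDiv_apply]
  have h1 := dvr_val L (Units.map (algebraMap K L : K →* L) x) P
  have h2 : P.valuation L ((Units.map (algebraMap K L : K →* L) x : Lˣ) : L) = _ := val_below P (x : K)
  rw [h2, dvr_val, ← WithZero.exp_nsmul, WithZero.exp_inj] at h1
  simp at h1
  linarith

theorem ker_DL [IsGalois K L] (p : ℕ) (hp : p.Prime) (hdeg : Module.finrank K L = p) (σ : L ≃ₐ[K] L)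
    (hσ : orderOf σ = p) : (DL σ).ker = (Units.map (algebraMap K L : K →* L)).range := by
  ext x
  rw [MonoidHom.mem_ker]
  constructor
  · intro h
    have h1 : σ (x : L) = x := by
      have := congrArg (fun y : Lˣ => (y : L)) h
      simp only [DL_apply] at this
      rw [div_eq_iff x.ne_zero] at this
      simpa using this
    have h2 : ∀ τ : L ≃ₐ[K] L, τ (x : L) = x := by
      intro τ
      obtain ⟨k, rfl⟩ := sigma_gen p hp hdeg σ hσ τ
      induction k with
      | zero => rfl
      | succ k ih => rw [pow_succ, AlgEquiv.mul_apply, h1, ih]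
    obtain ⟨y, hy⟩ := (IsGalois.mem_bot_iff_fixed (F := K) (x : L)).2 h2
    have hy0 : y ≠ 0 := by
      rintro rfl
      apply x.ne_zero
      rw [← hy]; simp
    exact ⟨Units.mk0 y hy0, by ext; exact hy⟩
  · rintro ⟨y, rfl⟩
    ext
    rw [DL_apply]
    simp

theorem ambig_main [IsGalois K L] (p : ℕ) (hp : p.Prime) (hdeg : Module.finrank K L = p) (σ : L ≃ₐ[K] L)
    (hσ : orderOf σ = p) (hfin : {P : HeightOneSpectrum (𝓞 L) | ram K P = p}.Finite) :
    (dvr L).range.relIndex ((dvr L).range.comap (diffDiv (sP σ))) *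
      ((dvr L).ker.map (DL σ)).relIndex ((dvr L).ker ⊓ (NL σ p).ker) =
    ((dvr L).ker.map (NL σ p)).relIndex ((dvr L).ker ⊓ (NL σ p).range) *
      p ^ Nat.card {P : HeightOneSpectrum (𝓞 L) | ram K P = p} * Nat.card (ClassGroup (𝓞 K)) := by
  haveI : Fact p.Prime := ⟨hp⟩
  have hσp : σ ^ p = 1 := by rw [← hσ]; exact pow_orderOf_eq_one σ
  have hs : (sP σ) ^ p = 1 := by rw [← sP_pow, hσp, sP_one]
  obtain ⟨hle, hidx⟩ := finsupp_invariant_index (sP σ) p (prBelow K) prBelow_surj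
    (by
      intro P Q h
      obtain ⟨τ, hτ⟩ := exists_sP_of_below P Q h
      obtain ⟨k, rfl⟩ := sigma_gen p hp hdeg σ hσ τ
      exact ⟨k, by rw [hτ, sP_pow]⟩) (ram K) (ram_cases p hp hdeg σ) hfin (liftDiv K L).range
    (by
      intro n
      constructor
      · rintro ⟨m, rfl⟩
        exact ⟨fun v => (Multiplicative.toAdd m) v, fun P => liftDiv_apply m P⟩
      · rintro ⟨m, hm⟩
        have hmf : (Function.support m).Finite := by
          have : Function.support m ⊆ (prBelow K (L := L)) '' (Function.support (fun P => (Multiplicative.toAdd n) P)) := by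
            intro v hv
            obtain ⟨P, rfl⟩ := prBelow_surj (L := L) v
            refine ⟨P, ?_, rfl⟩
            rw [Function.mem_support, hm]
            exact mul_ne_zero (by exact_mod_cast ram_ne_zero P) hv
          exact ((Finsupp.finite_support (Multiplicative.toAdd n)).image _).subset this
        refine ⟨Multiplicative.ofAdd (Finsupp.ofSupportFinite m hmf), ?_⟩
        apply Multiplicative.toAdd.injective
        ext P
        rw [liftDiv_apply, hm]; rfl)
    (prBelow_sP σ) (ram_sP σ)
  have hPK : (DL σ).ker.map (dvr L) = (dvr K).range.map (liftDiv K L) := by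
    rw [ker_DL p hp hdeg σ hσ, ← MonoidHom.range_comp, ← MonoidHom.range_comp]
    congr 1
    ext1 x
    exact (liftDiv_dvr x).symm
  have h := ambig_abs (DL σ) (NL σ p) (diffDiv (sP σ)) (dvr L) (liftDiv K L).range
    (ker_NL_eq σ p hσ hp.pos) (diffDiv_dvr σ)
    (by
      intro x
      rw [MonoidHom.mem_ker]
      constructor
      · intro h
        have := finsupp_H90 (sP σ) p hp.pos hs (Multiplicative.toAdd (dvr L x)) (by
          intro P
          rw [← NL_dvr σ p hσp, h]; rfl)
        exact this
      · rintro ⟨b, hb⟩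
        apply Multiplicative.toAdd.injective
        ext P
        rw [NL_dvr σ p hσp, ← hb, diffDiv_norm (sP σ) p hs]; rfl)
    hle (by rw [hPK]; exact Subgroup.map_le_range _ _)
  rw [hidx, hPK] at h
  rw [h]
  congr 1
  rw [MonoidHom.range_eq_map (liftDiv K L), Subgroup.relIndex_map_map_of_injective _ _ liftDiv_inj, Subgroup.relIndex_top_right,
    card_cl_eq]

end Below

end PartA5

section PartA6

theorem nsmul_index_abs {M : Type*} [AddCommGroup M] [Module.Finite ℤ M] (p : ℕ) (hp : p ≠ 0) :
    (nsmulAddMonoidHom (α := M) p).range.index = p ^ Module.finrank ℤ M * Nat.card (nsmulAddMonoidHom (α := M) p).ker := by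
  classical
  let T : Submodule ℤ M := Submodule.torsion ℤ M
  haveI : Finite T := by
    haveI : Module.Finite ℤ T := inferInstance
    exact Module.finite_of_fg_torsion T (Submodule.torsion_isTorsion)
  have hTmem : ∀ x : M, x ∈ T ↔ IsOfFinAddOrder x := by
    intro x
    rw [Submodule.mem_torsion_iff, isOfFinAddOrder_iff_zsmul_eq_zero]
    constructor
    · rintro ⟨a, ha⟩; exact ⟨a, nonZeroDivisors.ne_zero a.2, ha⟩
    · rintro ⟨a, h, ha⟩; exact ⟨⟨a, mem_nonZeroDivisors_of_ne_zero h⟩, ha⟩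
  have hfree : (nsmulAddMonoidHom (α := M ⧸ T) p).range.index = p ^ Module.finrank ℤ M := by
    haveI : Module.Free ℤ (M ⧸ T) := inferInstance
    rw [AddSubgroup.index_range_nsmul]
    congr 1
    exact finrank_quotient_eq_of_le_torsion le_rfl
  let q : M →+ M ⧸ T := (Submodule.mkQ T).toAddMonoidHom
  have hq : Function.Surjective q := Submodule.mkQ_surjective T
  have hqk : q.ker = T.toAddSubgroup := by
    ext x
    rw [AddMonoidHom.mem_ker]
    exact Submodule.Quotient.mk_eq_zero T
  have h1 : (nsmulAddMonoidHom (α := M ⧸ T) p).range = (nsmulAddMonoidHom (α := M) p).range.map q := by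
    ext x
    constructor
    · rintro ⟨y, rfl⟩
      obtain ⟨z, rfl⟩ := hq y
      exact ⟨p • z, ⟨z, rfl⟩, map_nsmul q p z⟩
    · rintro ⟨_, ⟨z, rfl⟩, rfl⟩
      exact ⟨q z, (map_nsmul q p z).symm⟩
  rw [h1, AddSubgroup.index_map, AddMonoidHom.range_eq_top.2 hq, AddSubgroup.index_top, mul_one, hqk] at hfree
  rw [← hfree, ← AddSubgroup.relIndex_mul_index (le_sup_left : (nsmulAddMonoidHom (α := M) p).range ≤ _ ⊔ T.toAddSubgroup),
    AddSubgroup.relIndex_sup_left, mul_comm]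
  congr 1
  have h2 : (nsmulAddMonoidHom (α := M) p).range.addSubgroupOf T.toAddSubgroup = (nsmulAddMonoidHom (α := T.toAddSubgroup) p).range := by
    ext x
    rw [AddSubgroup.mem_addSubgroupOf]
    constructor
    · rintro ⟨y, hy⟩
      have : y ∈ T := by
        rw [hTmem]
        have hx := (hTmem x).1 x.2
        rw [← hy] at hx
        exact (isOfFinAddOrder_nsmul.1 hx).resolve_right hp
      exact ⟨⟨y, this⟩, Subtype.ext hy⟩
    · rintro ⟨y, rfl⟩
      exact ⟨y, rfl⟩
  haveI : Finite T.toAddSubgroup := ‹Finite T›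
  rw [AddSubgroup.relIndex, h2, AddSubgroup.index_range]
  refine Nat.card_congr ⟨fun x => ⟨x.1.1, ?_⟩, fun x => ⟨⟨x.1, ?_⟩, ?_⟩, fun x => rfl, fun x => rfl⟩
  · exact congrArg Subtype.val x.2
  · have : x.1 ∈ T := by
      rw [hTmem]
      exact isOfFinAddOrder_iff_nsmul_eq_zero.2 ⟨p, Nat.pos_of_ne_zero hp, x.2⟩
    exact this
  · exact Subtype.ext x.2

theorem pow_index_abs {M : Type*} [CommGroup M] [Module.Finite ℤ (Additive M)] (p : ℕ) (hp : p ≠ 0) :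
    (powMonoidHom (α := M) p).range.index = p ^ Module.finrank ℤ (Additive M) * Nat.card (powMonoidHom (α := M) p).ker := by
  have := nsmul_index_abs (M := Additive M) p hp
  exact this

@[to_additive add_chi_mul]
theorem chi_mul {M : Type*} [CommGroup M] (f g : M →* M) (hf : Finite f.ker) :
    (f.comp g).range.index * (Nat.card f.ker * Nat.card g.ker) = f.range.index * g.range.index * Nat.card (f.comp g).ker := by
  have e1 : (f.comp g).range = g.range.map f := MonoidHom.range_comp f g
  have h1 : (f.comp g).range.index = (g.range ⊔ f.ker).index * f.range.index := by
    rw [e1, Subgroup.index_map]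
  have h2 : g.range.index = g.range.relIndex f.ker * (g.range ⊔ f.ker).index := by
    rw [← Subgroup.relIndex_mul_index (le_sup_left : g.range ≤ g.range ⊔ f.ker), Subgroup.relIndex_sup_left]
  have h3 : Nat.card f.ker = Nat.card (g.range ⊓ f.ker : Subgroup M) * g.range.relIndex f.ker := by
    rw [← Subgroup.relIndex_bot_left, ← Subgroup.relIndex_bot_left,
      ← Subgroup.inf_relIndex_right g.range, Subgroup.relIndex_mul_relIndex _ _ _ bot_le inf_le_right]
  have h4 : Nat.card (f.comp g).ker = Nat.card g.ker * Nat.card (g.range ⊓ f.ker : Subgroup M) := by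
    have : (f.comp g).ker.map g = g.range ⊓ f.ker := by
      ext x
      simp only [Subgroup.mem_map, MonoidHom.mem_ker, MonoidHom.comp_apply, Subgroup.mem_inf, MonoidHom.mem_range]
      constructor
      · rintro ⟨y, h, rfl⟩; exact ⟨⟨y, rfl⟩, h⟩
      · rintro ⟨⟨y, rfl⟩, h⟩; exact ⟨y, h, rfl⟩
    rw [← this, ← Subgroup.relIndex_ker, ← Subgroup.relIndex_bot_left, ← Subgroup.relIndex_bot_left,
      Subgroup.relIndex_mul_relIndex _ _ _ bot_le]
    intro x hx
    rw [MonoidHom.mem_ker] at *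
    simp [hx]
  rw [h1, h2, h4, h3]
  ring

@[to_additive add_finite_ker_comp]
theorem finite_ker_comp {M : Type*} [CommGroup M] (f g : M →* M) (hf : Finite f.ker) (hg : Finite g.ker) :
    Finite (f.comp g).ker := by
  have h : ((f.comp g).ker : Set M) = g ⁻¹' (f.ker : Set M) := by
    ext x; simp [MonoidHom.mem_ker]
  have h2 : ((f.comp g).ker : Set M).Finite := by
    rw [h]
    refine Set.Finite.preimage' (Set.toFinite _) ?_
    intro b _
    by_cases hb : ∃ a, g a = b
    · obtain ⟨a, rfl⟩ := hb
      refine ((Set.toFinite (g.ker : Set M)).image (fun x => x * a)).subset ?_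
      intro x hx
      refine ⟨x / a, ?_, by simp⟩
      simp only [SetLike.mem_coe, MonoidHom.mem_ker, _root_.map_div]
      have : g x = g a := hx
      rw [this]; simp
    · have : g ⁻¹' {b} = ∅ := by
        ext x
        simp only [Set.mem_preimage, Set.mem_singleton_iff, Set.mem_empty_iff_false, iff_false]
        intro hx; exact hb ⟨x, hx⟩
      rw [this]; exact Set.finite_empty
  exact h2

@[to_additive add_chi_pow]
theorem chi_pow {M : Type*} [CommGroup M] (f : M →* M) (hf : Finite f.ker) (F : ℕ → M →* M) (h0 : F 0 = MonoidHom.id M)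
    (hF : ∀ k, F (k+1) = f.comp (F k)) (k : ℕ) :
    (F k).range.index * Nat.card f.ker ^ k = f.range.index ^ k * Nat.card (F k).ker := by
  induction k with
  | zero =>
    rw [h0]
    have : (MonoidHom.id M).range = ⊤ := MonoidHom.range_eq_top.2 Function.surjective_id
    have h2 : (MonoidHom.id M).ker = ⊥ := (MonoidHom.ker_eq_bot_iff _).2 Function.injective_id
    rw [this, h2]; simp
  | succ k ih =>
    have h := chi_mul f (F k) hf
    rw [← hF] at h
    have hk : Nat.card (F k).ker ≠ 0 := by
      have hfin : ∀ j, Finite (F j).ker := by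
        intro j
        induction j with
        | zero =>
          rw [h0]
          have h2 : (MonoidHom.id M).ker = ⊥ := (MonoidHom.ker_eq_bot_iff _).2 Function.injective_id
          rw [h2]; infer_instance
        | succ j ihj =>
          rw [hF]; exact finite_ker_comp f (F j) hf ihj
      haveI := hfin k
      exact Nat.card_pos.ne'
    · apply Nat.eq_of_mul_eq_mul_right (Nat.pos_of_ne_zero hk)
      calc _ = ((F (k+1)).range.index * (Nat.card f.ker * Nat.card (F k).ker)) * Nat.card f.ker ^ k := by ring
        _ = f.range.index * ((F k).range.index * Nat.card f.ker ^ k) * Nat.card (F (k+1)).ker := by rw [h]; ring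
        _ = _ := by rw [ih]; ring

theorem cyclo_identities (p : ℕ) (hp : p.Prime) : ∃ W V Q : ℤ[X],
    (X - 1) ^ (p-1) = (∑ k ∈ Finset.range p, X ^ k : ℤ[X]) + C (p:ℤ) * W ∧
    C (p:ℤ) = (X - 1) ^ (p-1) * V + (∑ k ∈ Finset.range p, X ^ k : ℤ[X]) * Q := by
  haveI : Fact p.Prime := ⟨hp⟩
  set Φ : ℤ[X] := ∑ k ∈ Finset.range p, X ^ k with hΦ
  have h1 : C (p:ℤ) ∣ (X - 1) ^ (p-1) - Φ := by
    rw [C_dvd_iff_dvd_coeff]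
    intro i
    rw [← ZMod.intCast_zmod_eq_zero_iff_dvd]
    have h2 : ((X - 1) ^ (p-1) - Φ).map (Int.castRingHom (ZMod p)) = 0 := by
      have h3 : (X - 1 : (ZMod p)[X]) ≠ 0 := X_sub_C_ne_zero (1 : ZMod p)
      apply mul_left_cancel₀ h3
      rw [mul_zero]
      simp only [hΦ, Polynomial.map_sub, Polynomial.map_pow, map_X, Polynomial.map_one, Polynomial.map_sum]
      rw [mul_sub, mul_comm _ (∑ k ∈ Finset.range p, _), geom_sum_mul, ← pow_succ', Nat.sub_add_cancel hp.pos, sub_pow_char, one_pow, sub_self]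
    have := congrArg (fun q => coeff q i) h2
    rw [coeff_map] at this
    exact this
  obtain ⟨W, hW⟩ := h1
  have hW1 : W.eval 1 = -1 := by
    have := congrArg (eval 1) hW
    simp [hΦ, eval_finset_sum, zero_pow (Nat.sub_ne_zero_of_lt hp.one_lt)] at this
    have hp0 : (p:ℤ) ≠ 0 := by exact_mod_cast hp.ne_zero
    apply mul_left_cancel₀ hp0
    linarith
  obtain ⟨R, hR⟩ : (X - C 1) ∣ W + 1 := by
    rw [dvd_iff_isRoot]; simp [hW1]
  rw [C_1] at hR
  refine ⟨W, C (p:ℤ) * R ^ (p-1) - ∑ k ∈ Finset.range (p-1), ((X-1)*R)^k, ∑ k ∈ Finset.range (p-1), ((X-1)*R)^k, by rw [← hW]; ring, ?_⟩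
  have hg := geom_sum_mul ((X-1)*R) (p-1)
  set S := ∑ k ∈ Finset.range (p-1), ((X-1)*R)^k
  have hW' : W = (X-1)*R - 1 := by rw [← hR]; ring
  rw [hW'] at hW
  rw [mul_pow] at hg
  linear_combination S * hW + C (p:ℤ) * hg

theorem add_unit_index {A : Type*} [AddCommGroup A] [Module.Finite ℤ A] (p : ℕ) (hp : p.Prime) (s : AddMonoid.End A)
    (hs : ∑ k ∈ Finset.range p, s ^ k = 0) (D' : A →+ A) (hDs : ∀ x, D' x = s x - x) :
    D'.range.index ^ (p-1) = p ^ Module.finrank ℤ A * Nat.card D'.ker ^ (p-1) := by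
  obtain ⟨W, V, Q, h1, h2⟩ := cyclo_identities p hp
  have g1 := congrArg (aeval s) h1
  have g2 := congrArg (aeval s) h2
  simp only [map_mul, map_add, map_sub, map_pow, aeval_X, map_one, map_sum, hs, zero_add, zero_mul, add_zero, aeval_C] at g1 g2
  have hpe : ∀ x : A, (algebraMap ℤ (AddMonoid.End A) (p:ℤ)) x = p • x := by
    intro x
    simp
  obtain ⟨D, hD⟩ : ∃ D : AddMonoid.End A, D = s - 1 := ⟨_, rfl⟩
  have c1 : ((s - 1)^(p-1)) * aeval s V = aeval s V * (s-1)^(p-1) := by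
    have : s - 1 = aeval s (X - 1 : ℤ[X]) := by simp
    rw [this, ← map_pow, ← map_mul, ← map_mul, mul_comm]
  have c2 : algebraMap ℤ (AddMonoid.End A) (p:ℤ) * aeval s W = aeval s W * algebraMap ℤ (AddMonoid.End A) (p:ℤ) :=
    Algebra.commutes _ _
  have g3 := g1
  rw [c2] at g3
  have g4 := g2
  rw [c1] at g4
  rw [← hD] at g1 g2 g3 g4
  obtain ⟨E, hE⟩ : ∃ E : A →+ A, E = D ^ (p-1) := ⟨_, rfl⟩
  have hD' : D' = D := by ext x; rw [hDs, hD]; rfl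
  have f1 : ∀ x, E x = p • (aeval s W) x := fun x => by
    rw [hE]; exact (DFunLike.congr_fun g1 x).trans (hpe _)
  have f2 : ∀ x : A, p • x = E (aeval s V x) := fun x => by
    rw [hE]; exact (hpe x).symm.trans (DFunLike.congr_fun g2 x)
  have f3 : ∀ x, E x = (aeval s W) (p • x) := fun x => by
    rw [hE, ← hpe x]; exact (DFunLike.congr_fun g3 x)
  have f4 : ∀ x : A, p • x = (aeval s V) (E x) := fun x => by
    rw [hE]; exact (hpe x).symm.trans (DFunLike.congr_fun g4 x)
  have hr : E.range = (nsmulAddMonoidHom (α := A) p).range := by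
    ext x
    constructor
    · rintro ⟨y, rfl⟩
      rw [f1]
      exact ⟨aeval s W y, rfl⟩
    · rintro ⟨y, rfl⟩
      exact ⟨aeval s V y, (f2 y).symm⟩
  have hk : E.ker = (nsmulAddMonoidHom (α := A) p).ker := by
    ext x
    rw [AddMonoidHom.mem_ker, AddMonoidHom.mem_ker, nsmulAddMonoidHom_apply]
    constructor
    · intro h
      rw [f4, h]; exact map_zero _
    · intro h
      rw [f3, h]; exact map_zero _
  haveI : Finite (Submodule.torsion ℤ A) := by
    haveI : Module.Finite ℤ (Submodule.torsion ℤ A) := inferInstance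
    exact Module.finite_of_fg_torsion _ (Submodule.torsion_isTorsion)
  have hkf : Finite (nsmulAddMonoidHom (α := A) p).ker := by
    have hfin : ((nsmulAddMonoidHom (α := A) p).ker : Set A).Finite := by
      refine Set.Finite.subset (s := {x : A | x ∈ Submodule.torsion ℤ A}) ‹_› ?_
      intro x hx
      have : p • x = 0 := hx
      exact ⟨⟨(p:ℤ), mem_nonZeroDivisors_of_ne_zero (by exact_mod_cast hp.ne_zero)⟩, by
        rw [← natCast_zsmul] at this; exact this⟩
    exact hfin
  have hkD : Finite D'.ker := by
    have hsub : (D'.ker : Set A) ⊆ (nsmulAddMonoidHom (α := A) p).ker := by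
      rw [← hk]
      intro x hx
      have hx' : D x = 0 := by rw [← hD']; exact hx
      show E x = 0
      obtain ⟨k, hk⟩ : ∃ k, p - 1 = k + 1 := ⟨p-2, by have := hp.two_le; omega⟩
      rw [hE, hk, pow_succ]
      show (D^k) (D x) = 0
      rw [hx']
      exact map_zero _
    exact (show ((nsmulAddMonoidHom (α := A) p).ker : Set A).Finite from hkf).subset hsub
  have hc := add_chi_pow D' hkD (fun k => ((D^k : AddMonoid.End A) : A →+ A)) (pow_zero D) (fun k => by rw [hD']; exact pow_succ' D k) (p-1)
  simp only [← hE] at hc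
  rw [hr, hk, nsmul_index_abs p hp.ne_zero] at hc
  have : 0 < Nat.card (nsmulAddMonoidHom (α := A) p).ker := Nat.card_pos
  apply Nat.eq_of_mul_eq_mul_right this
  rw [← hc]; ring

theorem unit_herbrand {M : Type*} [CommGroup M] [Module.Finite ℤ (Additive M)] (p : ℕ) (hp : p.Prime)
    (s : Monoid.End M) (hs : s ^ p = 1) (D Nm : M →* M) (hD : ∀ x, D x = s x / x)
    (hN : ∀ x, Nm x = ∏ k ∈ Finset.range p, (s ^ k) x) (r : ℕ)
    (hr : Module.finrank ℤ (Additive M) + 1 = p * (r + 1)) (hrK : Module.finrank ℤ (Additive D.ker) = r)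
    (hμ : Nat.card {x : M // D x = 1 ∧ x ^ p = 1} = p) :
    D.range.relIndex Nm.ker = p * Nm.range.relIndex D.ker ∧ Nm.range.relIndex D.ker ≠ 0 := by
  have hsN : ∀ x, Nm (s x) = Nm x := by
    intro x
    rw [hN, hN]
    have : ∀ k, (s ^ k) (s x) = (s ^ (k+1)) x := fun k => by rw [pow_succ]; rfl
    simp only [this]
    have h1 := Finset.prod_range_succ (fun k => (s ^ k) x) p
    have h2 := Finset.prod_range_succ' (fun k => (s ^ k) x) p
    rw [h1, hs, pow_zero] at h2
    exact (mul_right_cancel h2).symm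
  have hNs : ∀ x, s (Nm x) = Nm x := by
    intro x
    conv_rhs => rw [← hsN]
    rw [hN, hN, map_prod]
    refine Finset.prod_congr rfl fun k _ => ?_
    show (s * s^k) x = (s^k * s) x
    rw [← pow_succ, ← pow_succ']
  have hDN : ∀ x, Nm (D x) = 1 := fun x => by rw [hD, _root_.map_div, hsN, div_self']
  have hND : ∀ x, D (Nm x) = 1 := fun x => by rw [hD, hNs, div_self']
  have hNP : ∀ x, D x = 1 → Nm x = powMonoidHom p x := by
    intro x hx
    have hsx : s x = x := by rw [hD] at hx; exact div_eq_one.1 hx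
    have : ∀ k, (s ^ k) x = x := by
      intro k
      induction k with
      | zero => rfl
      | succ k ih => rw [pow_succ]; show (s^k) (s x) = x; rw [hsx, ih]
    rw [hN]; simp [this]
  have key := herbrand_abs D Nm (powMonoidHom p) hDN hND hNP
  -- [E_K : E_K^p]
  have hEK : (D.ker.map (powMonoidHom p)).relIndex D.ker = p ^ (r+1) := by
    have h1 : (D.ker.map (powMonoidHom p)).subgroupOf D.ker = (powMonoidHom (α := D.ker) p).range := by
      ext x
      rw [Subgroup.mem_subgroupOf]
      constructor
      · rintro ⟨y, hy, h⟩
        exact ⟨⟨y, hy⟩, Subtype.ext h⟩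
      · rintro ⟨y, rfl⟩
        exact ⟨y, y.2, rfl⟩
    haveI : Module.Finite ℤ (Additive D.ker) :=
      Module.Finite.of_injective (D.ker.subtype.toAdditive.toIntLinearMap) (fun a b h => Subtype.ext h)
    rw [Subgroup.relIndex, h1, pow_index_abs p hp.ne_zero, hrK, pow_succ]
    congr 1
    conv_rhs => rw [← hμ]
    refine (Nat.card_congr ⟨fun x => ⟨⟨x.1, x.2.1⟩, Subtype.ext x.2.2⟩, fun x => ⟨x.1.1, x.1.2, congrArg Subtype.val x.2⟩, fun x => rfl, fun x => rfl⟩).symm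
  -- restriction to M0
  haveI hfinM0 : Module.Finite ℤ (Additive Nm.ker) :=
      Module.Finite.of_injective (Nm.ker.subtype.toAdditive.toIntLinearMap) (fun a b h => Subtype.ext h)
  let D0 : Nm.ker →* Nm.ker := (D.comp Nm.ker.subtype).codRestrict Nm.ker (fun x => hDN _)
  let s0 : Nm.ker →* Nm.ker := MonoidHom.codRestrict (MonoidHom.comp s Nm.ker.subtype) Nm.ker (fun x => by
    rw [MonoidHom.mem_ker]; exact (hsN x).trans x.2)
  let t0 : AddMonoid.End (Additive Nm.ker) := MonoidHom.toAdditive s0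
  have ht0 : ∀ (k : ℕ) (x : Nm.ker), (((t0 ^ k) (Additive.ofMul x)).toMul : M) = (s ^ k) x := by
    intro k
    induction k with
    | zero => intro x; rfl
    | succ k ih =>
      intro x
      rw [pow_succ, pow_succ]
      exact ih (s0 x)
  have hsum : ∑ k ∈ Finset.range p, t0 ^ k = 0 := by
    refine AddMonoidHom.ext fun x => ?_
    have : (∑ k ∈ Finset.range p, t0 ^ k) x = ∑ k ∈ Finset.range p, (t0 ^ k) x := by
      exact AddMonoidHom.finsetSum_apply _ _ _
    refine this.trans ?_
    apply Additive.toMul.injective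
    rw [toMul_sum]
    apply Subtype.ext
    rw [Subgroup.val_finset_prod]
    have h2 := hN (Additive.toMul x).1
    rw [(Additive.toMul x).2] at h2
    rw [← Finset.prod_congr rfl (fun k _ => ht0 k (Additive.toMul x))] at h2
    exact h2.symm
  have hidx := add_unit_index p hp t0 hsum (MonoidHom.toAdditive D0) (by
    intro x
    apply Additive.toMul.injective
    apply Subtype.ext
    exact hD _)
  have hi1 : (MonoidHom.toAdditive D0).range.index = (Nm.ker.map D).relIndex Nm.ker := by
    have h1 : (Nm.ker.map D).subgroupOf Nm.ker = D0.range := by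
      ext x
      rw [Subgroup.mem_subgroupOf]
      constructor
      · rintro ⟨y, hy, h⟩
        exact ⟨⟨y, hy⟩, Subtype.ext h⟩
      · rintro ⟨y, rfl⟩
        exact ⟨y, y.2, rfl⟩
    rw [Subgroup.relIndex, h1]; rfl
  have hi2 : Nat.card (MonoidHom.toAdditive D0).ker = p := by
    have : Nat.card D0.ker = p := by
      conv_rhs => rw [← hμ]
      refine (Nat.card_congr ⟨fun x => ⟨⟨x.1, by rw [MonoidHom.mem_ker, hNP _ x.2.1]; exact x.2.2⟩, Subtype.ext x.2.1⟩, fun x => ⟨x.1.1, congrArg Subtype.val x.2, by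
          have h3 := hNP x.1.1 (congrArg Subtype.val x.2)
          rw [x.1.2] at h3
          exact h3.symm⟩, fun x => rfl, fun x => rfl⟩).symm
    exact this
  have hrank : Module.finrank ℤ (Additive Nm.ker) = (p-1) * (r+1) := by
    let NL : Additive M →ₗ[ℤ] Additive M := (MonoidHom.toAdditive Nm).toIntLinearMap
    have h1 := Submodule.finrank_quotient_add_finrank (LinearMap.ker NL)
    rw [LinearEquiv.finrank_eq NL.quotKerEquivRange] at h1
    have h2 : Module.finrank ℤ (LinearMap.ker NL) = Module.finrank ℤ (Additive Nm.ker) := by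
      rfl
    have h3 : Module.finrank ℤ (LinearMap.range NL) = r := by
      let DLn : Additive M →ₗ[ℤ] Additive M := (MonoidHom.toAdditive D).toIntLinearMap
      have h4 : Module.finrank ℤ (LinearMap.ker DLn) = r := hrK
      rw [← h4]
      apply le_antisymm
      · apply Submodule.finrank_mono
        rintro _ ⟨y, rfl⟩
        exact hND y
      · let f : LinearMap.ker DLn →ₗ[ℤ] LinearMap.range NL := LinearMap.codRestrict _ (NL.comp (LinearMap.ker DLn).subtype) (fun x => ⟨_, rfl⟩)
        have h5 := Submodule.finrank_quotient_add_finrank (LinearMap.ker f)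
        rw [LinearEquiv.finrank_eq f.quotKerEquivRange] at h5
        have h6 : Module.finrank ℤ (LinearMap.ker f) = 0 := by
          rw [Module.finrank_eq_zero_iff]
          intro x
          refine ⟨(p:ℤ), by exact_mod_cast hp.ne_zero, ?_⟩
          have hx : Nm (Additive.toMul x.1.1) = 1 := congrArg Subtype.val x.2
          rw [hNP _ x.1.2] at hx
          apply Subtype.ext
          apply Subtype.ext
          show (p:ℤ) • x.1.1 = 0
          rw [natCast_zsmul]; exact hx
        have h7 := Submodule.finrank_le (LinearMap.range f)
        omega
    rw [h3, h2] at h1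
    have hp1 := hp.one_lt
    obtain ⟨q, rfl⟩ : ∃ q, p = q + 1 := ⟨p-1, by omega⟩
    simp only [Nat.add_sub_cancel]
    nlinarith
  rw [hi1, hi2, hrank, mul_comm (p-1), pow_mul, ← mul_pow] at hidx
  have hidx' := Nat.pow_left_injective (Nat.sub_pos_of_lt hp.one_lt).ne' hidx
  have hne : Nm.range.relIndex D.ker ≠ 0 := by
    have h1 : D.ker.map (powMonoidHom p) ≤ Nm.range := by
      rintro _ ⟨y, hy, rfl⟩
      exact ⟨y, hNP y hy⟩
    have h2 := Subgroup.relIndex_dvd_of_le_left D.ker h1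
    rw [hEK] at h2
    intro h0
    rw [h0, zero_dvd_iff] at h2
    exact (pow_pos hp.pos (r+1)).ne' h2
  refine ⟨?_, hne⟩
  rw [hEK, hidx'] at key
  apply Nat.eq_of_mul_eq_mul_left (pow_pos hp.pos (r+1))
  rw [key]; ring

end PartA6

section PartA7

open IsDedekindDomain nonZeroDivisors

section UnitsPart
variable {K L : Type*} [Field K] [NumberField K] [Field L] [NumberField L] [Algebra K L]

/-- inclusion of units -/
noncomputable def iU (L : Type*) [Field L] [NumberField L] : (𝓞 L)ˣ →* Lˣ := Units.map (algebraMap (𝓞 L) L).toMonoidHom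

theorem iU_inj : Function.Injective (iU L) :=
  Units.map_injective (RingOfIntegers.coe_injective)

theorem iU_range : (iU L).range = (dvr L).ker := by
  ext x
  rw [dvr_ker]
  constructor
  · rintro ⟨u, rfl⟩; exact ⟨u, rfl⟩
  · rintro ⟨u, rfl⟩; exact ⟨u, rfl⟩

theorem iU_val (u : (𝓞 L)ˣ) : ((iU L u : Lˣ) : L) = ((u : 𝓞 L) : L) := rfl

noncomputable def sU (σ : L ≃ₐ[K] L) : Monoid.End (𝓞 L)ˣ :=
  Units.map (RingOfIntegers.mapRingEquiv σ.toRingEquiv : 𝓞 L →* 𝓞 L)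

theorem sU_pow (σ : L ≃ₐ[K] L) (k : ℕ) (u : (𝓞 L)ˣ) : ((((sU σ) ^ k) u : (𝓞 L)ˣ) : L) = (σ ^ k) (u : L) := by
  induction k generalizing u with
  | zero => rfl
  | succ k ih =>
    rw [pow_succ, pow_succ, AlgEquiv.mul_apply]
    exact ih (sU σ u)

noncomputable def dU (σ : L ≃ₐ[K] L) : (𝓞 L)ˣ →* (𝓞 L)ˣ :=
  (show (𝓞 L)ˣ →* (𝓞 L)ˣ from sU σ) / MonoidHom.id _

theorem dU_apply (σ : L ≃ₐ[K] L) (u : (𝓞 L)ˣ) : dU σ u = sU σ u / u := rfl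

noncomputable def nU (σ : L ≃ₐ[K] L) (p : ℕ) : (𝓞 L)ˣ →* (𝓞 L)ˣ := ∏ k ∈ Finset.range p, ((sU σ ^ k : Monoid.End (𝓞 L)ˣ) : (𝓞 L)ˣ →* (𝓞 L)ˣ)

theorem nU_apply (σ : L ≃ₐ[K] L) (p : ℕ) (u : (𝓞 L)ˣ) : nU σ p u = ∏ k ∈ Finset.range p, (sU σ ^ k) u := by
  unfold nU
  exact MonoidHom.finset_prod_apply _ _ _

theorem iU_dU (σ : L ≃ₐ[K] L) (u : (𝓞 L)ˣ) : iU L (dU σ u) = DL σ (iU L u) := by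
  ext
  rw [DL_apply]
  rw [dU_apply, _root_.map_div, Units.val_div_eq_div_val]
  rfl

theorem iU_nU (σ : L ≃ₐ[K] L) (p : ℕ) (u : (𝓞 L)ˣ) : iU L (nU σ p u) = NL σ p (iU L u) := by
  ext
  rw [NL_apply, nU_apply, map_prod, Units.coe_prod]
  refine Finset.prod_congr rfl fun k _ => ?_
  exact sU_pow σ k u

theorem map_iU_ker_dU (σ : L ≃ₐ[K] L) : (dU σ).ker.map (iU L) = (dvr L).ker ⊓ (DL σ).ker := by
  rw [← iU_range]
  ext x
  constructor
  · rintro ⟨u, hu, rfl⟩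
    refine ⟨⟨u, rfl⟩, ?_⟩
    show DL σ _ = 1
    rw [← iU_dU, show dU σ u = 1 from hu, map_one]
  · rintro ⟨⟨u, rfl⟩, hu⟩
    refine ⟨u, ?_, rfl⟩
    apply iU_inj
    rw [iU_dU, map_one]; exact hu

theorem map_iU_ker_nU (σ : L ≃ₐ[K] L) (p : ℕ) : (nU σ p).ker.map (iU L) = (dvr L).ker ⊓ (NL σ p).ker := by
  rw [← iU_range]
  ext x
  constructor
  · rintro ⟨u, hu, rfl⟩
    refine ⟨⟨u, rfl⟩, ?_⟩
    show NL σ p _ = 1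
    rw [← iU_nU, show nU σ p u = 1 from hu, map_one]
  · rintro ⟨⟨u, rfl⟩, hu⟩
    refine ⟨u, ?_, rfl⟩
    apply iU_inj
    rw [iU_nU, map_one]; exact hu

theorem map_iU_range_dU (σ : L ≃ₐ[K] L) : (dU σ).range.map (iU L) = (dvr L).ker.map (DL σ) := by
  rw [← iU_range, ← MonoidHom.range_comp, ← MonoidHom.range_comp]
  congr 1

theorem map_iU_range_nU (σ : L ≃ₐ[K] L) (p : ℕ) : (nU σ p).range.map (iU L) = (dvr L).ker.map (NL σ p) := by
  rw [← iU_range, ← MonoidHom.range_comp, ← MonoidHom.range_comp]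
  congr 1
  ext1 u
  exact iU_nU σ p u

theorem ker_dU_eq [IsGalois K L] (p : ℕ) (hp : p.Prime) (hdeg : Module.finrank K L = p) (σ : L ≃ₐ[K] L)
    (hσ : orderOf σ = p) : (Units.map (algebraMap (𝓞 K) (𝓞 L) : 𝓞 K →* 𝓞 L)).range = (dU σ).ker := by
  ext u
  have hmem : u ∈ (dU σ).ker ↔ iU L u ∈ (DL σ).ker := by
    rw [MonoidHom.mem_ker, MonoidHom.mem_ker, ← iU_dU]
    constructor
    · intro h; rw [h, map_one]
    · intro h; apply iU_inj; rw [h, map_one]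
  rw [hmem, ker_DL p hp hdeg σ hσ]
  constructor
  · rintro ⟨y, rfl⟩
    exact ⟨iU K y, by ext; rfl⟩
  · rintro ⟨y, hy⟩
    have h1 : algebraMap K L (y : K) = ((u : 𝓞 L) : L) := congrArg Units.val hy
    have h2 : algebraMap K L ((y⁻¹ : Kˣ) : K) = (((u⁻¹ : (𝓞 L)ˣ) : 𝓞 L) : L) := by
      have := congrArg (fun z : Lˣ => ((z⁻¹ : Lˣ) : L)) hy
      simp only [← map_inv] at this
      exact this
    have hintg : ∀ z : K, IsIntegral ℤ (algebraMap K L z) → IsIntegral ℤ z := fun z hz =>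
      (isIntegral_algebraMap_iff (algebraMap K L).injective).1 hz
    let a : 𝓞 K := ⟨y, hintg _ (by rw [h1]; exact (u : 𝓞 L).2)⟩
    let b : 𝓞 K := ⟨((y⁻¹ : Kˣ) : K), hintg _ (by rw [h2]; exact ((u⁻¹ : (𝓞 L)ˣ) : 𝓞 L).2)⟩
    refine ⟨⟨a, b, ?_, ?_⟩, ?_⟩
    · ext; exact y.mul_inv
    · ext; exact y.inv_mul
    · ext
      exact h1

theorem ambig_formula [IsGalois K L] (p : ℕ) (hp : p.Prime) (hdeg : Module.finrank K L = p) (σ : L ≃ₐ[K] L)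
    (hσ : orderOf σ = p) (hfin : {P : HeightOneSpectrum (𝓞 L) | ram K P = p}.Finite)
    (ζ : K) (hζ : IsPrimitiveRoot ζ p) (hrank : Units.rank L + 1 = p * (Units.rank K + 1)) :
    (dvr L).range.relIndex ((dvr L).range.comap (diffDiv (sP σ))) * (p *
      ((dvr L).ker ⊓ (NL σ p).range).relIndex ((dvr L).ker ⊓ (DL σ).ker)) =
      p ^ Nat.card {P : HeightOneSpectrum (𝓞 L) | ram K P = p} * Nat.card (ClassGroup (𝓞 K)) := by
  have hσp : σ ^ p = 1 := by rw [← hσ]; exact pow_orderOf_eq_one σ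
  have hker := ker_dU_eq p hp hdeg σ hσ
  have hinj : Function.Injective (Units.map (algebraMap (𝓞 K) (𝓞 L) : 𝓞 K →* 𝓞 L)) :=
    Units.map_injective (FaithfulSMul.algebraMap_injective (𝓞 K) (𝓞 L))
  have hs : (sU σ) ^ p = 1 := by
    refine MonoidHom.ext fun u => ?_
    apply iU_inj
    ext
    refine (sU_pow σ p u).trans ?_
    rw [hσp]; rfl
  haveI : NeZero p := ⟨hp.ne_zero⟩
  obtain ⟨hU1, hU2⟩ := unit_herbrand p hp (sU σ) hs (dU σ) (nU σ p) (dU_apply σ) (nU_apply σ p) (Units.rank K)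
    (by rw [Units.finrank_eq, hrank])
    (by
      rw [← hker, ← Units.finrank_eq]
      exact (LinearEquiv.finrank_eq (MulEquiv.toAdditive (MonoidHom.ofInjective hinj)).toIntLinearEquiv).symm)
    (by
      let ζ' : 𝓞 L := ⟨algebraMap K L ζ, (hζ.map_of_injective (algebraMap K L).injective).isIntegral hp.pos⟩
      have hζ' : IsPrimitiveRoot ζ' p := by
        rw [← IsPrimitiveRoot.map_iff_of_injective (f := algebraMap (𝓞 L) L) RingOfIntegers.coe_injective]
        exact hζ.map_of_injective (algebraMap K L).injective
      conv_rhs => rw [← hζ'.card_rootsOfUnity]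
      refine Nat.card_congr ⟨fun x => ⟨x.1, x.2.2⟩, fun x => ⟨x.1, ?_, x.2⟩, fun x => rfl, fun x => rfl⟩
      apply iU_inj
      rw [iU_dU, map_one]
      ext
      rw [DL_apply, iU_val]
      have hx : (((x.1 : (𝓞 L)ˣ) : 𝓞 L) : L) ^ p = 1 := by
        have := congrArg (fun u : (𝓞 L)ˣ => ((u : 𝓞 L) : L)) x.2
        simpa using this
      obtain ⟨i, -, hi⟩ := (hζ.map_of_injective (algebraMap K L).injective).eq_pow_of_pow_eq_one hx
      rw [← hi, ← map_pow, AlgEquiv.commutes]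
      refine div_self ?_
      rw [map_pow, hi]
      exact fun h0 => by rw [h0, zero_pow hp.ne_zero] at hx; exact zero_ne_one hx)
  have i1 := Subgroup.relIndex_map_map_of_injective (dU σ).range (nU σ p).ker (iU_inj (L := L))
  have i2 := Subgroup.relIndex_map_map_of_injective (nU σ p).range (dU σ).ker (iU_inj (L := L))
  rw [map_iU_range_dU, map_iU_ker_nU] at i1
  rw [map_iU_range_nU, map_iU_ker_dU] at i2
  have hm := ambig_main p hp hdeg σ hσ hfin
  rw [i1, hU1, ← i2] at hm
  rw [← i2] at hU2
  have hZY : (dvr L).ker.map (NL σ p) ≤ (dvr L).ker ⊓ (NL σ p).range := by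
    refine le_inf ?_ (Subgroup.map_le_range _ _)
    rw [← map_iU_range_nU, ← iU_range]; exact Subgroup.map_le_range _ _
  have hYX : (dvr L).ker ⊓ (NL σ p).range ≤ (dvr L).ker ⊓ (DL σ).ker := by
    refine inf_le_inf_left _ ?_
    rintro _ ⟨x, rfl⟩
    rw [MonoidHom.mem_ker]
    ext
    rw [DL_apply, Units.val_one, div_eq_one_iff_eq (Units.ne_zero _), NL_apply, map_prod]
    have : ∀ k, σ ((σ ^ k) (x : L)) = (σ ^ (k+1)) (x : L) := fun k => by rw [pow_succ']; rfl
    simp only [this]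
    have h1 := Finset.prod_range_succ (fun k => (σ ^ k) (x : L)) p
    have h2 := Finset.prod_range_succ' (fun k => (σ ^ k) (x : L)) p
    rw [h1, hσp, pow_zero] at h2
    exact (mul_right_cancel₀ x.ne_zero h2).symm
  have hmul := Subgroup.relIndex_mul_relIndex _ _ _ hZY hYX
  rw [← hmul] at hm hU2
  have hne := left_ne_zero_of_mul hU2
  apply Nat.eq_of_mul_eq_mul_left (Nat.pos_of_ne_zero hne)
  linear_combination hm

end UnitsPart

end PartA7

section PartA8

theorem add_nilp_bound {A : Type*} [AddCommGroup A] [Finite A] (p : ℕ) (hp : p.Prime) (s : AddMonoid.End A)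
    (hp0 : ∀ x : A, p • x = 0)
    (hs : ∑ k ∈ Finset.range p, s ^ k = 0) (D' : A →+ A) (hDs : ∀ x, D' x = s x - x) :
    Nat.card A ≤ Nat.card D'.ker ^ (p-1) := by
  obtain ⟨W, V, Q, h1, h2⟩ := cyclo_identities p hp
  have g1 := congrArg (aeval s) h1
  simp only [map_mul, map_sub, map_add, map_pow, aeval_X, map_one, map_sum, hs, zero_add, aeval_C] at g1
  obtain ⟨D, hD⟩ : ∃ D : AddMonoid.End A, D = s - 1 := ⟨_, rfl⟩
  rw [← hD] at g1
  have hD' : D' = D := by ext x; rw [hDs, hD]; rfl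
  have hle : ∀ k, Nat.card (AddMonoidHom.ker ((D ^ k : AddMonoid.End A) : A →+ A)) ≤ Nat.card D'.ker ^ k := by
    intro k
    induction k with
    | zero =>
      have h2 : (AddMonoidHom.id A).ker = ⊥ := (AddMonoidHom.ker_eq_bot_iff _).2 Function.injective_id
      rw [show (AddMonoidHom.ker ((D ^ 0 : AddMonoid.End A) : A →+ A)) = ⊥ from h2]; simp
    | succ k ih =>
      obtain ⟨g, hg⟩ : ∃ g : A →+ A, g = D ^ k := ⟨_, rfl⟩
      rw [← hg] at ih
      have e1 : ((D ^ (k+1) : AddMonoid.End A) : A →+ A) = D'.comp g := by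
        rw [hD', hg]; exact pow_succ' D k
      rw [e1]
      have hm : ∀ x : (D'.comp g).ker, g x ∈ D'.ker := fun x => x.2
      let φ : (D'.comp g).ker →+ D'.ker := (g.comp (D'.comp g).ker.subtype).codRestrict D'.ker hm
      have h3 := AddSubgroup.card_mul_index φ.ker
      rw [AddSubgroup.index_ker] at h3
      have h4 : Nat.card φ.range ≤ Nat.card D'.ker := AddSubgroup.card_le_card_addGroup _
      have h5 : Nat.card φ.ker ≤ Nat.card g.ker := by
        refine Nat.card_le_card_of_injective (fun x => ⟨x.1.1, congrArg Subtype.val x.2⟩) ?_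
        intro x y hxy
        apply Subtype.ext
        apply Subtype.ext
        exact Subtype.mk.inj hxy
      rw [← h3, pow_succ]
      exact Nat.mul_le_mul (h5.trans ih) h4
  have := hle (p-1)
  have htop : (AddMonoidHom.ker ((D ^ (p-1) : AddMonoid.End A) : A →+ A)) = ⊤ := by
    rw [eq_top_iff]
    intro x _
    have := (DFunLike.congr_fun g1 x)
    refine this.trans ?_
    show (algebraMap ℤ (AddMonoid.End A) (p:ℤ)) (aeval s W x) = 0
    simp [hp0]
  rw [htop] at this
  simpa using this

theorem rank_bounds {C : Type*} [CommGroup C] [Finite C] (p : ℕ) (hp : p.Prime) (s : Monoid.End C)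
    (D Nm : C →* C) (hD : ∀ x, D x = s x / x) (hN : ∀ x, Nm x = ∏ k ∈ Finset.range p, (s ^ k) x)
    (h : ℕ) (hph : ¬ p ∣ h) (hNh : ∀ x, Nm x ^ h = 1) :
    (Nat.card D.ker).factorization p ≤ pRank p C ∧ pRank p C ≤ (Nat.card D.ker).factorization p * (p-1) := by
  haveI : Fact p.Prime := ⟨hp⟩
  set e := (Nat.card D.ker).factorization p with he
  let Cp : Subgroup C := (powMonoidHom p : C →* C).ker
  have hCp : ∀ x, x ∈ Cp ↔ x ^ p = 1 := fun x => Iff.rfl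
  have hpg : ∀ H : Subgroup C, H ≤ Cp → IsPGroup p H := fun H hH x => ⟨1, by
    rw [pow_one]; exact Subtype.ext ((hCp _).1 (hH x.2))⟩
  have hrk : Nat.card Cp = p ^ pRank p C := by
    obtain ⟨n, hn⟩ := IsPGroup.iff_card.1 (hpg Cp le_rfl)
    have : Nat.card {g : C // g ^ p = 1} = p ^ n := hn
    rw [pRank, this, hn, hp.factorization_pow]; simp
  have hNP : ∀ x, D x = 1 → Nm x = x ^ p := by
    intro x hx
    have hsx : s x = x := by rw [hD] at hx; exact div_eq_one.1 hx
    have : ∀ k, (s ^ k) x = x := by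
      intro k
      induction k with
      | zero => rfl
      | succ k ih => rw [pow_succ]; show (s^k) (s x) = x; rw [hsx, ih]
    rw [hN]; simp [this]
  have hcop : Nat.Coprime p h := (Nat.Prime.coprime_iff_not_dvd hp).2 hph
  -- Sylow
  have hFp : Nat.card (D.ker ⊓ Cp : Subgroup C) = p ^ e := by
    obtain ⟨n, hn⟩ := IsPGroup.iff_card.1 (hpg (D.ker ⊓ Cp) inf_le_right)
    obtain ⟨S⟩ : Nonempty (Sylow p D.ker) := inferInstance
    have hS := S.card_eq_multiplicity
    rw [hn]
    apply le_antisymm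
    · apply Nat.pow_le_pow_right hp.pos
      rw [he, ← hp.pow_dvd_iff_le_factorization Nat.card_pos.ne', ← hn]
      exact Subgroup.card_dvd_of_le inf_le_left
    · rw [he, ← hS, ← hn]
      refine Nat.card_le_card_of_injective (fun x => ⟨x.1.1, x.1.2, ?_⟩) ?_
      · obtain ⟨k, hk⟩ := S.isPGroup' x
        have hk' : (x.1.1 : C) ^ (p^k) = 1 := congrArg (fun y : S => ((y : D.ker) : C)) hk
        have h2 := hNh x.1.1
        rw [hNP _ x.1.2, ← pow_mul, mul_comm, pow_mul] at h2
        show (x.1.1 : C) ^ p = 1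
        have h3 : ((x.1.1 : C) ^ p) ^ h = 1 := by rw [← pow_mul, mul_comm, pow_mul, h2]
        have h4 : ((x.1.1 : C) ^ p) ^ (p^k) = 1 := by rw [← pow_mul, mul_comm, pow_mul, hk', one_pow]
        have h5 := Nat.Coprime.pow_left k hcop
        have h6 := Nat.dvd_gcd (orderOf_dvd_of_pow_eq_one h4) (orderOf_dvd_of_pow_eq_one h3)
        rw [h5] at h6
        exact orderOf_eq_one_iff.1 (Nat.dvd_one.1 h6)
      · intro x y hxy
        apply Subtype.ext
        apply Subtype.ext
        exact Subtype.mk.inj hxy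
  constructor
  · have h1 : p ^ e ≤ p ^ pRank p C := by
      rw [← hFp, ← hrk]
      exact Nat.le_of_dvd Nat.card_pos (Subgroup.card_dvd_of_le inf_le_right)
    exact (Nat.pow_le_pow_iff_right hp.one_lt).1 h1
  · have hsC : ∀ x : Cp, s x ∈ Cp := fun x => by
      rw [hCp, ← map_pow, (hCp _).1 x.2, map_one]
    let s0 : Cp →* Cp := MonoidHom.codRestrict (MonoidHom.comp s Cp.subtype) Cp hsC
    have hDC : ∀ x : Cp, D x ∈ Cp := fun x => by
      rw [hCp, ← map_pow, (hCp _).1 x.2, map_one]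
    let D0 : Cp →* Cp := (D.comp Cp.subtype).codRestrict Cp hDC
    let t0 : AddMonoid.End (Additive Cp) := MonoidHom.toAdditive s0
    have ht0 : ∀ (k : ℕ) (x : Cp), (((t0 ^ k) (Additive.ofMul x)).toMul : C) = (s ^ k) x := by
      intro k
      induction k with
      | zero => intro x; rfl
      | succ k ih =>
        intro x
        rw [pow_succ, pow_succ]
        exact ih (s0 x)
    have hsum : ∑ k ∈ Finset.range p, t0 ^ k = 0 := by
      refine AddMonoidHom.ext fun x => ?_
      have : (∑ k ∈ Finset.range p, t0 ^ k) x = ∑ k ∈ Finset.range p, (t0 ^ k) x := by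
        exact AddMonoidHom.finsetSum_apply _ _ _
      refine this.trans ?_
      apply Additive.toMul.injective
      rw [toMul_sum]
      apply Subtype.ext
      rw [Subgroup.val_finset_prod]
      have h2 := hN (Additive.toMul x).1
      rw [← Finset.prod_congr rfl (fun k _ => ht0 k (Additive.toMul x))] at h2
      refine h2.symm.trans ?_
      have h3 := hNh (Additive.toMul x).1
      have h4 : (Nm (Additive.toMul x).1) ^ p = 1 := by
        rw [← map_pow, (hCp _).1 (Additive.toMul x).2, map_one]
      have h6 := Nat.dvd_gcd (orderOf_dvd_of_pow_eq_one h4) (orderOf_dvd_of_pow_eq_one h3)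
      rw [hcop] at h6
      exact orderOf_eq_one_iff.1 (Nat.dvd_one.1 h6)
    have hb := add_nilp_bound p hp t0 (fun x => by
        apply Additive.toMul.injective
        apply Subtype.ext
        exact (hCp _).1 (Additive.toMul x).2) hsum (MonoidHom.toAdditive D0) (by
      intro x
      apply Additive.toMul.injective
      apply Subtype.ext
      exact hD _)
    have hc : Nat.card (MonoidHom.toAdditive D0).ker = p ^ e := by
      rw [← hFp]
      have : Nat.card D0.ker = Nat.card (D.ker ⊓ Cp : Subgroup C) :=
        Nat.card_congr ⟨fun x => ⟨x.1.1, congrArg Subtype.val x.2, x.1.2⟩, fun x => ⟨⟨x.1, x.2.2⟩, Subtype.ext x.2.1⟩, fun x => rfl, fun x => rfl⟩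
      exact this
    rw [hc] at hb
    have hb' : Nat.card Cp ≤ (p^e)^(p-1) := hb
    rw [hrk, ← pow_mul] at hb'
    exact (Nat.pow_le_pow_iff_right hp.one_lt).1 hb'

end PartA8

section PartA9

open IsDedekindDomain nonZeroDivisors

section ClassBounds
variable {K L : Type*} [Field K] [NumberField K] [Field L] [NumberField L] [Algebra K L]

theorem mem_range_liftDiv [IsGalois K L] (n : Dvs L) (m : HeightOneSpectrum (𝓞 K) → ℤ)
    (hm : ∀ P : HeightOneSpectrum (𝓞 L), (Multiplicative.toAdd n) P = ram K P * m (prBelow K P)) :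
    n ∈ (liftDiv K L).range := by
  have hmf : (Function.support m).Finite := by
    have : Function.support m ⊆ (prBelow K (L := L)) '' (Function.support (fun P => (Multiplicative.toAdd n) P)) := by
      intro v hv
      obtain ⟨P, rfl⟩ := prBelow_surj (L := L) v
      refine ⟨P, ?_, rfl⟩
      rw [Function.mem_support, hm]
      exact mul_ne_zero (by exact_mod_cast ram_ne_zero P) hv
    exact ((Finsupp.finite_support (Multiplicative.toAdd n)).image _).subset this
  refine ⟨Multiplicative.ofAdd (Finsupp.ofSupportFinite m hmf), ?_⟩
  apply Multiplicative.toAdd.injective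
  ext P
  rw [liftDiv_apply, hm]; rfl

noncomputable def pE (σ : L ≃ₐ[K] L) : Monoid.End (Dvs L) := permDiv (sP σ)

theorem norm_mem_lift [IsGalois K L] (p : ℕ) (hp : p.Prime) (hdeg : Module.finrank K L = p) (σ : L ≃ₐ[K] L)
    (hσ : orderOf σ = p) (n : Dvs L) :
    (∏ k ∈ Finset.range p, (pE σ ^ k) n) ∈ (liftDiv K L).range := by
  have hσp : σ ^ p = 1 := by rw [← hσ]; exact pow_orderOf_eq_one σ
  have hs : (sP σ) ^ p = 1 := by rw [← sP_pow, hσp, sP_one]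
  have hval : ∀ k P, (Multiplicative.toAdd ((pE σ ^ k) n)) P
      = (Multiplicative.toAdd n) (((sP σ)^k).symm P) := by
    intro k
    induction k with
    | zero => intro P; rfl
    | succ k ih =>
      intro P
      rw [pow_succ']
      show (Multiplicative.toAdd (permDiv (sP σ) ((pE σ ^ k) n))) P = _
      rw [permDiv_apply, ih, pow_succ']
      rfl
  set N := ∏ k ∈ Finset.range p, (pE σ ^ k) n with hN
  have hNv : ∀ P, (Multiplicative.toAdd N) P = ∑ k ∈ Finset.range p, (Multiplicative.toAdd n) (((sP σ)^k).symm P) := by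
    intro P
    rw [hN, toAdd_prod, Finsupp.finset_sum_apply]
    exact Finset.sum_congr rfl fun k _ => hval k P
  have hNs : ∀ P, (Multiplicative.toAdd N) (sP σ P) = (Multiplicative.toAdd N) P := by
    intro P
    rw [hNv, hNv]
    obtain ⟨q, rfl⟩ : ∃ q, p = q + 1 := ⟨p-1, by have := hp.pos; omega⟩
    rw [Finset.sum_range_succ', Finset.sum_range_succ]
    congr 1
    · refine Finset.sum_congr rfl fun k _ => ?_
      congr 1
      rw [Equiv.symm_apply_eq, pow_succ']
      show _ = (sP σ) ((sP σ ^ k) (((sP σ) ^ k).symm P))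
      rw [Equiv.apply_symm_apply]
    · congr 1
      rw [pow_zero, eq_comm, Equiv.symm_apply_eq]
      show P = (sP σ ^ q) (sP σ P)
      have : (sP σ ^ q) (sP σ P) = (sP σ ^ (q+1)) P := by rw [pow_succ]; rfl
      rw [this, hs]; rfl
  have hNc : ∀ P Q, prBelow K P = prBelow K Q → (Multiplicative.toAdd N) Q = (Multiplicative.toAdd N) P := by
    intro P Q h
    obtain ⟨τ, hτ⟩ := exists_sP_of_below P Q h
    obtain ⟨k, rfl⟩ := sigma_gen p hp hdeg σ hσ τ
    rw [hτ, sP_pow]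
    clear hτ
    induction k with
    | zero => rfl
    | succ k ih =>
      rw [pow_succ']
      exact (hNs _).trans ih
  let sec : HeightOneSpectrum (𝓞 K) → HeightOneSpectrum (𝓞 L) := Function.surjInv (prBelow_surj (K := K) (L := L))
  have hsec : ∀ v, prBelow K (sec v) = v := Function.surjInv_eq prBelow_surj
  apply mem_range_liftDiv N (fun v => if ram K (sec v) = 1 then (Multiplicative.toAdd N) (sec v) else (Multiplicative.toAdd n) (sec v))
  intro P
  obtain ⟨Q, hQ⟩ : ∃ Q, Q = sec (prBelow K P) := ⟨_, rfl⟩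
  have hPQ : prBelow K P = prBelow K Q := by rw [hQ, hsec]
  obtain ⟨τ, hτ⟩ := exists_sP_of_below P Q hPQ
  have hr : ram K Q = ram K P := by rw [hτ, ram_sP]
  simp only [← hQ]
  rw [← hNc P Q hPQ, ← hr]
  rcases ram_cases p hp hdeg σ Q with h | ⟨h, h'⟩
  · rw [if_pos h, h]; simp
  · rw [if_neg (by rw [h]; exact hp.one_lt.ne'), h, hNv]
    have : ∀ k, ((sP σ)^k).symm Q = Q := by
      intro k
      rw [Equiv.symm_apply_eq]
      induction k with
      | zero => rfl
      | succ k ih =>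
        rw [pow_succ]
        show Q = (sP σ ^ k) (sP σ Q)
        rw [h']; exact ih
    simp [this]

theorem class_bounds [IsGalois K L] (p : ℕ) (hp : p.Prime) (hdeg : Module.finrank K L = p) (σ : L ≃ₐ[K] L)
    (hσ : orderOf σ = p) (hreg : ¬ p ∣ Nat.card (ClassGroup (𝓞 K))) :
    ((dvr L).range.relIndex ((dvr L).range.comap (diffDiv (sP σ)))).factorization p ≤ pRank p (ClassGroup (𝓞 L)) ∧
    pRank p (ClassGroup (𝓞 L)) ≤ ((dvr L).range.relIndex ((dvr L).range.comap (diffDiv (sP σ)))).factorization p * (p-1) := by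
  let C := Dvs L ⧸ (dvr L).range
  have hpr : pRank p (ClassGroup (𝓞 L)) = pRank p C := by
    unfold pRank
    refine congrArg (fun n => Nat.factorization n p) ?_
    refine Nat.card_congr (Equiv.subtypeEquiv (clEquivDiv L).toEquiv ?_)
    intro a
    show a ^ p = 1 ↔ (clEquivDiv L a) ^ p = 1
    rw [← map_pow, map_eq_one_iff _ (clEquivDiv L).injective]
  haveI : Finite C := Finite.of_equiv _ (clEquivDiv L).toEquiv
  have hdiff : (dvr L).range ≤ (dvr L).range.comap (diffDiv (sP σ)) := by
    rintro _ ⟨x, rfl⟩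
    refine ⟨DL σ x, ?_⟩
    exact (diffDiv_dvr σ x).symm
  have hperm : (dvr L).range ≤ (dvr L).range.comap (permDiv (sP σ)) := by
    intro y hy
    have h1 := hdiff hy
    rw [Subgroup.mem_comap] at *
    have h2 : permDiv (sP σ) y = diffDiv (sP σ) y * y := by
      show _ = (permDiv (sP σ) y / y) * y
      rw [div_mul_cancel]
    rw [h2]
    exact mul_mem h1 hy
  let s : Monoid.End C := QuotientGroup.map _ _ (permDiv (sP σ)) hperm
  let D : C →* C := QuotientGroup.map _ _ (diffDiv (sP σ)) hdiff
  have hspow : ∀ k (n : Dvs L), (s ^ k) (QuotientGroup.mk n) = QuotientGroup.mk ((pE σ ^ k) n) := by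
    intro k
    induction k with
    | zero => intro n; rfl
    | succ k ih =>
      intro n
      rw [pow_succ, pow_succ]
      exact ih _
  let Nm : C →* C := ∏ k ∈ Finset.range p, (show C →* C from s ^ k)
  have hNm : ∀ x, Nm x = ∏ k ∈ Finset.range p, (s ^ k) x := fun x => MonoidHom.finset_prod_apply _ _ _
  have h := rank_bounds p hp s D Nm (by
      intro x
      induction x using QuotientGroup.induction_on with
      | H n => rfl) hNm (Nat.card (ClassGroup (𝓞 K))) hreg (by
      intro x
      induction x using QuotientGroup.induction_on with
      | H n =>
        rw [hNm]
        have e1 : ∏ k ∈ Finset.range p, (s ^ k) (QuotientGroup.mk n) =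
            QuotientGroup.mk (∏ k ∈ Finset.range p, (pE σ ^ k) n) := by
          rw [Finset.prod_congr rfl (fun k _ => hspow k n)]
          exact (map_prod (QuotientGroup.mk' (dvr L).range) _ _).symm
        rw [e1]
        obtain ⟨m, hm⟩ := norm_mem_lift p hp hdeg σ hσ n
        rw [← hm, ← QuotientGroup.mk_pow, QuotientGroup.eq_one_iff, ← map_pow]
        have e2 : m ^ Nat.card (ClassGroup (𝓞 K)) ∈ (dvr K).range := by
          rw [← card_cl_eq]
          exact Subgroup.pow_index_mem _ _
        obtain ⟨x, hx⟩ := e2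
        rw [← hx, liftDiv_dvr]
        exact ⟨_, rfl⟩)
  have hker : Nat.card D.ker = (dvr L).range.relIndex ((dvr L).range.comap (diffDiv (sP σ))) := by
    have e : D.ker = ((dvr L).range.comap (diffDiv (sP σ))).map (QuotientGroup.mk' (dvr L).range) := by
      ext x
      induction x using QuotientGroup.induction_on with
      | H n =>
        rw [MonoidHom.mem_ker]
        constructor
        · intro h
          refine ⟨n, ?_, rfl⟩
          exact (QuotientGroup.eq_one_iff (diffDiv (sP σ) n)).1 h
        · rintro ⟨m, hm, hmn⟩
          rw [← hmn]
          exact (QuotientGroup.eq_one_iff (diffDiv (sP σ) m)).2 hm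
    rw [e, ← Subgroup.relIndex_ker, QuotientGroup.ker_mk']
  rw [hpr, ← hker]
  exact h

end ClassBounds

end PartA9

section PartB1

open IsDedekindDomain nonZeroDivisors

section Kummer
variable {K L : Type*} [Field K] [NumberField K] [Field L] [NumberField L] [Algebra K L]

theorem kummer_data (p : ℕ) (hp : p.Prime) (ζ : K) (hζ : IsPrimitiveRoot ζ p)
    (b : K) (hb : ∀ c, c ^ p ≠ b) (η : L) (hη : η ^ p = algebraMap K L b)
    (hgen : IntermediateField.adjoin K {η} = ⊤) :
    IsGalois K L ∧ Module.finrank K L = p ∧ ∃ σ : L ≃ₐ[K] L, orderOf σ = p ∧ σ η = algebraMap K L ζ * η := by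
  haveI : NeZero p := ⟨hp.ne_zero⟩
  have hirr : Irreducible (X ^ p - C b) := X_pow_sub_C_irreducible_of_prime hp hb
  have hintg : IsIntegral K η := IsIntegral.of_finite K η
  have hmin : minpoly K η = X ^ p - C b := by
    symm
    apply minpoly.eq_of_irreducible_of_monic hirr
    · simp [hη]
    · exact monic_X_pow_sub_C _ hp.ne_zero
  have hdeg : Module.finrank K L = p := by
    have := IntermediateField.adjoin.finrank hintg
    rw [hgen, IntermediateField.finrank_top', hmin, natDegree_X_pow_sub_C] at this
    exact this
  have hζ' : (primitiveRoots p K).Nonempty := ⟨ζ, (mem_primitiveRoots hp.pos).2 hζ⟩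
  haveI : IsSplittingField K L (X ^ p - C b) := by
    have := isSplittingField_X_pow_sub_C_of_root_adjoin_eq_top (K := K) (L := L) (a := b) (α := η)
      (by rw [hdeg]; exact hζ') (by rw [hdeg]; exact hη) hgen
    rwa [hdeg] at this
  refine ⟨isGalois_of_isSplittingField_X_pow_sub_C hζ' hirr L, hdeg,
    (autEquivZmod hirr L hζ).symm (Multiplicative.ofAdd ((1 : ℕ) : ZMod p)), ?_, ?_⟩
  · rw [MulEquiv.orderOf_eq, orderOf_ofAdd_eq_addOrderOf, Nat.cast_one, ZMod.addOrderOf_one]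
  · rw [autEquivZmod_symm_apply_natCast hirr L hη hζ, pow_one, Algebra.smul_def]

theorem units_rank_eq (p : ℕ) (hp2 : 2 < p) (hdeg : Module.finrank K L = p)
    (ζ : K) (hζ : IsPrimitiveRoot ζ p) : Units.rank L + 1 = p * (Units.rank K + 1) := by
  have hK : InfinitePlace.nrRealPlaces K = 0 := NumberField.InfinitePlace.IsPrimitiveRoot.nrRealPlaces_eq_zero_of_two_lt hp2 hζ
  have hL : InfinitePlace.nrRealPlaces L = 0 := NumberField.InfinitePlace.IsPrimitiveRoot.nrRealPlaces_eq_zero_of_two_lt hp2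
    (hζ.map_of_injective (algebraMap K L).injective)
  have h1 := InfinitePlace.card_add_two_mul_card_eq_rank K
  have h2 := InfinitePlace.card_add_two_mul_card_eq_rank L
  have h3 := InfinitePlace.card_eq_nrRealPlaces_add_nrComplexPlaces K
  have h4 := InfinitePlace.card_eq_nrRealPlaces_add_nrComplexPlaces L
  have h5 : Fintype.card (InfinitePlace K) ≠ 0 := Fintype.card_ne_zero
  have h6 : Fintype.card (InfinitePlace L) ≠ 0 := Fintype.card_ne_zero
  have h7 : Module.finrank ℚ K * Module.finrank K L = Module.finrank ℚ L := Module.finrank_mul_finrank ℚ K L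
  rw [hdeg, ← h1, ← h2, hK, hL] at h7
  unfold Units.rank
  rw [Nat.sub_add_cancel (by omega), Nat.sub_add_cancel (by omega), h3, h4, hK, hL]
  linarith

variable (K L) in
/-- units of K inside L -/
noncomputable def eK : (𝓞 K)ˣ →* Lˣ := (Units.map (algebraMap K L : K →* L)).comp (iU K)

theorem eK_val (u : (𝓞 K)ˣ) : ((eK K L u : Lˣ) : L) = algebraMap K L ((u : 𝓞 K) : K) := rfl

theorem eK_range [IsGalois K L] (p : ℕ) (hp : p.Prime) (hdeg : Module.finrank K L = p) (σ : L ≃ₐ[K] L)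
    (hσ : orderOf σ = p) : (eK K L).range = (dvr L).ker ⊓ (DL σ).ker := by
  have hk := ker_DL p hp hdeg σ hσ
  apply le_antisymm
  · rintro _ ⟨u, rfl⟩
    refine Subgroup.mem_inf.2 ⟨?_, ?_⟩
    · rw [dvr_ker]
      exact ⟨Units.map (algebraMap (𝓞 K) (𝓞 L)).toMonoidHom u, by ext; rfl⟩
    · rw [hk]
      exact ⟨iU K u, rfl⟩
  · intro x hx0
    obtain ⟨hx, hx2⟩ := Subgroup.mem_inf.1 hx0
    rw [hk] at hx2
    obtain ⟨y, rfl⟩ := hx2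
    have hy : y ∈ (dvr K).ker := by
      rw [MonoidHom.mem_ker, ← liftDiv_dvr] at hx
      rw [MonoidHom.mem_ker]
      exact liftDiv_inj (by rw [hx, map_one])
    rw [← iU_range] at hy
    obtain ⟨u, rfl⟩ := hy
    exact ⟨u, rfl⟩

/-- units of K that are norms from L -/
noncomputable def nrmU (σ : L ≃ₐ[K] L) (p : ℕ) : Subgroup (𝓞 K)ˣ := (NL σ p).range.comap (eK K L)

theorem nrmU_index [IsGalois K L] (p : ℕ) (hp : p.Prime) (hdeg : Module.finrank K L = p) (σ : L ≃ₐ[K] L)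
    (hσ : orderOf σ = p) : ((dvr L).ker ⊓ (NL σ p).range).relIndex ((dvr L).ker ⊓ (DL σ).ker) = (nrmU σ p).index := by
  rw [nrmU, Subgroup.index_comap, eK_range p hp hdeg σ hσ]
  rw [← Subgroup.inf_relIndex_right, ← Subgroup.inf_relIndex_right (NL σ p).range]
  congr 1
  ext x
  simp only [Subgroup.mem_inf]
  tauto

theorem pow_mem_nrmU (σ : L ≃ₐ[K] L) (p : ℕ) (u : (𝓞 K)ˣ) : u ^ p ∈ nrmU σ p := by
  refine ⟨eK K L u, ?_⟩
  ext
  rw [NL_apply]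
  simp [eK_val]

theorem resid_of_ram [IsGalois K L] (p : ℕ) (hp : p.Prime) (hdeg : Module.finrank K L = p)
    (P : HeightOneSpectrum (𝓞 L)) (hP : ram K P = p) (x : 𝓞 L) :
    ∃ y : 𝓞 K, x - algebraMap (𝓞 K) (𝓞 L) y ∈ P.asIdeal := by
  haveI := IsGaloisGroup.of_isFractionRing Gal(L/K) (𝓞 K) (𝓞 L) K L
  have h := Ideal.ncard_primesOver_mul_ramificationIdxIn_mul_inertiaDegIn (prBelow K P).asIdeal (𝓞 L) Gal(L/K)
  rw [Ideal.ramificationIdxIn_eq_ramificationIdx (prBelow K P).asIdeal P.asIdeal Gal(L/K)] at h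
  rw [IsGalois.card_aut_eq_finrank] at h
  have h2 : ram K P = P.asIdeal.ramificationIdx (𝓞 K) := by
    apply Ideal.ramificationIdx'_eq_ramificationIdx'
    exact Ideal.map_ne_bot_of_ne_bot (prBelow K P).ne_bot
  rw [← h2, hP, hdeg, Ideal.inertiaDegIn_eq_inertiaDeg (prBelow K P).asIdeal P.asIdeal Gal(L/K)] at h
  have hf : P.asIdeal.inertiaDeg (𝓞 K) = 1 := by
    have h3 : ((prBelow K P).asIdeal.primesOver (𝓞 L)).ncard * P.asIdeal.inertiaDeg (𝓞 K) = 1 := by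
      have := hp.pos
      nlinarith
    exact Nat.eq_one_of_mul_eq_one_left h3
  haveI : (prBelow K P).asIdeal.IsMaximal := (prBelow K P).isMaximal
  haveI : P.asIdeal.IsMaximal := P.isMaximal
  rw [Ideal.inertiaDeg_eq_of_isMaximal (prBelow K P).asIdeal P.asIdeal] at hf
  letI : Field (𝓞 K ⧸ (prBelow K P).asIdeal) := Ideal.Quotient.field _
  obtain ⟨c, hc⟩ := (finrank_eq_one_iff_of_nonzero' (1 : 𝓞 L ⧸ P.asIdeal) one_ne_zero).1 hf (Ideal.Quotient.mk _ x)
  obtain ⟨y, rfl⟩ := Ideal.Quotient.mk_surjective c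
  refine ⟨y, ?_⟩
  rw [← Ideal.Quotient.eq, ← hc, Algebra.smul_def, mul_one]
  rfl

theorem val_lt_one_iff (P : HeightOneSpectrum (𝓞 L)) (x : 𝓞 L) : P.valuation L (x : L) < 1 ↔ x ∈ P.asIdeal := by
  exact HeightOneSpectrum.valuation_lt_one_iff_mem P x

theorem sigma_sub_of_ram [IsGalois K L] (p : ℕ) (hp : p.Prime) (hdeg : Module.finrank K L = p)
    (σ : L ≃ₐ[K] L) (P : HeightOneSpectrum (𝓞 L)) (hP : ram K P = p) (x : 𝓞 L) :
    P.valuation L (σ x - x) < 1 := by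
  obtain ⟨y, hy⟩ := resid_of_ram (K := K) p hp hdeg P hP x
  have hs : sP σ P = P := by
    rcases ram_cases p hp hdeg σ P with h | h
    · exact absurd (hP.symm.trans h) hp.one_lt.ne'
    · exact h.2
  have h1 : P.valuation L ((x : L) - algebraMap K L (y : K)) < 1 := by
    have := (val_lt_one_iff P _).2 hy
    exact this
  have h2 := val_sP σ P ((x : L) - algebraMap K L (y : K))
  rw [hs, map_sub, σ.commutes] at h2
  have : σ (x : L) - x = (σ x - algebraMap K L (y : K)) - (x - algebraMap K L (y : K)) := by ring
  rw [this]
  exact (Valuation.map_sub _ _ _).trans_lt (max_lt (h2 ▸ h1) h1)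
end Kummer

end PartB1

section PartB2

open IsDedekindDomain nonZeroDivisors

section CycK
variable {K : Type*} [Field K] [NumberField K] {p : ℕ} [hp : Fact p.Prime] [IsCyclotomicExtension {p} ℚ K]
  {ζ : K} (hζ : IsPrimitiveRoot ζ p) {N : ℕ} [hN : Fact N.Prime]

theorem exists_rho (g : ZMod N) (hg : IsPrimitiveRoot g p) :
    ∃ ρ : 𝓞 K →+* ZMod N, ρ hζ.toInteger = g := by
  have h : aeval g (minpoly ℤ hζ.integralPowerBasis.gen) = 0 := by
    have e : minpoly ℤ hζ.toInteger = minpoly ℤ ζ :=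
      (minpoly.algebraMap_eq (B := 𝓞 K) (B' := K) RingOfIntegers.coe_injective hζ.toInteger).symm
    rw [hζ.integralPowerBasis_gen, e, ← cyclotomic_eq_minpoly hζ hp.out.pos]
    have := hg.isRoot_cyclotomic hp.out.pos
    rw [← map_cyclotomic_int, IsRoot.def, eval_map] at this
    exact this
  refine ⟨(hζ.integralPowerBasis.lift g h).toRingHom, ?_⟩
  have := hζ.integralPowerBasis.lift_gen g h
  rwa [hζ.integralPowerBasis_gen] at this

noncomputable def rho (g : ZMod N) (hg : IsPrimitiveRoot g p) : 𝓞 K →+* ZMod N := (exists_rho hζ g hg).choose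

theorem rho_zeta (g : ZMod N) (hg : IsPrimitiveRoot g p) : rho hζ g hg hζ.toInteger = g :=
  (exists_rho hζ g hg).choose_spec

theorem zeta_poly (x : 𝓞 K) : ∃ h : ℤ[X], aeval hζ.toInteger h = x := by
  have : x ∈ Algebra.adjoin ℤ {hζ.toInteger} := by
    rw [IsCyclotomicExtension.Rat.adjoin_singleton_eq_top hζ]; trivial
  rw [Algebra.adjoin_singleton_eq_range_aeval] at this
  exact this

noncomputable def vN (g : ZMod N) (hg : IsPrimitiveRoot g p) : HeightOneSpectrum (𝓞 K) :=
  ⟨RingHom.ker (rho hζ g hg), RingHom.ker_isPrime _, by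
    intro h
    have : (N : 𝓞 K) ∈ RingHom.ker (rho hζ g hg) := by
      rw [RingHom.mem_ker, map_natCast, ZMod.natCast_self]
    rw [h, Ideal.mem_bot] at this
    exact hN.out.ne_zero (by exact_mod_cast this)⟩

theorem mem_vN (g : ZMod N) (hg : IsPrimitiveRoot g p) (x : 𝓞 K) :
    x ∈ (vN hζ g hg).asIdeal ↔ rho hζ g hg x = 0 := RingHom.mem_ker

theorem N_mem_vN (g : ZMod N) (hg : IsPrimitiveRoot g p) : (N : 𝓞 K) ∈ (vN hζ g hg).asIdeal := by
  rw [mem_vN, map_natCast, ZMod.natCast_self]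

theorem vN_inj (g g' : ZMod N) (hg : IsPrimitiveRoot g p) (hg' : IsPrimitiveRoot g' p)
    (h : vN hζ g hg = vN hζ g' hg') : g = g' := by
  have h1 : hζ.toInteger - (g.val : 𝓞 K) ∈ (vN hζ g hg).asIdeal := by
    rw [mem_vN, map_sub, rho_zeta, map_natCast, ZMod.natCast_zmod_val, sub_self]
  rw [h, mem_vN, map_sub, rho_zeta, map_natCast, ZMod.natCast_zmod_val, sub_eq_zero] at h1
  exact h1.symm

theorem exists_vN (hroot : ∃ f : ZMod N, IsPrimitiveRoot f p) (v : HeightOneSpectrum (𝓞 K)) (hv : (N : 𝓞 K) ∈ v.asIdeal) :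
    ∃ g hg, v = vN hζ (N := N) g hg := by
  obtain ⟨f, hf⟩ := hroot
  haveI := v.isPrime
  have key : (∏ g ∈ primitiveRoots p (ZMod N), (hζ.toInteger - (g.val : 𝓞 K))) ∈ v.asIdeal := by
    have e1 : (∏ g ∈ primitiveRoots p (ZMod N), (X - C (g.val : ℤ)) : ℤ[X]).map (Int.castRingHom (ZMod N)) =
        (cyclotomic p ℤ).map (Int.castRingHom (ZMod N)) := by
      rw [map_cyclotomic_int, cyclotomic_eq_prod_X_sub_primitiveRoots hf, Polynomial.map_prod]
      refine Finset.prod_congr rfl fun g _ => ?_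
      rw [Polynomial.map_sub, map_X, map_C, eq_intCast, Int.cast_natCast, ZMod.natCast_zmod_val]
    have e2 : (C (N : ℤ)) ∣ (∏ g ∈ primitiveRoots p (ZMod N), (X - C (g.val : ℤ)) : ℤ[X]) - cyclotomic p ℤ := by
      rw [C_dvd_iff_dvd_coeff]
      intro i
      have := congrArg (fun q => coeff q i) e1
      simp only [coeff_map] at this
      rw [← sub_eq_zero, ← map_sub] at this
      rw [coeff_sub]
      exact (ZMod.intCast_zmod_eq_zero_iff_dvd _ N).1 this
    obtain ⟨q, hq⟩ := e2
    have e3 := congrArg (aeval hζ.toInteger) hq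
    have e4 : aeval hζ.toInteger (cyclotomic p ℤ) = 0 := by
      have := hζ.toInteger_isPrimitiveRoot.isRoot_cyclotomic hp.out.pos
      rw [← map_cyclotomic_int, IsRoot.def, eval_map] at this
      exact this
    rw [map_sub, e4, sub_zero, map_prod, map_mul, aeval_C] at e3
    simp only [map_sub, aeval_X, aeval_C, map_natCast] at e3
    rw [e3]
    exact Ideal.mul_mem_right _ _ hv
  obtain ⟨g, hg, hm⟩ := (Ideal.IsPrime.prod_mem_iff).1 key
  rw [mem_primitiveRoots hp.out.pos] at hg
  refine ⟨g, hg, ?_⟩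
  have hle : (vN hζ g hg).asIdeal ≤ v.asIdeal := by
    intro x hx
    obtain ⟨h, rfl⟩ := zeta_poly hζ x
    have h1 : hζ.toInteger - (g.val : 𝓞 K) ∣ aeval hζ.toInteger h - aeval (g.val : 𝓞 K) h := by
      rw [aeval_def, aeval_def]
      simpa [eval₂_eq_eval_map] using sub_dvd_eval_sub hζ.toInteger (g.val : 𝓞 K) (h.map (algebraMap ℤ (𝓞 K)))
    have h2 : aeval (g.val : 𝓞 K) h = ((h.eval (g.val : ℤ) : ℤ) : 𝓞 K) := by
      have := aeval_algebraMap_apply (𝓞 K) (g.val : ℤ) h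
      simpa using this
    have h3 : (N : ℤ) ∣ h.eval (g.val : ℤ) := by
      have h4 : aeval hζ.toInteger h - aeval (g.val : 𝓞 K) h ∈ (vN hζ g hg).asIdeal := by
        refine Ideal.mem_of_dvd _ h1 ?_
        rw [mem_vN, map_sub, rho_zeta, map_natCast, ZMod.natCast_zmod_val, sub_self]
      have h5 := (Submodule.sub_mem_iff_right _ hx).1 h4
      rw [h2, mem_vN, map_intCast] at h5
      exact (ZMod.intCast_zmod_eq_zero_iff_dvd _ N).1 h5
    have h6 : aeval (g.val : 𝓞 K) h ∈ v.asIdeal := by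
      rw [h2]
      obtain ⟨c, hc⟩ := h3
      rw [hc]; push_cast
      exact Ideal.mul_mem_right _ _ hv
    have := Ideal.add_mem _ (Ideal.mem_of_dvd _ h1 hm) h6
    simpa using this
  ext1
  exact ((vN hζ g hg).isMaximal.eq_of_le v.isPrime.ne_top hle).symm

include hζ in
/-- primes above N -/
theorem card_primes_N (hroot : ∃ f : ZMod N, IsPrimitiveRoot f p) :
    {v : HeightOneSpectrum (𝓞 K) | (N : 𝓞 K) ∈ v.asIdeal}.ncard = p - 1 := by
  obtain ⟨f, hf⟩ := id hroot
  rw [← Nat.totient_prime hp.out, ← hf.card_primitiveRoots, ← Set.ncard_coe_finset]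
  symm
  refine Set.ncard_congr (fun g hg => vN hζ g ((mem_primitiveRoots hp.out.pos).1 hg)) ?_ ?_ ?_
  · intro g hg; exact N_mem_vN hζ _ _
  · intro a b ha hb h; exact vN_inj hζ _ _ _ _ h
  · intro v hv
    obtain ⟨g, hg, rfl⟩ := exists_vN hζ hroot v hv
    exact ⟨g, (mem_primitiveRoots hp.out.pos).2 hg, rfl⟩

theorem liesOver_of_mem (q : ℕ) [hq : Fact q.Prime] (v : HeightOneSpectrum (𝓞 K)) (hv : (q : 𝓞 K) ∈ v.asIdeal) :
    v.asIdeal.LiesOver (Ideal.span {(q : ℤ)}) := by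
  haveI := v.isPrime
  rw [Ideal.liesOver_iff]
  refine Ideal.IsMaximal.eq_of_le (Int.ideal_span_isMaximal_of_prime q) Ideal.IsPrime.ne_top' ?_
  rw [Ideal.span_singleton_le_iff_mem, Ideal.mem_comap, algebraMap_int_eq, map_natCast]
  exact hv

include hζ in
theorem val_N (hNp : N ≠ p) (v : HeightOneSpectrum (𝓞 K)) (hv : (N : 𝓞 K) ∈ v.asIdeal) :
    v.valuation K (N : K) = WithZero.exp (-1 : ℤ) := by
  haveI := v.isPrime
  haveI := liesOver_of_mem N v hv
  have h := IsCyclotomicExtension.Rat.ramificationIdx_eq_of_not_dvd N K v.asIdeal (m := p)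
    (by rw [Nat.prime_dvd_prime_iff_eq hN.out hp.out]; exact hNp)
  have hne : Ideal.span {(N : ℤ)} ≠ ⊥ := by simpa using hN.out.ne_zero
  let w : HeightOneSpectrum ℤ := ⟨Ideal.span {(N : ℤ)}, (Int.ideal_span_isMaximal_of_prime N).isPrime, hne⟩
  haveI : v.asIdeal.LiesOver w.asIdeal := this
  have h2 := HeightOneSpectrum.intValuation_liesOver w v (N : ℤ)
  have h5 : w.asIdeal.ramificationIdx' v.asIdeal = v.asIdeal.ramificationIdx ℤ :=
    Ideal.ramificationIdx'_eq_ramificationIdx' (p := w.asIdeal) v.asIdeal (Ideal.map_ne_bot_of_ne_bot hne)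
  rw [h5, h, pow_one,
    HeightOneSpectrum.intValuation_singleton w (by exact_mod_cast hN.out.ne_zero) rfl] at h2
  have h3 := HeightOneSpectrum.valuation_of_algebraMap (K := K) v (N : 𝓞 K)
  have h4 : (((N : 𝓞 K)) : K) = (N : K) := map_natCast (algebraMap (𝓞 K) K) _
  have h6 : algebraMap ℤ (𝓞 K) (N : ℤ) = (N : 𝓞 K) := by simp
  have h7 : v.valuation K (N : K) = v.intValuation (N : 𝓞 K) := by
    rw [← h3]; exact congrArg (v.valuation K) h4.symm
  rw [h7, h2, h6]

theorem prime_p_eq (v : HeightOneSpectrum (𝓞 K)) (hv : (p : 𝓞 K) ∈ v.asIdeal) :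
    v.asIdeal = Ideal.span {hζ.toInteger - 1} := by
  haveI := v.isPrime
  haveI := liesOver_of_mem p v hv
  exact IsCyclotomicExtension.Rat.eq_span_zeta_sub_one_of_liesOver' p K hζ v.asIdeal

include hζ in
theorem val_lam (v : HeightOneSpectrum (𝓞 K)) (hv : (p : 𝓞 K) ∈ v.asIdeal) :
    v.valuation K (ζ - 1) = WithZero.exp (-1 : ℤ) := by
  have h := prime_p_eq hζ v hv
  have h0 : hζ.toInteger - 1 ≠ 0 := fun h0 => v.ne_bot (by rw [h, h0]; simp)
  have := HeightOneSpectrum.intValuation_singleton v h0 h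
  rw [← this, ← HeightOneSpectrum.valuation_of_algebraMap (K := K) v]
  simp; rfl

theorem exists_prime_p : ∃ v : HeightOneSpectrum (𝓞 K), (p : 𝓞 K) ∈ v.asIdeal := by
  have hζ := IsCyclotomicExtension.zeta_spec p ℚ K
  have hdvd : hζ.toInteger - 1 ∣ (p : 𝓞 K) := by
    have := (IsCyclotomicExtension.Rat.zeta_sub_one_dvd_intCast_iff' (p := p) hζ (n := p)).2 dvd_rfl
    exact_mod_cast this
  refine ⟨⟨Ideal.span {hζ.toInteger - 1}, inferInstance, ?_⟩, ?_⟩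
  · intro h
    rw [Ideal.span_singleton_eq_bot] at h
    rw [h, zero_dvd_iff] at hdvd
    exact hp.out.ne_zero (by exact_mod_cast hdvd)
  · exact Ideal.mem_span_singleton.2 hdvd

theorem card_primes_p : {v : HeightOneSpectrum (𝓞 K) | (p : 𝓞 K) ∈ v.asIdeal}.ncard = 1 := by
  obtain ⟨v, hv⟩ := exists_prime_p (K := K) (p := p)
  rw [Set.ncard_eq_one]
  refine ⟨v, ?_⟩
  ext w
  refine ⟨fun hw => ?_, fun hw => by rw [Set.mem_singleton_iff.1 hw]; exact hv⟩
  have hζ := IsCyclotomicExtension.zeta_spec p ℚ K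
  rw [Set.mem_singleton_iff]; ext1
  rw [prime_p_eq hζ w hw, prime_p_eq hζ v hv]

include hζ in
/-- p is a unit times (ζ-1)^(p-1), in valuation form, in any overfield -/
theorem lam_pow_eq : ∃ u : (𝓞 K)ˣ, (ζ - 1) ^ (p - 1) * ((u : 𝓞 K) : K) = p := by
  obtain ⟨u, hu⟩ := IsCyclotomicExtension.Rat.associated_zeta_sub_one_pow_prime p hζ
  refine ⟨u, ?_⟩
  have := congrArg (algebraMap (𝓞 K) K) hu
  rw [map_mul, map_pow, map_sub, map_one, map_natCast] at this
  exact this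
end CycK

end PartB2

section PartB3

open IsDedekindDomain nonZeroDivisors

section RamL
variable {K L : Type*} [Field K] [NumberField K] [Field L] [NumberField L] [Algebra K L]
 {p : ℕ} [hp : Fact p.Prime] [IsCyclotomicExtension {p} ℚ K]
  {ζ : K} (hζ : IsPrimitiveRoot ζ p) 

theorem val_int_le (P : HeightOneSpectrum (𝓞 L)) (x : L) (hx : IsIntegral ℤ x) : P.valuation L x ≤ 1 :=
  P.valuation_le_one (⟨x, hx⟩ : 𝓞 L)

theorem nat_int (n : ℕ) : IsIntegral ℤ (n : L) := by
  have := isIntegral_algebraMap (R := ℤ) (A := L) (x := (n : ℤ))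
  simpa using this

theorem root_int {N : ℕ} (α : L) (hα : α ^ p = (N : L)) : IsIntegral ℤ α := by
  refine IsIntegral.of_pow hp.out.pos (n := p) ?_
  rw [hα]; exact nat_int N

theorem val_one_of_not_mem (P : HeightOneSpectrum (𝓞 L)) (x : 𝓞 L) (hx : x ∉ P.asIdeal) : P.valuation L (x : L) = 1 := by
  refine le_antisymm (P.valuation_le_one x) ?_
  rw [← not_lt, val_lt_one_iff]; exact hx

theorem val_unit (P : HeightOneSpectrum (𝓞 L)) (u : (𝓞 L)ˣ) : P.valuation L ((u : 𝓞 L) : L) = 1 := by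
  refine val_one_of_not_mem P _ fun h => P.isPrime.ne_top (Ideal.eq_top_of_isUnit_mem _ h u.isUnit)

theorem p_mem_iff (P : HeightOneSpectrum (𝓞 L)) (n : ℕ) : (n : 𝓞 K) ∈ (prBelow K P).asIdeal ↔ (n : 𝓞 L) ∈ P.asIdeal := by
  rw [mem_prBelow, map_natCast]

theorem val_nat_lt (P : HeightOneSpectrum (𝓞 L)) (n : ℕ) : P.valuation L (n : L) < 1 ↔ (n : 𝓞 L) ∈ P.asIdeal := by
  rw [← val_lt_one_iff]; simp

include hζ in
theorem val_p (P : HeightOneSpectrum (𝓞 L)) : P.valuation L (p : L) = P.valuation L (algebraMap K L ζ - 1) ^ (p - 1) := by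
  obtain ⟨u, hu⟩ := lam_pow_eq hζ
  have h := congrArg (algebraMap K L) hu
  rw [map_mul, map_pow, map_sub, map_one, map_natCast] at h
  rw [← h, map_mul, map_pow]
  have := val_unit P (Units.map (algebraMap (𝓞 K) (𝓞 L)).toMonoidHom u)
  have e : P.valuation L (algebraMap K L ((u : 𝓞 K) : K)) = 1 := this
  rw [e, mul_one]

include hζ in
theorem not_ram_of_unit [IsGalois K L] (hdeg : Module.finrank K L = p)
    (σ : L ≃ₐ[K] L) (P : HeightOneSpectrum (𝓞 L)) (η : L) (hη : IsIntegral ℤ η) (hu : P.valuation L η = 1)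
    (hση : σ η = algebraMap K L ζ * η) (hpP : (p : 𝓞 L) ∉ P.asIdeal) : ram K P ≠ p := by
  intro hP
  have h := sigma_sub_of_ram (K := K) p hp.out hdeg σ P hP ⟨η, hη⟩
  have e : σ η - η = (algebraMap K L ζ - 1) * η := by rw [hση]; ring
  have h' : P.valuation L (σ η - η) < 1 := h
  rw [e, map_mul, hu, mul_one] at h'
  apply hpP
  rw [← val_nat_lt, val_p hζ]
  exact pow_lt_one₀ zero_le' h' (Nat.sub_ne_zero_of_lt hp.out.one_lt)

include hζ in
theorem ram_at_N [IsGalois K L] (hdeg : Module.finrank K L = p)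
    (σ : L ≃ₐ[K] L) {N : ℕ} [hN : Fact N.Prime] (hNp : N ≠ p) (α : L) (hα : α ^ p = (N : L))
    (P : HeightOneSpectrum (𝓞 L)) (hP : (N : 𝓞 L) ∈ P.asIdeal) : ram K P = p := by
  rcases ram_cases p hp.out hdeg σ P with h | h
  · exfalso
    have h1 := val_N hζ hNp (prBelow K P) ((p_mem_iff P N).2 hP)
    have h2 := val_below (K := K) P (N : K)
    rw [map_natCast, h1, h, pow_one, ← hα, map_pow] at h2
    have hα0 : P.valuation L α ≠ 0 := by
      intro h0; rw [h0, zero_pow hp.out.ne_zero] at h2; exact WithZero.exp_ne_zero h2.symm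
    rw [← WithZero.exp_log hα0, ← WithZero.exp_nsmul, WithZero.exp_inj, nsmul_eq_mul] at h2
    have : (p : ℤ) ∣ 1 := by
      rw [← Int.dvd_neg]; exact ⟨_, h2.symm⟩
    exact hp.out.one_lt.ne' (by exact_mod_cast Int.eq_one_of_dvd_one (by positivity) this)
  · exact h.1

theorem alpha_expand {N : ℕ} (α : L) (hαi : IsIntegral ℤ α) (hα : α ^ p = (N : L)) :
    ∃ r : L, IsIntegral ℤ r ∧ (α - 1) ^ p = (N : L) - 1 - p * (α - 1) * r := by
  obtain ⟨a, rfl⟩ : ∃ a : 𝓞 L, (a : L) = α := ⟨⟨α, hαi⟩, rfl⟩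
  obtain ⟨r, hr⟩ := exists_add_pow_prime_eq hp.out (a - 1 : 𝓞 L) 1
  refine ⟨(r : L), r.2, ?_⟩
  have := congrArg (algebraMap (𝓞 L) L) hr
  simp only [sub_add_cancel, map_add, map_sub, map_mul, map_pow, map_natCast, map_one, one_pow, mul_one] at this
  rw [hα] at this
  linear_combination -this

include hζ in
theorem ram_at_p [IsGalois K L] (hdeg : Module.finrank K L = p)
    (σ : L ≃ₐ[K] L) {N : ℕ} [hN : Fact N.Prime] (hmod : N ≡ 1 [MOD p]) (hmod2 : ¬ p ^ 2 ∣ N - 1)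
    (α : L) (hα : α ^ p = (N : L))
    (P : HeightOneSpectrum (𝓞 L)) (hP : (p : 𝓞 L) ∈ P.asIdeal) : ram K P = p := by
  rcases ram_cases p hp.out hdeg σ P with h | h
  · exfalso
    have hαi : IsIntegral ℤ α := root_int (p := p) α hα
    obtain ⟨r, hri, hr⟩ := alpha_expand (p := p) α hαi hα
    have h1 : P.valuation L (algebraMap K L ζ - 1) = WithZero.exp (-1 : ℤ) := by
      have := val_below (K := K) P (ζ - 1)
      rw [map_sub, map_one, h, pow_one, val_lam hζ _ ((p_mem_iff P p).2 hP)] at this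
      exact this
    have h2 := val_p hζ P
    rw [h1, ← WithZero.exp_nsmul] at h2
    obtain ⟨c, hc⟩ := (Nat.modEq_iff_dvd' hN.out.one_le).1 hmod.symm
    have hcp : ¬ p ∣ c := fun ⟨d, hd⟩ => hmod2 ⟨d, by rw [hc, hd]; ring⟩
    have h3 : P.valuation L ((N : L) - 1) = P.valuation L (p : L) := by
      have e : (N : L) - 1 = p * c := by
        have := hN.out.one_le
        rw [← Nat.cast_one, ← Nat.cast_sub this, hc]; push_cast; rfl
      rw [e, map_mul]
      have : P.valuation L (c : L) = 1 := by
        refine le_antisymm (val_int_le P _ (nat_int c)) ?_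
        rw [← not_lt, val_nat_lt]
        intro hcm
        have hcop : IsCoprime (p : ℤ) (c : ℤ) := Nat.isCoprime_iff_coprime.2 ((Nat.Prime.coprime_iff_not_dvd hp.out).2 hcp)
        obtain ⟨a, b, hab⟩ := hcop
        apply P.isPrime.ne_top
        rw [Ideal.eq_top_iff_one]
        have hh := congrArg (Int.cast (R := 𝓞 L)) hab
        push_cast at hh
        rw [← hh]
        exact Ideal.add_mem _ (Ideal.mul_mem_left _ _ hP) (Ideal.mul_mem_left _ _ hcm)
      rw [this, mul_one]
    have hp1 : P.valuation L (p : L) < 1 := (val_nat_lt P p).2 hP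
    have hp0 : P.valuation L (p : L) ≠ 0 := by rw [h2]; exact WithZero.exp_ne_zero
    have hri' := val_int_le P r hri
    have hy1 := val_int_le P (α - 1) (hαi.sub isIntegral_one)
    have hylt : P.valuation L (α - 1) < 1 := by
      by_contra hcon
      have hy : P.valuation L (α - 1) = 1 := le_antisymm hy1 (not_lt.1 hcon)
      have e := congrArg (P.valuation L) hr
      rw [map_pow, hy, one_pow] at e
      have : P.valuation L ((N : L) - 1 - p * (α - 1) * r) < 1 := by
        refine (Valuation.map_sub _ _ _).trans_lt (max_lt (h3 ▸ hp1) ?_)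
        rw [map_mul, map_mul]
        exact (mul_le_of_le_one_right' hri').trans_lt ((mul_le_of_le_one_right' hy1).trans_lt hp1)
      rw [← e] at this
      exact lt_irrefl _ this
    have e := congrArg (P.valuation L) hr
    have e3 : P.valuation L (p * (α - 1) * r) < P.valuation L ((N : L) - 1) := by
      rw [h3, map_mul, map_mul]
      refine (mul_le_of_le_one_right' hri').trans_lt ?_
      calc _ < P.valuation L (p : L) * 1 := by
            exact mul_lt_mul_of_pos_left hylt (zero_lt_iff.2 hp0)
        _ = _ := mul_one _
    rw [map_pow, Valuation.map_sub_eq_of_lt_left _ e3, h3, h2] at e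
    · have hα0 : P.valuation L (α - 1) ≠ 0 := by
        intro h0; rw [h0, zero_pow hp.out.ne_zero] at e; exact WithZero.exp_ne_zero e.symm
      rw [← WithZero.exp_log hα0, ← WithZero.exp_nsmul, WithZero.exp_inj, nsmul_eq_mul, nsmul_eq_mul,
        Nat.cast_sub hp.out.one_le] at e
      have : (p : ℤ) ∣ 1 := by
        refine ⟨WithZero.log (P.valuation L (α - 1)) + 1, ?_⟩
        push_cast at e
        linear_combination -e
      exact hp.out.one_lt.ne' (by exact_mod_cast Int.eq_one_of_dvd_one (by positivity) this)
  · exact h.1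

include hζ in
theorem unram_at_p [IsGalois K L] (hdeg : Module.finrank K L = p) (hpodd : Odd p)
    (σ : L ≃ₐ[K] L) {N : ℕ} [hN : Fact N.Prime] (hmod2 : p ^ 2 ∣ N - 1)
    (α : L) (hα : α ^ p = (N : L)) (hσα : σ α = algebraMap K L ζ * α)
    (P : HeightOneSpectrum (𝓞 L)) (hP : (p : 𝓞 L) ∈ P.asIdeal) : ram K P ≠ p := by
  intro hram
  have hαi : IsIntegral ℤ α := root_int (p := p) α hα
  obtain ⟨r, hri, hr⟩ := alpha_expand (p := p) α hαi hα
  obtain ⟨c, hc⟩ := hmod2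
  have eN : (N : L) - 1 = p ^ 2 * c := by
    have := hN.out.one_le
    rw [← Nat.cast_one, ← Nat.cast_sub this, hc]; push_cast; rfl
  have hζ1 : algebraMap K L ζ - 1 ≠ 0 := by
    rw [sub_ne_zero, ← map_one (algebraMap K L)]
    exact fun h => hζ.ne_one hp.out.one_lt ((algebraMap K L).injective h)
  have hp3 : 3 ≤ p := by
    have := hp.out.two_le
    rcases hpodd with ⟨k, hk⟩; omega
  have key : ∀ Q : HeightOneSpectrum (𝓞 L), Q.valuation L (α - 1) ≤ Q.valuation L (algebraMap K L ζ - 1) := by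
    intro Q
    by_contra hcon
    rw [not_le] at hcon
    have hl1 : Q.valuation L (algebraMap K L ζ - 1) ≤ 1 := by
      have : IsIntegral ℤ (algebraMap K L ζ - 1) := 
        (hζ.map_of_injective (algebraMap K L).injective |>.isIntegral hp.out.pos).sub isIntegral_one
      exact val_int_le Q _ this
    have hl0 : 0 < Q.valuation L (algebraMap K L ζ - 1) := zero_lt_iff.2 ((Valuation.ne_zero_iff _).2 hζ1)
    have e := congrArg (Q.valuation L) hr
    rw [map_pow] at e
    have hle : Q.valuation L ((N : L) - 1 - p * (α - 1) * r) < Q.valuation L (α - 1) ^ p := by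
      refine (Valuation.map_sub _ _ _).trans_lt (max_lt ?_ ?_)
      · rw [eN, map_mul, map_pow, val_p hζ, ← pow_mul]
        calc _ ≤ Q.valuation L (algebraMap K L ζ - 1) ^ ((p - 1) * 2) := 
              mul_le_of_le_one_right' (val_int_le Q _ (nat_int c))
          _ ≤ Q.valuation L (algebraMap K L ζ - 1) ^ p := pow_le_pow_right_of_le_one' hl1 (by omega)
          _ < _ := pow_lt_pow_left₀ hcon zero_le' hp.out.ne_zero
      · rw [map_mul, map_mul, val_p hζ]
        calc _ ≤ Q.valuation L (algebraMap K L ζ - 1) ^ (p - 1) * Q.valuation L (α - 1) := 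
              mul_le_of_le_one_right' (val_int_le Q _ hri)
          _ < Q.valuation L (α - 1) ^ (p - 1) * Q.valuation L (α - 1) :=
              mul_lt_mul_of_pos_right (pow_lt_pow_left₀ hcon zero_le' (by omega)) (hl0.trans hcon)
          _ = _ := by rw [← pow_succ]; congr 1; omega
    rw [← e] at hle
    exact lt_irrefl _ hle
  obtain ⟨x, hx⟩ := HeightOneSpectrum.mem_integers_of_valuation_le_one L ((α - 1) / (algebraMap K L ζ - 1)) (by
    intro Q
    rw [map_div₀]
    exact div_le_one_of_le₀ (key Q) zero_le')
  have h := sigma_sub_of_ram (K := K) p hp.out hdeg σ P hram x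
  have e2 : σ (x : L) - x = α := by
    have hx' : (x : L) = (α - 1) / (algebraMap K L ζ - 1) := hx
    rw [hx', map_div₀, map_sub, map_sub, map_one, AlgEquiv.commutes, hσα]
    field_simp
    ring
  rw [e2] at h
  have h3 : P.valuation L (N : L) < 1 := by
    rw [← hα, map_pow]; exact pow_lt_one₀ zero_le' h hp.out.ne_zero
  rw [val_nat_lt] at h3
  apply P.isPrime.ne_top
  rw [Ideal.eq_top_iff_one]
  have : (1 : 𝓞 L) = (N : 𝓞 L) - p * (p * c) := by
    have h4 : N = p ^ 2 * c + 1 := by have := hN.out.one_le; omega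
    rw [h4]; push_cast; ring
  rw [this]
  exact Ideal.sub_mem _ h3 (Ideal.mul_mem_right _ _ hP)

theorem inj_ram [IsGalois K L] (hdeg : Module.finrank K L = p) (σ : L ≃ₐ[K] L) (hσ : orderOf σ = p)
    (P Q : HeightOneSpectrum (𝓞 L)) (hP : ram K P = p) (h : prBelow K P = prBelow K Q) : P = Q := by
  obtain ⟨τ, rfl⟩ := exists_sP_of_below P Q h
  obtain ⟨k, rfl⟩ := sigma_gen p hp.out hdeg σ hσ τ
  have hs : sP σ P = P := by
    rcases ram_cases p hp.out hdeg σ P with h | h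
    · exact absurd (hP.symm.trans h) hp.out.one_lt.ne'
    · exact h.2
  rw [sP_pow]
  clear h
  induction k with
  | zero => simp
  | succ k ih => rw [pow_succ, Equiv.Perm.mul_apply, hs, ← ih]

theorem finite_mem (n : ℕ) (hn : n ≠ 0) : {v : HeightOneSpectrum (𝓞 K) | (n : 𝓞 K) ∈ v.asIdeal}.Finite := by
  have := HeightOneSpectrum.Support.finite (R := 𝓞 K) (K := K) ((n : K)⁻¹)
  refine this.subset ?_
  intro v hv
  have h1 := (val_nat_lt v n).2 hv
  show 1 < v.valuation K ((n : K)⁻¹)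
  rw [map_inv₀]
  refine (one_lt_inv₀ ?_).2 h1
  rw [zero_lt_iff, Valuation.ne_zero_iff]; exact_mod_cast hn

include hζ in
theorem card_ram [IsGalois K L] (hdeg : Module.finrank K L = p) (hpodd : Odd p)
    (σ : L ≃ₐ[K] L) (hσ : orderOf σ = p) {N : ℕ} [hN : Fact N.Prime] (hNp : N ≠ p) (hmod : N ≡ 1 [MOD p])
    (hroot : ∃ f : ZMod N, IsPrimitiveRoot f p)
    (α : L) (hα : α ^ p = (N : L)) (hσα : σ α = algebraMap K L ζ * α) :
    {P : HeightOneSpectrum (𝓞 L) | ram K P = p}.Finite ∧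
    Nat.card {P : HeightOneSpectrum (𝓞 L) | ram K P = p} = p - 1 + (if p ^ 2 ∣ N - 1 then 0 else 1) := by
  classical
  have hαi : IsIntegral ℤ α := root_int (p := p) α hα
  have hiff : ∀ P : HeightOneSpectrum (𝓞 L), ram K P = p ↔ ((N : 𝓞 K) ∈ (prBelow K P).asIdeal ∨
      ((p : 𝓞 K) ∈ (prBelow K P).asIdeal ∧ ¬ p ^ 2 ∣ N - 1)) := by
    intro P
    rw [p_mem_iff, p_mem_iff]
    constructor
    · intro h
      by_contra hcon
      push Not at hcon
      by_cases hpP : (p : 𝓞 L) ∈ P.asIdeal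
      · exact unram_at_p hζ hdeg hpodd σ (hcon.2 hpP) α hα hσα P hpP h
      · refine not_ram_of_unit hζ hdeg σ P α hαi ?_ hσα hpP h
        have h1 := val_int_le P α hαi
        by_contra h2
        have h3 := pow_lt_one₀ zero_le' (lt_of_le_of_ne h1 h2) hp.out.ne_zero
        rw [← map_pow, hα, val_nat_lt] at h3
        exact hcon.1 h3
    · rintro (h | ⟨h, h2⟩)
      · exact ram_at_N hζ hdeg σ hNp α hα P h
      · exact ram_at_p hζ hdeg σ hmod h2 α hα P h
  have himg : prBelow K '' {P : HeightOneSpectrum (𝓞 L) | ram K P = p} =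
      {v : HeightOneSpectrum (𝓞 K) | (N : 𝓞 K) ∈ v.asIdeal} ∪
       (if p ^ 2 ∣ N - 1 then ∅ else {v : HeightOneSpectrum (𝓞 K) | (p : 𝓞 K) ∈ v.asIdeal}) := by
    ext v
    constructor
    · rintro ⟨P, hP, rfl⟩
      rcases (hiff P).1 hP with h | h
      · exact Or.inl h
      · right; rw [if_neg h.2]; exact h.1
    · intro hv
      obtain ⟨P, rfl⟩ := prBelow_surj (L := L) v
      refine ⟨P, (hiff P).2 ?_, rfl⟩
      rcases hv with h | h
      · exact Or.inl h
      · by_cases hd : p ^ 2 ∣ N - 1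
        · rw [if_pos hd] at h; exact h.elim
        · rw [if_neg hd] at h; exact Or.inr ⟨h, hd⟩
  have hinj : Set.InjOn (prBelow K) {P : HeightOneSpectrum (𝓞 L) | ram K P = p} :=
    fun P hP Q _ h => inj_ram hdeg σ hσ P Q hP h
  have hfin1 := finite_mem (K := K) N hN.out.ne_zero
  have hfin2 := finite_mem (K := K) p hp.out.ne_zero
  have hfin : (prBelow K '' {P : HeightOneSpectrum (𝓞 L) | ram K P = p}).Finite := by
    rw [himg]
    refine hfin1.union ?_
    split_ifs
    · exact Set.finite_empty
    · exact hfin2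
  refine ⟨hfin.of_finite_image hinj, ?_⟩
  rw [Nat.card_coe_set_eq, ← Set.ncard_image_of_injOn hinj, himg]
  rw [Set.ncard_union_eq ?_ hfin1 ?_]
  · rw [card_primes_N hζ hroot]
    congr 1
    split_ifs
    · simp
    · exact card_primes_p
  · split_ifs
    · simp
    · rw [Set.disjoint_left]
      intro v h1 h2
      have hcop : IsCoprime (p : ℤ) (N : ℤ) := Nat.isCoprime_iff_coprime.2 ((Nat.coprime_primes hp.out hN.out).2 hNp.symm)
      obtain ⟨a, b, hab⟩ := hcop
      apply v.isPrime.ne_top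
      rw [Ideal.eq_top_iff_one]
      have hh := congrArg (Int.cast (R := 𝓞 K)) hab
      push_cast at hh
      rw [← hh]
      exact Ideal.add_mem _ (Ideal.mul_mem_left _ _ h2) (Ideal.mul_mem_left _ _ h1)
  · split_ifs
    · exact Set.finite_empty
    · exact hfin2
end RamL

end PartB3

section PartB4

open IsDedekindDomain nonZeroDivisors

section NormRes
variable {K L : Type*} [Field K] [NumberField K] [Field L] [NumberField L] [Algebra K L]
 {p : ℕ} [hp : Fact p.Prime] 

/-- a norm unit is a `p`-th power modulo ramified primes -/
theorem norm_residue [IsGalois K L] (hdeg : Module.finrank K L = p)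
    (σ : L ≃ₐ[K] L) (u : (𝓞 K)ˣ) (hu : u ∈ nrmU σ p) (P : HeightOneSpectrum (𝓞 L)) (hP : ram K P = p) :
    ∃ y : 𝓞 K, (u : 𝓞 K) - y ^ p ∈ (prBelow K P).asIdeal := by
  obtain ⟨γ, hγ⟩ := hu
  have hs : sP σ P = P := by
    rcases ram_cases p hp.out hdeg σ P with h | h
    · exact absurd (hP.symm.trans h) hp.out.one_lt.ne'
    · exact h.2
  have hv : ∀ x : L, P.valuation L (σ x) = P.valuation L x := by
    intro x
    have := val_sP σ P x
    rwa [hs] at this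
  have hvk : ∀ (k : ℕ) (x : L), P.valuation L ((σ ^ k) x) = P.valuation L x := by
    intro k
    induction k with
    | zero => intro x; simp
    | succ k ih => intro x; rw [pow_succ, AlgEquiv.mul_apply, ih, hv]
  have hγ' : ∏ k ∈ Finset.range p, (σ ^ k) (γ : L) = algebraMap K L ((u : 𝓞 K) : K) := by
    rw [← NL_apply, hγ, eK_val]
  have hγ1 : P.valuation L (γ : L) = 1 := by
    have h := congrArg (P.valuation L) hγ'
    rw [map_prod] at h
    simp only [hvk] at h
    have e : P.valuation L (algebraMap K L ((u : 𝓞 K) : K)) = 1 :=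
      val_unit P (Units.map (algebraMap (𝓞 K) (𝓞 L)).toMonoidHom u)
    rw [e, Finset.prod_const, Finset.card_range] at h
    exact (pow_eq_one_iff_of_nonneg zero_le' hp.out.ne_zero).1 h
  obtain ⟨x, hx⟩ := HeightOneSpectrum.exists_valuation_sub_lt_of_integer (K := L) P hγ1.le (γ := 1) 
  obtain ⟨y, hy⟩ := resid_of_ram (K := K) p hp.out hdeg P hP x
  refine ⟨y, ?_⟩
  rw [mem_prBelow, ← val_lt_one_iff]
  have hxy : P.valuation L ((γ : L) - algebraMap K L (y : K)) < 1 := by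
    have h1 : P.valuation L ((x : L) - algebraMap K L (y : K)) < 1 := (val_lt_one_iff P _).2 hy
    have h2 : P.valuation L ((x : L) - γ) < 1 := by
      simpa using hx
    have : (γ : L) - algebraMap K L (y : K) = ((x : L) - algebraMap K L (y : K)) - (x - γ) := by ring
    rw [this]
    exact (Valuation.map_sub _ _ _).trans_lt (max_lt h1 h2)
  have hyk : ∀ k, P.valuation L ((σ ^ k) (γ : L) - algebraMap K L (y : K)) < 1 := by
    intro k
    have := hvk k ((γ : L) - algebraMap K L (y : K))
    rw [map_sub, AlgEquiv.commutes] at this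
    rw [this]; exact hxy
  have hprod : ∀ n, P.valuation L (∏ k ∈ Finset.range n, (σ ^ k) (γ : L) - algebraMap K L (y : K) ^ n) < 1 := by
    intro n
    induction n with
    | zero => simp
    | succ n ih =>
      rw [Finset.prod_range_succ, pow_succ]
      set A := ∏ k ∈ Finset.range n, (σ ^ k) (γ : L)
      set B := algebraMap K L (y : K)
      have : A * (σ ^ n) (γ : L) - B ^ n * B = (A - B ^ n) * (σ ^ n) (γ : L) + B ^ n * ((σ ^ n) (γ : L) - B) := by ring
      rw [this]
      refine (Valuation.map_add _ _ _).trans_lt (max_lt ?_ ?_)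
      · rw [map_mul, hvk, hγ1, mul_one]; exact ih
      · rw [map_mul, map_pow]
        refine (mul_le_of_le_one_left' (pow_le_one₀ zero_le' ?_)).trans_lt (hyk n)
        exact P.valuation_le_one (algebraMap (𝓞 K) (𝓞 L) y)
  have := hprod p
  rw [hγ'] at this
  have e : ((algebraMap (𝓞 K) (𝓞 L) (u - y ^ p) : 𝓞 L) : L) = algebraMap K L ((u : 𝓞 K) : K) - algebraMap K L (y : K) ^ p := by
    have : ((algebraMap (𝓞 K) (𝓞 L) (u - y ^ p) : 𝓞 L) : L) = algebraMap K L (((u : 𝓞 K) - y ^ p : 𝓞 K) : K) := rfl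
    rw [this]; simp
  rw [e]; exact this

end NormRes

end PartB4

section PartB5

open IsDedekindDomain nonZeroDivisors

section UnitExt
variable {K L : Type*} [Field K] [NumberField K] [Field L] [NumberField L] [Algebra K L]
 {p : ℕ} [hp : Fact p.Prime] [IsCyclotomicExtension {p} ℚ K]
  {ζ : K} (hζ : IsPrimitiveRoot ζ p)

/-- a subgroup of index not divisible by `p` containing all `p`-th powers is everything -/
theorem eq_top_of_pow {G : Type*} [CommGroup G] (H : Subgroup G) (hH : ∀ g, g ^ p ∈ H) (hi : ¬ p ∣ H.index) : H = ⊤ := by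
  have hi0 : H.index ≠ 0 := fun h => hi (h ▸ dvd_zero p)
  haveI : H.FiniteIndex := ⟨hi0⟩
  rw [eq_top_iff]
  intro g _
  rw [← QuotientGroup.eq_one_iff]
  have h1 : (g : G ⧸ H) ^ p = 1 := by
    rw [← QuotientGroup.mk_pow, QuotientGroup.eq_one_iff]; exact hH g
  have h2 : (g : G ⧸ H) ^ H.index = 1 := by
    rw [Subgroup.index]; exact pow_card_eq_one'
  have h3 : Nat.Coprime p H.index := (Nat.Prime.coprime_iff_not_dvd hp.out).2 hi
  have := pow_gcd_eq_one.2 ⟨h1, h2⟩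
  rwa [h3, pow_one] at this

theorem not_dvd_of_pRank {G : Type*} [CommGroup G] [Finite G] (h : pRank p G = 0) : ¬ p ∣ Nat.card G := by
  intro hd
  obtain ⟨g, hg⟩ := exists_prime_orderOf_dvd_card' p hd
  have hsub : p ∣ Nat.card {g : G // g ^ p = 1} := by
    let H : Subgroup G := (powMonoidHom p).ker
    have h1 : Nat.card {g : G // g ^ p = 1} = Nat.card H := rfl
    rw [h1]
    have hgH : g ∈ H := by
      show g ^ p = 1
      rw [← hg]; exact pow_orderOf_eq_one g
    have := Subgroup.orderOf_dvd_natCard H hgH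
    rwa [hg] at this
  haveI : Nonempty {g : G // g ^ p = 1} := ⟨⟨1, one_pow p⟩⟩
  rw [pRank, Nat.factorization_eq_zero_iff] at h
  rcases h with h | h | h
  · exact h hp.out
  · exact h hsub
  · exact Nat.card_pos.ne' h

include hζ in
theorem unit_ext [IsGalois K L] (hdeg : Module.finrank K L = p) (hp2 : 2 < p)
    (σ : L ≃ₐ[K] L) (hσ : orderOf σ = p) (hreg : ¬ p ∣ Nat.card (ClassGroup (𝓞 K)))
    (u : (𝓞 K)ˣ) (η : L) (hη : η ^ p = algebraMap K L ((u : 𝓞 K) : K)) (hση : σ η = algebraMap K L ζ * η) :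
    ¬ p ∣ Nat.card (ClassGroup (𝓞 L)) ∧ nrmU σ p = ⊤ := by
  have hηint : IsIntegral ℤ η := by
    refine IsIntegral.of_pow hp.out.pos ?_
    rw [hη]
    exact (RingOfIntegers.isIntegral_coe (u : 𝓞 K)).algebraMap
  have hηval : ∀ P : HeightOneSpectrum (𝓞 L), P.valuation L η = 1 := by
    intro P
    have e : P.valuation L (algebraMap K L ((u : 𝓞 K) : K)) = 1 :=
      val_unit P (Units.map (algebraMap (𝓞 K) (𝓞 L)).toMonoidHom u)
    rw [← hη, map_pow] at e
    exact (pow_eq_one_iff_of_nonneg zero_le' hp.out.ne_zero).1 e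
  have hsub : ∀ P : HeightOneSpectrum (𝓞 L), ram K P = p → (p : 𝓞 L) ∈ P.asIdeal := by
    intro P hP
    by_contra h
    exact not_ram_of_unit hζ hdeg σ P η hηint (hηval P) hση h hP
  have hss : ({P : HeightOneSpectrum (𝓞 L) | ram K P = p}).Subsingleton := by
    intro P hP Q hQ
    have h1 := (p_mem_iff (K := K) P p).2 (hsub P hP)
    have h2 := (p_mem_iff (K := K) Q p).2 (hsub Q hQ)
    obtain ⟨v, hv⟩ := Set.ncard_eq_one.1 (card_primes_p (K := K) (p := p))
    have h3 : prBelow K P = v := by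
      have : prBelow K P ∈ ({v} : Set _) := hv ▸ h1
      exact this
    have h4 : prBelow K Q = v := by
      have : prBelow K Q ∈ ({v} : Set _) := hv ▸ h2
      exact this
    exact inj_ram hdeg σ hσ P Q hP (h3.trans h4.symm)
  have hfin := hss.finite
  have hmain := ambig_formula p hp.out hdeg σ hσ hfin ζ hζ (units_rank_eq p hp2 hdeg ζ hζ)
  rw [nrmU_index p hp.out hdeg σ hσ] at hmain
  have ht : Nat.card {P : HeightOneSpectrum (𝓞 L) | ram K P = p} ≤ 1 := by
    haveI := hss.coe_sort
    exact Finite.card_le_one_iff_subsingleton.2 inferInstance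
  have ht1 : Nat.card {P : HeightOneSpectrum (𝓞 L) | ram K P = p} = 1 := by
    by_contra h
    have h0 : Nat.card {P : HeightOneSpectrum (𝓞 L) | ram K P = p} = 0 := by omega
    rw [h0, pow_zero, one_mul] at hmain
    apply hreg
    rw [← hmain]
    exact (dvd_mul_right _ _).mul_left _
  rw [ht1, pow_one, mul_left_comm] at hmain
  have hmain := Nat.eq_of_mul_eq_mul_left hp.out.pos hmain
  have hb := (class_bounds p hp.out hdeg σ hσ hreg).2
  constructor
  · apply not_dvd_of_pRank
    rw [Nat.factorization_eq_zero_of_not_dvd, zero_mul] at hb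
    · omega
    · intro h
      apply hreg
      rw [← hmain]
      exact h.mul_right _
  · apply eq_top_of_pow (p := p) _ (pow_mem_nrmU σ p)
    intro h
    apply hreg
    rw [← hmain]
    exact h.mul_left _

include hζ in
theorem not_fixed (σ : L ≃ₐ[K] L) (u : (𝓞 K)ˣ) (η : L) (hη : η ^ p = algebraMap K L ((u : 𝓞 K) : K))
    (hση : σ η = algebraMap K L ζ * η) (P : HeightOneSpectrum (𝓞 L)) (hpP : (p : 𝓞 L) ∉ P.asIdeal)
    (y : 𝓞 K) (hy : (u : 𝓞 K) - y ^ p ∈ (prBelow K P).asIdeal) : sP σ P ≠ P := by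
  intro hs
  have hv : ∀ x : L, P.valuation L (σ x) = P.valuation L x := by
    intro x
    have := val_sP σ P x
    rwa [hs] at this
  have hηval : P.valuation L η = 1 := by
    have e : P.valuation L (algebraMap K L ((u : 𝓞 K) : K)) = 1 :=
      val_unit P (Units.map (algebraMap (𝓞 K) (𝓞 L)).toMonoidHom u)
    rw [← hη, map_pow] at e
    exact (pow_eq_one_iff_of_nonneg zero_le' hp.out.ne_zero).1 e
  have hζL : IsPrimitiveRoot (algebraMap K L ζ) p := hζ.map_of_injective (algebraMap K L).injective
  have h1 : P.valuation L (η ^ p - algebraMap K L (y : K) ^ p) < 1 := by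
    rw [mem_prBelow, ← val_lt_one_iff] at hy
    have e : ((algebraMap (𝓞 K) (𝓞 L) (u - y ^ p) : 𝓞 L) : L) = algebraMap K L ((u : 𝓞 K) : K) - algebraMap K L (y : K) ^ p := by
      have : ((algebraMap (𝓞 K) (𝓞 L) (u - y ^ p) : 𝓞 L) : L) = algebraMap K L (((u : 𝓞 K) - y ^ p : 𝓞 K) : K) := rfl
      rw [this]; simp
    rw [hη, ← e]; exact hy
  rw [hζL.pow_sub_pow_eq_prod_sub_mul _ _ hp.out.pos, map_prod] at h1
  have hyv : P.valuation L (algebraMap K L (y : K)) ≤ 1 := P.valuation_le_one (algebraMap (𝓞 K) (𝓞 L) y)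
  have h2 : ∃ ξ ∈ nthRootsFinset p (1 : L), P.valuation L (η - ξ * algebraMap K L (y : K)) < 1 := by
    by_contra hcon
    push Not at hcon
    exact absurd h1 (not_lt.2 (Finset.one_le_prod' hcon))
  obtain ⟨ξ, hξ, h3⟩ := h2
  have hξ1 : ξ ^ p = 1 := by
    rwa [mem_nthRootsFinset hp.out.pos] at hξ
  obtain ⟨i, -, rfl⟩ := hζL.eq_pow_of_pow_eq_one hξ1
  have h4 := hv (η - algebraMap K L ζ ^ i * algebraMap K L (y : K))
  rw [map_sub, map_mul, map_pow, AlgEquiv.commutes, AlgEquiv.commutes, hση] at h4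
  have h5 : P.valuation L ((algebraMap K L ζ - 1) * η) < 1 := by
    have : (algebraMap K L ζ - 1) * η = (algebraMap K L ζ * η - algebraMap K L ζ ^ i * algebraMap K L (y : K))
      - (η - algebraMap K L ζ ^ i * algebraMap K L (y : K)) := by ring
    rw [this]
    exact (Valuation.map_sub _ _ _).trans_lt (max_lt (h4 ▸ h3) h3)
  rw [map_mul, hηval, mul_one] at h5
  apply hpP
  rw [← val_nat_lt, val_p hζ]
  exact pow_lt_one₀ zero_le' h5 (Nat.sub_ne_zero_of_lt hp.out.one_lt)

theorem not_both (P : HeightOneSpectrum (𝓞 L)) {N : ℕ} (hN : N.Prime) (hNp : N ≠ p) (h : (N : 𝓞 L) ∈ P.asIdeal) :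
    (p : 𝓞 L) ∉ P.asIdeal := by
  intro h'
  have hc : IsCoprime (N : ℤ) (p : ℤ) := Nat.isCoprime_iff_coprime.2 ((Nat.coprime_primes hN hp.out).2 hNp)
  obtain ⟨x, y, hxy⟩ := hc
  apply P.isPrime.ne_top
  rw [Ideal.eq_top_iff_one]
  have := congrArg (Int.cast : ℤ → 𝓞 L) hxy
  push_cast at this
  rw [← this]
  exact P.asIdeal.add_mem (P.asIdeal.mul_mem_left _ h) (P.asIdeal.mul_mem_left _ h')

include hζ in
theorem N_is_norm [IsGalois K L] (hdeg : Module.finrank K L = p) (hp2 : 2 < p)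
    (σ : L ≃ₐ[K] L) (hσ : orderOf σ = p) (hreg : ¬ p ∣ Nat.card (ClassGroup (𝓞 K)))
    (u : (𝓞 K)ˣ) (η : L) (hη : η ^ p = algebraMap K L ((u : 𝓞 K) : K)) (hση : σ η = algebraMap K L ζ * η)
    {N : ℕ} [hN : Fact N.Prime] (hNp : N ≠ p)
    (hres : ∀ v : HeightOneSpectrum (𝓞 K), (N : 𝓞 K) ∈ v.asIdeal → ∃ y : 𝓞 K, (u : 𝓞 K) - y ^ p ∈ v.asIdeal) :
    ∃ β : Lˣ, ((NL σ p β : Lˣ) : L) = N := by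
  classical
  obtain ⟨hcl, htop⟩ := unit_ext hζ hdeg hp2 σ hσ hreg u η hη hση
  have hN0 : (N : K) ≠ 0 := by exact_mod_cast hN.out.ne_zero
  have hσp : σ ^ p = 1 := by rw [← hσ]; exact pow_orderOf_eq_one σ
  have hsp : (sP σ) ^ p = 1 := by rw [← sP_pow, hσp, sP_one]
  have hfix : ∀ P : HeightOneSpectrum (𝓞 L), (N : 𝓞 L) ∈ P.asIdeal → sP σ P ≠ P := by
    intro P hP
    obtain ⟨y, hy⟩ := hres (prBelow K P) ((p_mem_iff P N).2 hP)
    exact not_fixed hζ σ u η hη hση P (not_both P hN.out hNp hP) y hy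
  have hram1 : ∀ P : HeightOneSpectrum (𝓞 L), (N : 𝓞 L) ∈ P.asIdeal → ram K P = 1 := by
    intro P hP
    rcases ram_cases p hp.out hdeg σ P with h | h
    · exact h
    · exact absurd h.2 (hfix P hP)
  choose sec hsec using prBelow_surj (K := K) (L := L)
  let T : Finset (HeightOneSpectrum (𝓞 K)) := (finite_mem (K := K) N hN.out.ne_zero).toFinset
  let S : Finset (HeightOneSpectrum (𝓞 L)) := T.image sec
  have hS : ∀ P, P ∈ S ↔ (N : 𝓞 L) ∈ P.asIdeal ∧ sec (prBelow K P) = P := by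
    intro P
    simp only [S, T, Finset.mem_image, Set.Finite.mem_toFinset, Set.mem_setOf_eq]
    constructor
    · rintro ⟨v, hv, rfl⟩
      rw [hsec]
      refine ⟨?_, rfl⟩
      rw [← p_mem_iff (K := K), hsec]; exact hv
    · rintro ⟨h1, h2⟩
      exact ⟨prBelow K P, (p_mem_iff P N).2 h1, h2⟩
  let D : Dvs L := Multiplicative.ofAdd (Finsupp.indicator S (fun _ _ => (1 : ℤ)))
  have hD : ∀ P, Multiplicative.toAdd D P = if P ∈ S then 1 else 0 := by
    intro P
    show Finsupp.indicator S (fun _ _ => (1 : ℤ)) P = _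
    rw [Finsupp.indicator_apply]; split_ifs <;> rfl
  set h := Nat.card (ClassGroup (𝓞 L)) with hh
  have hDh : D ^ h ∈ (dvr L).range := by
    rw [hh, ← card_cl_eq]
    exact Subgroup.pow_index_mem _ D
  obtain ⟨β, hβ⟩ := hDh
  have hbelow_pow : ∀ (k : ℕ) P, prBelow K ((sP σ ^ k) P) = prBelow K P := by
    intro k P
    rw [← sP_pow, prBelow_sP]
  have hsum : ∀ P, ∑ k ∈ Finset.range p, (Multiplicative.toAdd D) (((sP σ) ^ k) P) = if (N : 𝓞 L) ∈ P.asIdeal then 1 else 0 := by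
    intro P
    have hmemk : ∀ k : ℕ, (N : 𝓞 L) ∈ ((sP σ ^ k) P).asIdeal ↔ (N : 𝓞 L) ∈ P.asIdeal := by
      intro k
      rw [← p_mem_iff (K := K), hbelow_pow, p_mem_iff]
    by_cases hP : (N : 𝓞 L) ∈ P.asIdeal
    · rw [if_pos hP]
      obtain ⟨τ, hτ⟩ := exists_sP_of_below P (sec (prBelow K P)) (hsec _).symm
      obtain ⟨k, rfl⟩ := sigma_gen p hp.out hdeg σ hσ τ
      rw [sP_pow] at hτ
      have hkm : (sP σ ^ k) P = (sP σ ^ (k % p)) P := by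
        rw [← pow_eq_pow_mod k hsp]
      rw [hkm] at hτ
      rw [Finset.sum_eq_single (k % p)]
      · rw [hD, if_pos]
        rw [hS, hbelow_pow, hmemk]
        exact ⟨hP, hτ⟩
      · intro j hj hjk
        rw [hD, if_neg]
        rw [hS, hbelow_pow, hmemk]
        rintro ⟨-, h2⟩
        rw [hτ] at h2
        have hper : (sP σ ^ (k % p)) P = (sP σ ^ j) P := h2
        have hmin : Function.minimalPeriod (sP σ) P = p := by
          have hdvd : Function.minimalPeriod (sP σ) P ∣ p := by
            apply Function.IsPeriodicPt.minimalPeriod_dvd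
            show (sP σ)^[p] P = P
            rw [← Equiv.Perm.coe_pow, hsp]; rfl
          rcases (Nat.dvd_prime hp.out).1 hdvd with h | h
          · exact absurd (Function.minimalPeriod_eq_one_iff_isFixedPt.1 h) (hfix P hP)
          · exact h
        rw [Equiv.Perm.coe_pow, Equiv.Perm.coe_pow] at hper
        apply hjk
        exact (Function.iterate_injOn_Iio_minimalPeriod (f := sP σ) (x := P)
          (by rw [hmin]; exact Nat.mod_lt _ hp.out.pos) (by rw [hmin]; exact Finset.mem_range.1 hj) hper).symm
      · intro hk
        exact absurd (Finset.mem_range.2 (Nat.mod_lt _ hp.out.pos)) hk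
    · rw [if_neg hP]
      apply Finset.sum_eq_zero
      intro k _
      rw [hD, if_neg]
      rw [hS, hmemk]
      exact fun h => hP h.1
  let NN : Lˣ := Units.map (algebraMap K L : K →* L) (Units.mk0 (N : K) hN0)
  have hNN : ∀ P, (Multiplicative.toAdd (dvr L NN)) P = if (N : 𝓞 L) ∈ P.asIdeal then 1 else 0 := by
    intro P
    have h1 := dvr_val L NN P
    have h2 : (NN : L) = algebraMap K L (N : K) := rfl
    split_ifs with hP
    · rw [h2, val_below, hram1 P hP, pow_one, val_N hζ hNp _ ((p_mem_iff P N).2 hP), WithZero.exp_inj] at h1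
      omega
    · have h3 : P.valuation L (NN : L) = 1 := by
        rw [h2, map_natCast]
        exact_mod_cast val_one_of_not_mem P (N : 𝓞 L) hP
      rw [h3, ← WithZero.exp_zero, WithZero.exp_inj] at h1
      omega
  have hdv : dvr L (NL σ p β) = dvr L (NN ^ h) := by
    apply Multiplicative.toAdd.injective
    ext P
    rw [NL_dvr σ p hσp, map_pow, hβ, toAdd_pow, toAdd_pow, Finsupp.smul_apply, hNN, ← hsum P, Finset.smul_sum]
    rfl
  have hDLN : ∀ x : Lˣ, NL σ p x ∈ (DL σ).ker := by
    intro x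
    rw [MonoidHom.mem_ker]
    ext
    rw [DL_apply, Units.val_one, div_eq_one_iff_eq (Units.ne_zero _), NL_apply, map_prod]
    have : ∀ k, σ ((σ ^ k) (x : L)) = (σ ^ (k+1)) (x : L) := fun k => by rw [pow_succ']; rfl
    simp only [this]
    have h1 := Finset.prod_range_succ (fun k => (σ ^ k) (x : L)) p
    have h2 := Finset.prod_range_succ' (fun k => (σ ^ k) (x : L)) p
    rw [h1, hσp, pow_zero] at h2
    exact (mul_right_cancel₀ x.ne_zero h2).symm
  have hNNp : NL σ p NN = NN ^ p := by
    ext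
    rw [NL_apply]
    have : ∀ k : ℕ, (σ ^ k) (NN : L) = NN := fun k => AlgEquiv.commutes _ _
    simp [this]
  have hNNK : NN ∈ (DL σ).ker := by
    rw [MonoidHom.mem_ker]
    ext
    rw [DL_apply, Units.val_one, div_eq_one_iff_eq (Units.ne_zero _)]
    exact AlgEquiv.commutes _ _
  have hw : NL σ p β / NN ^ h ∈ (eK K L).range := by
    rw [eK_range p hp.out hdeg σ hσ]
    refine Subgroup.mem_inf.2 ⟨?_, ?_⟩
    · rw [MonoidHom.mem_ker, _root_.map_div, hdv, div_self']
    · exact Subgroup.div_mem _ (hDLN β) (Subgroup.pow_mem _ hNNK h)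
  obtain ⟨w, hw⟩ := hw
  have hw2 : w ∈ nrmU σ p := by rw [htop]; trivial
  obtain ⟨γ, hγ⟩ := hw2
  have hNh : NN ^ h ∈ (NL σ p).range := by
    refine ⟨β / γ, ?_⟩
    rw [_root_.map_div, hγ, hw]
    simp
  have hNp' : NN ^ p ∈ (NL σ p).range := ⟨NN, hNNp⟩
  have hcop : Nat.Coprime p h := (Nat.Prime.coprime_iff_not_dvd hp.out).2 hcl
  have hfinal : NN ∈ (NL σ p).range := by
    rw [← QuotientGroup.eq_one_iff] at hNh hNp' ⊢
    rw [QuotientGroup.mk_pow] at hNh hNp'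
    have := pow_gcd_eq_one.2 ⟨hNp', hNh⟩
    rwa [hcop, pow_one] at this
  obtain ⟨b, hb⟩ := hfinal
  refine ⟨b, ?_⟩
  rw [hb]
  exact map_natCast (algebraMap K L) N

end UnitExt

section Symm
variable {K L F : Type*} [Field K] [Field L] [Field F] [Algebra K L] [Algebra K F]

/-- reciprocity of norms from Kummer extensions (cyclic algebras) -/
theorem norm_symm (p : ℕ) (hp : 0 < p) [FiniteDimensional K L] [FiniteDimensional K F]
    (hdL : Module.finrank K L = p) (hdF : Module.finrank K F = p)
    (ζ ζ' : K) (hζζ : ζ * ζ' = 1) (σ : F ≃ₐ[K] F) (τ : L ≃ₐ[K] L) (α : L) (η β : F) (u n : K)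
    (hgen : IntermediateField.adjoin K {α} = ⊤)
    (hα : α ^ p = algebraMap K L n) (hη : η ^ p = algebraMap K F u) (hση : σ η = algebraMap K F ζ' * η)
    (hτ : τ α = algebraMap K L ζ * α) (hσp : σ ^ p = 1) (hβ : ∏ k ∈ Finset.range p, (σ ^ k) β = algebraMap K F n) :
    ∃ γ : L, ∏ k ∈ Finset.range p, (τ ^ k) γ = algebraMap K L u := by
  have hintg : IsIntegral K α := IsIntegral.of_finite K α
  let pb : PowerBasis K L := (IntermediateField.adjoin.powerBasis hintg).map
    ((IntermediateField.equivOfEq hgen).trans IntermediateField.topEquiv)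
  have hpbgen : pb.gen = α := rfl
  have hmin : minpoly K α = X ^ p - C n := by
    symm
    apply Polynomial.eq_of_monic_of_dvd_of_natDegree_le (minpoly.monic hintg) (monic_X_pow_sub_C n hp.ne')
    · apply minpoly.dvd
      simp [hα]
    · rw [natDegree_X_pow_sub_C, ← hdL, ← IntermediateField.adjoin.finrank hintg, hgen, IntermediateField.finrank_top']
  let Y : Module.End K F := (Algebra.lmul K F β) * (σ.toLinearMap : Module.End K F)
  let X' : Module.End K F := Algebra.lmul K F η
  have hYap : ∀ x, Y x = β * σ x := fun x => rfl
  have hXap : ∀ x, X' x = η * x := fun x => rfl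
  have hYk : ∀ (k : ℕ) x, (Y ^ k) x = (∏ i ∈ Finset.range k, (σ ^ i) β) * (σ ^ k) x := by
    intro k
    induction k with
    | zero => intro x; simp
    | succ k ih =>
      intro x
      rw [pow_succ, Module.End.mul_apply, ih, hYap, map_mul, Finset.prod_range_succ, mul_assoc, pow_succ]
      rfl
  have hYp : Y ^ p = algebraMap K (Module.End K F) n := by
    ext x
    rw [hYk, hβ, hσp, Module.algebraMap_end_apply, Algebra.smul_def]; rfl
  let φ : L →ₐ[K] Module.End K F := pb.lift Y (by
    rw [hpbgen, hmin]; simp [hYp])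
  have hφα : φ α = Y := by
    exact pb.lift_gen Y (by rw [hpbgen, hmin]; simp [hYp])
  let e : L →ₗ[K] F :=
    { toFun := fun γ => φ γ 1
      map_add' := fun a b => by simp
      map_smul' := fun c a => by simp }
  have he : ∀ γ, e γ = φ γ 1 := fun _ => rfl
  have hinj : Function.Injective e := by
    rw [injective_iff_map_eq_zero]
    intro γ h
    by_contra h0
    have : φ (γ⁻¹ * γ) 1 = 0 := by
      rw [map_mul, Module.End.mul_apply, ← he, h, map_zero]
    rw [inv_mul_cancel₀ h0, map_one φ] at this
    exact one_ne_zero this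
  have hsurj : Function.Surjective e := (LinearMap.injective_iff_surjective_of_finrank_eq_finrank (hdL.trans hdF.symm)).1 hinj
  obtain ⟨γ, hγ⟩ := hsurj η
  refine ⟨γ, hinj ?_⟩
  -- commutation
  have hcommα : X' * φ α = φ (τ α) * X' := by
    ext x
    rw [hτ, ← Algebra.smul_def, map_smul, hφα]
    show X' (Y x) = ζ • Y (X' x)
    rw [hYap, hXap, hXap, hYap, map_mul, hση, Algebra.smul_def]
    have : algebraMap K F ζ * algebraMap K F ζ' = 1 := by rw [← map_mul, hζζ, map_one]
    linear_combination (-η * β * σ x) * this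
  have hcomm : ∀ x : L, X' * φ x = φ (τ x) * X' := by
    intro x
    obtain ⟨f, rfl⟩ := pb.exists_eq_aeval' x
    rw [hpbgen]
    induction f using Polynomial.induction_on with
    | C a => simp only [aeval_C, AlgEquiv.commutes, AlgHom.commutes, Algebra.commutes]
    | add f g hf hg => simp only [map_add, mul_add, add_mul, hf, hg]
    | monomial k a h =>
      have e1 : aeval α (C a * X ^ (k + 1)) = aeval α (C a * X ^ k) * α := by
        rw [pow_succ, ← mul_assoc, map_mul, aeval_X]
      rw [e1, map_mul φ, ← mul_assoc, h, mul_assoc, hcommα, map_mul τ, map_mul φ, mul_assoc]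
  have hXk : ∀ k : ℕ, η ^ k = φ (∏ i ∈ Finset.range k, (τ ^ i) γ) 1 := by
    intro k
    induction k with
    | zero => simp only [pow_zero, Finset.range_zero, Finset.prod_empty, map_one φ]; rfl
    | succ k ih =>
      have h1 : η ^ (k + 1) = (X' * φ (∏ i ∈ Finset.range k, (τ ^ i) γ)) 1 := by
        rw [Module.End.mul_apply, ← ih, hXap, pow_succ']
      have h2 : X' 1 = φ γ 1 := by rw [← he, hγ, hXap, mul_one]
      rw [h1, hcomm, Module.End.mul_apply, h2, ← Module.End.mul_apply, ← map_mul, Finset.prod_range_succ', map_prod]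
      simp only [pow_succ', pow_zero]
      rfl
  rw [he, he, ← hXk, hη, AlgHom.commutes, Module.algebraMap_end_apply, Algebra.smul_def, mul_one]
end Symm

end PartB5

section PartB6

open IsDedekindDomain nonZeroDivisors

section Conv
variable {K L : Type*} [Field K] [NumberField K] [Field L] [NumberField L] [Algebra K L]
 {p : ℕ} [hp : Fact p.Prime] [IsCyclotomicExtension {p} ℚ K]
  {ζ : K} (hζ : IsPrimitiveRoot ζ p)

include hζ in
/-- a unit that is a `p`-th power modulo all primes over `N` is a norm -/
theorem norm_of_residue [IsGalois K L] (hdeg : Module.finrank K L = p) (hp2 : 2 < p)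
    (τ : L ≃ₐ[K] L) (hreg : ¬ p ∣ Nat.card (ClassGroup (𝓞 K)))
    {N : ℕ} [hN : Fact N.Prime] (hNp : N ≠ p) (α : L) (hα : α ^ p = (N : L))
    (hgen : IntermediateField.adjoin K {α} = ⊤) (hτ : τ α = algebraMap K L ζ * α)
    (u : (𝓞 K)ˣ)
    (hres : ∀ v : HeightOneSpectrum (𝓞 K), (N : 𝓞 K) ∈ v.asIdeal → ∃ y : 𝓞 K, (u : 𝓞 K) - y ^ p ∈ v.asIdeal) :
    u ∈ nrmU τ p := by
  by_cases hu : ∃ c : K, c ^ p = ((u : 𝓞 K) : K)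
  · obtain ⟨c, hc⟩ := hu
    have hci : IsIntegral ℤ c := IsIntegral.of_pow hp.out.pos (hc ▸ RingOfIntegers.isIntegral_coe (u : 𝓞 K))
    have hc' : (⟨c, hci⟩ : 𝓞 K) ^ p = (u : 𝓞 K) := by
      ext; exact hc
    have hcu : IsUnit (⟨c, hci⟩ : 𝓞 K) := by
      rw [← isUnit_pow_iff hp.out.ne_zero, hc']; exact u.isUnit
    have : u = hcu.unit ^ p := by
      ext; rw [Units.val_pow_eq_pow_val, IsUnit.unit_spec, hc']
    rw [this]
    exact pow_mem_nrmU τ p _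
  push Not at hu
  have hirr : Irreducible (X ^ p - C ((u : 𝓞 K) : K)) := X_pow_sub_C_irreducible_of_prime hp.out hu
  haveI : Fact (Irreducible (X ^ p - C ((u : 𝓞 K) : K))) := ⟨hirr⟩
  let F := AdjoinRoot (X ^ p - C ((u : 𝓞 K) : K))
  haveI : FiniteDimensional K F := (AdjoinRoot.powerBasis hirr.ne_zero).finite
  haveI : CharZero F := charZero_of_injective_algebraMap (algebraMap K F).injective
  haveI : FiniteDimensional ℚ F := FiniteDimensional.trans ℚ K F
  haveI : NumberField F := {}
  let η : F := AdjoinRoot.root _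
  have hη : η ^ p = algebraMap K F ((u : 𝓞 K) : K) := by
    have := AdjoinRoot.eval₂_root (X ^ p - C ((u : 𝓞 K) : K))
    rw [eval₂_sub, eval₂_X_pow, eval₂_C, sub_eq_zero] at this
    exact this
  have hgenF : IntermediateField.adjoin K {η} = ⊤ := by
    rw [eq_top_iff]
    intro x _
    have h1 : x ∈ Algebra.adjoin K {η} := by
      have := AdjoinRoot.adjoinRoot_eq_top (f := X ^ p - C ((u : 𝓞 K) : K))
      show x ∈ Algebra.adjoin K {AdjoinRoot.root _}
      rw [this]; trivial
    exact IntermediateField.algebra_adjoin_le_adjoin K _ h1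
  obtain ⟨hgal, hdF, σ, hσ, hση⟩ := kummer_data p hp.out ζ⁻¹ hζ.inv _ hu η hη hgenF
  obtain ⟨β, hβ⟩ := N_is_norm hζ.inv hdF hp2 σ hσ hreg u η hη hση hNp hres
  have hσp : σ ^ p = 1 := orderOf_dvd_iff_pow_eq_one.1 hσ.dvd
  obtain ⟨γ, hγ⟩ := norm_symm p hp.out.pos hdeg hdF ζ ζ⁻¹ (mul_inv_cancel₀ (hζ.ne_zero hp.out.ne_zero)) σ τ α η β
    ((u : 𝓞 K) : K) (N : K) hgen (by rw [hα, map_natCast]) hη hση hτ hσp (by rw [← NL_apply, hβ, map_natCast])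
  have hγ0 : γ ≠ 0 := by
    rintro rfl
    simp only [map_zero, Finset.prod_const, Finset.card_range, zero_pow hp.out.ne_zero] at hγ
    exact u.ne_zero (by
      have := (map_eq_zero (algebraMap K L)).1 hγ.symm
      exact_mod_cast this)
  refine ⟨Units.mk0 γ hγ0, ?_⟩
  ext
  rw [NL_apply, eK_val]
  exact hγ

end Conv

end PartB6

section PartC1

open IsDedekindDomain nonZeroDivisors
open scoped ENNReal

section EulerIdeals
variable {R : Type*} [CommRing R] [IsDedekindDomain R]

/-- nonzero ideals supported on `T` -/
def suppIn (T : Finset (HeightOneSpectrum R)) : Set (Ideal R) :=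
  {I | I ≠ ⊥ ∧ ∀ v : HeightOneSpectrum R, v.asIdeal ∣ I → v ∈ T}

theorem suppIn_empty : suppIn (∅ : Finset (HeightOneSpectrum R)) = {1} := by
  ext I
  simp only [suppIn, Set.mem_setOf_eq, Set.mem_singleton_iff, Finset.notMem_empty, imp_false]
  constructor
  · rintro ⟨h0, h⟩
    by_contra h1
    obtain ⟨M, hM, hle⟩ := Ideal.exists_le_maximal I (by rwa [Ideal.one_eq_top] at h1)
    have hM0 : M ≠ ⊥ := fun h' => h0 (le_bot_iff.1 (h' ▸ hle))
    exact h ⟨M, hM.isPrime, hM0⟩ (Ideal.dvd_iff_le.2 hle)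
  · rintro rfl
    refine ⟨one_ne_zero, fun v hv => v.isPrime.ne_top ?_⟩
    rwa [← Ideal.one_eq_top, ← isUnit_iff_eq_one, isUnit_iff_dvd_one]

theorem suppIn_bij [DecidableEq (HeightOneSpectrum R)] (T : Finset (HeightOneSpectrum R)) (v : HeightOneSpectrum R) (hv : v ∉ T) :
    Function.Bijective (fun x : ℕ × suppIn T => (⟨v.asIdeal ^ x.1 * x.2, by
      obtain ⟨n, I, hI⟩ := x
      refine ⟨mul_ne_zero (pow_ne_zero _ v.ne_bot) hI.1, fun w hw => ?_⟩
      rcases w.prime.dvd_or_dvd hw with h | h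
      · have := w.prime.dvd_of_dvd_pow h
        rw [Ideal.dvd_iff_le] at this
        have : v = w := HeightOneSpectrum.ext (v.isMaximal.eq_of_le w.isPrime.ne_top this)
        simp [this]
      · exact Finset.mem_insert_of_mem (hI.2 w h)⟩ : suppIn (insert v T))) := by
  constructor
  · rintro ⟨n, I, hI⟩ ⟨k, J, hJ⟩ h
    have h : v.asIdeal ^ n * I = v.asIdeal ^ k * J := congrArg Subtype.val h
    have hI' : ¬ v.asIdeal ∣ I := fun h => hv (hI.2 v h)
    have hJ' : ¬ v.asIdeal ∣ J := fun h => hv (hJ.2 v h)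
    have hnk : n = k := by
      rcases lt_trichotomy n k with hlt | heq | hlt
      · obtain ⟨d, rfl⟩ := Nat.exists_eq_add_of_lt hlt
        rw [add_assoc, pow_add, mul_assoc] at h
        have := mul_left_cancel₀ (pow_ne_zero _ v.ne_bot) h
        exact absurd (this ▸ (Dvd.intro _ (by rw [pow_succ', mul_assoc]))) hI'
      · exact heq
      · obtain ⟨d, rfl⟩ := Nat.exists_eq_add_of_lt hlt
        rw [add_assoc, pow_add, mul_assoc] at h
        have := mul_left_cancel₀ (pow_ne_zero _ v.ne_bot) h
        exact absurd (this ▸ (Dvd.intro _ (by rw [pow_succ', mul_assoc]))) hJ'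
    subst hnk
    have := mul_left_cancel₀ (pow_ne_zero _ v.ne_bot) h
    subst this
    rfl
  · rintro ⟨I, hI⟩
    obtain ⟨n, J, hJ, rfl⟩ := WfDvdMonoid.max_power_factor hI.1 v.irreducible
    refine ⟨⟨n, J, right_ne_zero_of_mul hI.1, fun w hw => ?_⟩, rfl⟩
    have := hI.2 w (hw.mul_left _)
    rcases Finset.mem_insert.1 this with rfl | h
    · exact absurd hw hJ
    · exact h

theorem euler_fin (w : Ideal R →* ℝ≥0∞) (T : Finset (HeightOneSpectrum R)) :
    ∑' I : suppIn T, w I = ∏ v ∈ T, (1 - w v.asIdeal)⁻¹ := by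
  classical
  induction T using Finset.induction_on with
  | empty => rw [suppIn_empty]; simp [← Ideal.one_eq_top, -Ideal.one_eq_top]
  | insert v T hv ih =>
    rw [Finset.prod_insert hv, ← ih, ← (Equiv.ofBijective _ (suppIn_bij T v hv)).tsum_eq, ENNReal.tsum_prod']
    simp only [Equiv.ofBijective_apply, map_mul, map_pow, ENNReal.tsum_mul_left, ENNReal.tsum_mul_right, ENNReal.tsum_geometric]

theorem euler_tendsto {ι : Type*} (w : Ideal R →* ℝ≥0∞) (l : Filter ι) (T : ι → Finset (HeightOneSpectrum R))
    (hT : ∀ v, ∀ᶠ i in l, v ∈ T i) :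
    Filter.Tendsto (fun i => ∏ v ∈ T i, (1 - w v.asIdeal)⁻¹) l (nhds (∑' I : {I : Ideal R // I ≠ ⊥}, w I)) := by
  classical
  simp only [← euler_fin]
  have key : ∀ i, ∑' I : suppIn (T i), w I = ∑' I : {I : Ideal R // I ≠ ⊥}, Set.indicator (suppIn (T i)) w I := by
    intro i
    rw [tsum_subtype (suppIn (T i)) w]
    have := tsum_subtype {I : Ideal R | I ≠ ⊥} (Set.indicator (suppIn (T i)) w)
    refine Eq.trans ?_ this.symm
    rw [Set.indicator_indicator]
    rw [Set.inter_eq_right.2 (fun I h => h.1)]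
  simp only [key]
  rw [tendsto_order]
  constructor
  · intro a ha
    rw [ENNReal.tsum_eq_iSup_sum, lt_iSup_iff] at ha
    obtain ⟨F, hF⟩ := ha
    have h1 : ∀ᶠ i in l, ∀ I ∈ F, (I : Ideal R) ∈ suppIn (T i) := by
      rw [Filter.eventually_all_finset]
      intro I _
      have hfin := Ideal.finite_factors (I := (I : Ideal R)) I.2
      have h2 : ∀ᶠ i in l, ∀ v ∈ {v : HeightOneSpectrum R | v.asIdeal ∣ I}, v ∈ T i := by
        rw [Filter.eventually_all_finite hfin]
        exact fun v _ => hT v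
      filter_upwards [h2] with i hi
      exact ⟨I.2, hi⟩
    filter_upwards [h1] with i hi
    refine hF.trans_le ((Finset.sum_le_sum fun I hI => ?_).trans (ENNReal.sum_le_tsum F))
    rw [Set.indicator_of_mem (hi I hI)]
  · intro a ha
    refine Filter.Eventually.of_forall fun i => lt_of_le_of_lt (ENNReal.tsum_le_tsum fun I => ?_) ha
    exact Set.indicator_le_self _ _ _
end EulerIdeals

end PartC1

section PartC2

open IsDedekindDomain nonZeroDivisors
open scoped ENNReal

section LocalFactor

theorem cyc_prod {ξ : ℂ} {n : ℕ} (hn : 0 < n) (hξ : IsPrimitiveRoot ξ n) (g : ℕ) (X : ℂ) :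
    ∏ k ∈ Finset.range (n * g), (1 - ξ ^ k * X) = (1 - X ^ n) ^ g := by
  induction g with
  | zero => simp
  | succ g ih =>
    rw [mul_add, mul_one, Finset.prod_range_add, ih, pow_succ]
    congr 1
    rw [show (1 : ℂ) - X ^ n = 1 ^ n - X ^ n by simp, hξ.pow_sub_pow_eq_prod_sub_mul _ _ hn]
    refine Finset.prod_bij (fun k _ => ξ ^ k) ?_ ?_ ?_ ?_
    · intro k _
      rw [mem_nthRootsFinset hn, ← pow_mul, mul_comm, pow_mul, hξ.pow_eq_one, one_pow]
    · intro a ha b hb h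
      exact hξ.pow_inj (Finset.mem_range.1 ha) (Finset.mem_range.1 hb) h
    · intro b hb
      rw [mem_nthRootsFinset hn] at hb
      haveI : NeZero n := ⟨hn.ne'⟩
      obtain ⟨i, hi, h⟩ := hξ.eq_pow_of_pow_eq_one hb
      exact ⟨i, Finset.mem_range.2 hi, h⟩
    · intro k _
      rw [pow_add, pow_mul, hξ.pow_eq_one, one_pow, one_mul]

variable {p : ℕ} [hp : Fact p.Prime] (χ : DirichletCharacter ℂ p) (hχ : orderOf χ = p - 1)
include hχ in
theorem chi_inj : Function.Injective χ.toUnitHom := by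
  rw [injective_iff_map_eq_one]
  intro x hx
  obtain ⟨γ, hγ⟩ := IsCyclic.exists_generator (α := (ZMod p)ˣ)
  obtain ⟨j, hj⟩ := (mem_powers_iff_mem_zpowers (x := γ)).2 (hγ x)
  have hj : γ ^ j = x := hj
  subst hj
  have h1 : χ ^ j = 1 := by
    ext y
    obtain ⟨i, hi⟩ := (mem_powers_iff_mem_zpowers (x := γ)).2 (hγ y)
    have hi : γ ^ i = y := hi
    rw [MulChar.pow_apply_coe, MulChar.one_apply_coe, ← hi, ← MulChar.coe_toUnitHom, map_pow,
      ← Units.val_pow_eq_pow_val, ← pow_mul, mul_comm, pow_mul, ← map_pow, hx, one_pow, Units.val_one]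
  have h2 := orderOf_dvd_of_pow_eq_one h1
  rw [hχ] at h2
  obtain ⟨c, rfl⟩ := h2
  rw [pow_mul, ZMod.units_pow_card_sub_one_eq_one, one_pow]

include hχ in
theorem chi_prim (x : (ZMod p)ˣ) : IsPrimitiveRoot (χ x) (orderOf (x : ZMod p)) := by
  rw [orderOf_units, ← orderOf_injective _ (chi_inj χ hχ) x, ← MulChar.coe_toUnitHom, ← orderOf_units]
  exact IsPrimitiveRoot.orderOf _

theorem orderOf_chi_exists : ∃ χ : DirichletCharacter ℂ p, orderOf χ = p - 1 := by
  refine MulChar.exists_mulChar_orderOf (ZMod p) (n := p - 1) (R := ℂ) (by rw [ZMod.card]) (ζ := Complex.exp (2 * Real.pi * Complex.I / (p - 1 : ℕ))) (Complex.isPrimitiveRoot_exp _ ?_)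
  have := hp.out.two_le
  omega

variable (K : Type*) [Field K] [NumberField K] [IsCyclotomicExtension {p} ℚ K]

theorem mem_iff_liesOver (q : ℕ) [hq : Fact q.Prime] (v : HeightOneSpectrum (𝓞 K)) :
    (q : 𝓞 K) ∈ v.asIdeal ↔ v.asIdeal.LiesOver (Ideal.span {(q : ℤ)}) := by
  refine ⟨liesOver_of_mem q v, fun h => ?_⟩
  have : (q : ℤ) ∈ Ideal.span {(q : ℤ)} := Ideal.mem_span_singleton_self _
  rw [h.over, Ideal.mem_comap] at this
  simpa using this

theorem card_mem_q (q : ℕ) [hq : Fact q.Prime] (hqp : q ≠ p) :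
    {v : HeightOneSpectrum (𝓞 K) | (q : 𝓞 K) ∈ v.asIdeal}.ncard * orderOf (q : ZMod p) = p - 1 := by
  have hnd : ¬ q ∣ p := fun h => hqp ((Nat.prime_dvd_prime_iff_eq hq.out hp.out).1 h)
  haveI : NeZero p := ⟨hp.out.ne_zero⟩
  haveI : IsGalois ℚ K := IsCyclotomicExtension.isGalois {p} ℚ K
  have hqp' : Prime (q : ℤ) := Nat.prime_iff_prime_int.1 hq.out
  haveI : (Ideal.span {(q : ℤ)}).IsPrime := (Ideal.span_singleton_prime hqp'.ne_zero).2 hqp'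
  have h := Ideal.ncard_primesOver_mul_ramificationIdxIn_mul_inertiaDegIn (Ideal.span {(q : ℤ)}) (𝓞 K) (Gal(K/ℚ))
  rw [IsCyclotomicExtension.Rat.ramificationIdxIn_eq_of_not_dvd q K hnd,
    IsCyclotomicExtension.Rat.inertiaDegIn_eq_of_not_dvd q K hnd, one_mul, IsGalois.card_aut_eq_finrank,
    IsCyclotomicExtension.Rat.finrank p K, Nat.totient_prime hp.out] at h
  rw [← h]
  congr 1
  refine Set.ncard_congr (fun v _ => v.asIdeal) ?_ ?_ ?_
  · intro v hv
    exact ⟨v.isPrime, liesOver_of_mem q v hv⟩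
  · intro v w _ _ h
    exact HeightOneSpectrum.ext h
  · intro P hP
    have hP0 : P ≠ ⊥ := by
      rintro rfl
      have h1 := hP.2.over
      have : (q : ℤ) ∈ Ideal.span {(q : ℤ)} := Ideal.mem_span_singleton_self _
      rw [h1, Ideal.mem_comap, Ideal.mem_bot] at this
      simp at this
      exact hq.out.ne_zero this
    exact ⟨⟨P, hP.1, hP0⟩, (mem_iff_liesOver K q _).2 hP.2, rfl⟩

theorem absNorm_mem_q (q : ℕ) [hq : Fact q.Prime] (hqp : q ≠ p) (v : HeightOneSpectrum (𝓞 K)) (hv : (q : 𝓞 K) ∈ v.asIdeal) :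
    Ideal.absNorm v.asIdeal = q ^ orderOf (q : ZMod p) := by
  have hnd : ¬ q ∣ p := fun h => hqp ((Nat.prime_dvd_prime_iff_eq hq.out hp.out).1 h)
  haveI : NeZero p := ⟨hp.out.ne_zero⟩
  haveI := liesOver_of_mem q v hv
  haveI := v.isPrime
  haveI := v.isMaximal
  rw [Ideal.absNorm_eq_pow_inertiaDeg' v.asIdeal hq.out, ← IsCyclotomicExtension.Rat.inertiaDeg_eq_of_not_dvd q K v.asIdeal hnd,
    Ideal.inertiaDeg'_eq_inertiaDeg]

theorem absNorm_mem_p (v : HeightOneSpectrum (𝓞 K)) (hv : (p : 𝓞 K) ∈ v.asIdeal) :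
    Ideal.absNorm v.asIdeal = p := by
  haveI := liesOver_of_mem p v hv
  haveI := v.isPrime
  haveI := v.isMaximal
  have h := IsCyclotomicExtension.Rat.inertiaDeg_eq_of_prime p K v.asIdeal
  rw [Ideal.absNorm_eq_pow_inertiaDeg' v.asIdeal hp.out, Ideal.inertiaDeg'_eq_inertiaDeg, h, pow_one]


/-- the weight `I ↦ N(I)^(-s)` -/
noncomputable def wN (s : ℝ) : Ideal (𝓞 K) →* ℝ≥0∞ where
  toFun I := ENNReal.ofReal ((Ideal.absNorm I : ℝ) ^ (-s))
  map_one' := by simp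
  map_mul' I J := by
    rw [map_mul, Nat.cast_mul, Real.mul_rpow (Nat.cast_nonneg _) (Nat.cast_nonneg _),
      ENNReal.ofReal_mul (Real.rpow_nonneg (Nat.cast_nonneg _) _)]

theorem wN_apply (s : ℝ) (I : Ideal (𝓞 K)) : wN K s I = ENNReal.ofReal ((Ideal.absNorm I : ℝ) ^ (-s)) := rfl

theorem inv_one_sub (y : ℝ) (h0 : 0 ≤ y) (h1 : y < 1) : (1 - ENNReal.ofReal y)⁻¹ = ENNReal.ofReal ((1 - y)⁻¹) := by
  rw [← ENNReal.ofReal_one, ← ENNReal.ofReal_sub _ h0, ENNReal.ofReal_inv_of_pos (by linarith)]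

include hχ in
theorem local_eq (s : ℝ) (hs : 1 < s) (q : ℕ) (hq : q.Prime) : ∃ r : ℝ, 0 ≤ r ∧
    (r : ℂ) = (1 - (q : ℂ) ^ (-(s : ℂ)))⁻¹ * ∏ k ∈ Finset.Icc 1 (p - 2), (1 - (χ ^ k) q * (q : ℂ) ^ (-(s : ℂ)))⁻¹ ∧
    ∏ v ∈ (finite_mem (K := K) q hq.ne_zero).toFinset, (1 - wN K s v.asIdeal)⁻¹ = ENNReal.ofReal r := by
  haveI : Fact q.Prime := ⟨hq⟩
  have h2p := hp.out.two_le
  set x : ℝ := (q : ℝ) ^ (-s) with hx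
  have hx0 : 0 < x := Real.rpow_pos_of_pos (by exact_mod_cast hq.pos) _
  have hx1 : x < 1 := Real.rpow_lt_one_of_one_lt_of_neg (by exact_mod_cast hq.one_lt) (by linarith)
  have hxc : (q : ℂ) ^ (-(s : ℂ)) = (x : ℂ) := by
    rw [hx, Complex.ofReal_cpow (Nat.cast_nonneg _)]; simp
  rw [hxc]
  by_cases hqp : q = p
  · subst hqp
    refine ⟨(1 - x)⁻¹, inv_nonneg.2 (by linarith), ?_, ?_⟩
    · rw [Finset.prod_eq_one]
      · simp
      · intro k hk
        have : (χ ^ k) (q : ZMod q) = 0 := by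
          rw [ZMod.natCast_self]
          exact MulChar.map_nonunit _ not_isUnit_zero
        rw [this]; simp
    · rw [Finset.prod_congr rfl (g := fun _ => ENNReal.ofReal ((1 - x)⁻¹)), Finset.prod_const,
        ← Set.ncard_eq_toFinset_card _ (finite_mem (K := K) q hq.ne_zero), card_primes_p, pow_one]
      intro v hv
      have hv : (q : 𝓞 K) ∈ v.asIdeal := by simpa using hv
      rw [wN_apply, absNorm_mem_p K v hv, inv_one_sub _ hx0.le hx1]
  · have hcop : q.Coprime p := (Nat.coprime_primes hq hp.out).2 hqp
    set f := orderOf (q : ZMod p) with hf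
    set g := {v : HeightOneSpectrum (𝓞 K) | (q : 𝓞 K) ∈ v.asIdeal}.ncard with hg
    have hgf : g * f = p - 1 := card_mem_q K q hqp
    have hprim := chi_prim χ hχ (ZMod.unitOfCoprime q hcop)
    rw [ZMod.coe_unitOfCoprime, ← hf] at hprim
    have hf0 : 0 < f := Nat.pos_of_ne_zero (by rintro h; rw [h] at hgf; omega)
    have hxf : x ^ f < 1 := pow_lt_one₀ hx0.le hx1 hf0.ne'
    refine ⟨((1 - x ^ f)⁻¹) ^ g, pow_nonneg (inv_nonneg.2 (by linarith)) _, ?_, ?_⟩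
    · push_cast
      rw [inv_pow, ← cyc_prod hf0 hprim g x, mul_comm f g, hgf, show p - 1 = (p - 2) + 1 by omega, Finset.prod_range_succ', mul_inv, mul_comm]
      congr 1
      · simp
      · rw [← Finset.prod_inv_distrib, Finset.range_eq_Ico, Finset.prod_Ico_add' (fun k => (1 - χ (q : ZMod p) ^ k * (x : ℂ))⁻¹) 0 (p - 2) 1]
        refine Finset.prod_congr (by ext; simp) fun k hk => ?_
        rw [MulChar.pow_apply' _ (by simp at hk; omega)]
    · rw [Finset.prod_congr rfl (g := fun _ => ENNReal.ofReal ((1 - x ^ f)⁻¹)), Finset.prod_const,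
        ← Set.ncard_eq_toFinset_card _ (finite_mem (K := K) q hq.ne_zero), ENNReal.ofReal_pow (inv_nonneg.2 (by linarith))]
      intro v hv
      have hv : (q : 𝓞 K) ∈ v.asIdeal := by simpa using hv
      rw [wN_apply, absNorm_mem_q K q hqp v hv, Nat.cast_pow, ← inv_one_sub _ (by positivity) hxf, hx,
        ← Real.rpow_natCast, ← Real.rpow_natCast, ← Real.rpow_mul (by positivity), ← Real.rpow_mul (by positivity), mul_comm]

theorem tsum_wN (s : ℝ) (hs : 1 < s) : ∑' I : {I : Ideal (𝓞 K) // I ≠ ⊥}, wN K s I =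
    ∑' n : ℕ, ENNReal.ofReal (Nat.card {I : Ideal (𝓞 K) // Ideal.absNorm I = n} * (n : ℝ) ^ (-s)) := by
  have h1 : ∑' I : {I : Ideal (𝓞 K) // I ≠ ⊥}, wN K s I = ∑' I : Ideal (𝓞 K), wN K s I := by
    refine (tsum_subtype {I : Ideal (𝓞 K) | I ≠ ⊥} (wN K s)).trans ?_
    refine tsum_congr fun I => ?_
    by_cases h : I = ⊥
    · subst h
      rw [Set.indicator_of_notMem (by simp), wN_apply]
      simp [Real.zero_rpow (show -s ≠ 0 by linarith)]
    · rw [Set.indicator_of_mem h]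
  rw [h1, ← (Equiv.sigmaFiberEquiv (Ideal.absNorm : Ideal (𝓞 K) → ℕ)).tsum_eq, ENNReal.tsum_sigma']
  refine tsum_congr fun n => ?_
  rw [tsum_congr (fun I => show wN K s (Equiv.sigmaFiberEquiv (Ideal.absNorm : Ideal (𝓞 K) → ℕ) ⟨n, I⟩) = ENNReal.ofReal ((n : ℝ) ^ (-s)) by
    rw [wN_apply]; simp [I.2]), ENNReal.tsum_const]
  haveI : Finite {I : Ideal (𝓞 K) // Ideal.absNorm I = n} := Ideal.finite_setOf_absNorm_eq n
  rw [ENNReal.ofReal_mul (Nat.cast_nonneg _), ENNReal.ofReal_natCast, ENat.card_eq_coe_natCard]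
  simp

end LocalFactor

end PartC2

section PartC3

open IsDedekindDomain nonZeroDivisors
open scoped ENNReal
open Filter Topology

section ZetaFactor
variable {p : ℕ} [hp : Fact p.Prime] (χ : DirichletCharacter ℂ p) (hχ : orderOf χ = p - 1)
variable (K : Type*) [Field K] [NumberField K] [IsCyclotomicExtension {p} ℚ K]

include hχ in
theorem zeta_factor (s : ℝ) (hs : 1 < s) : dedekindZeta K s =
    riemannZeta s * ∏ k ∈ Finset.Icc 1 (p - 2), LSeries (fun n => (χ ^ k) n) s := by
  classical
  have hs' : 1 < (s : ℂ).re := by simpa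
  choose! r hr0 hrc hr using local_eq χ hχ K s hs
  set Z : ℂ := riemannZeta s * ∏ k ∈ Finset.Icc 1 (p - 2), LSeries (fun n => (χ ^ k) n) s with hZ
  set P : ℕ → ℝ := fun n => ∏ q ∈ n.primesBelow, r q with hP
  have hPc : Tendsto (fun n => (P n : ℂ)) atTop (𝓝 Z) := by
    have h1 := (riemannZeta_eulerProduct hs').mul (tendsto_finsetProd (Finset.Icc 1 (p - 2))
      (fun k _ => DirichletCharacter.LSeries_eulerProduct (χ ^ k) hs'))
    refine h1.congr fun n => ?_
    rw [Finset.prod_comm, ← Finset.prod_mul_distrib, hP]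
    push_cast
    refine Finset.prod_congr rfl fun q hq => ?_
    rw [hrc q (Nat.prime_of_mem_primesBelow hq)]
  have hPr : Tendsto P atTop (𝓝 Z.re) := by
    have := (Complex.continuous_re.tendsto Z).comp hPc
    exact this
  have hZr : Z = (Z.re : ℂ) := tendsto_nhds_unique hPc ((Complex.continuous_ofReal.tendsto _).comp hPr)
  have hP0 : ∀ n, 0 ≤ P n := fun n => Finset.prod_nonneg fun q hq => hr0 q (Nat.prime_of_mem_primesBelow hq)
  have hZ0 : 0 ≤ Z.re := ge_of_tendsto' hPr hP0
  let Tq : ℕ → Finset (HeightOneSpectrum (𝓞 K)) := fun q =>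
    if h : q ≠ 0 then (finite_mem (K := K) q h).toFinset else ∅
  have hTq : ∀ q, q ≠ 0 → ∀ v, v ∈ Tq q ↔ (q : 𝓞 K) ∈ v.asIdeal := by
    intro q h v
    simp only [Tq, dif_pos h]; simp
  let T : ℕ → Finset (HeightOneSpectrum (𝓞 K)) := fun n => n.primesBelow.biUnion Tq
  have hdisj : ∀ n : ℕ, (n.primesBelow : Set ℕ).PairwiseDisjoint Tq := by
    intro n q hq q' hq' hne
    have hqp := Nat.prime_of_mem_primesBelow hq
    have hqp' := Nat.prime_of_mem_primesBelow hq'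
    change Disjoint (Tq q) (Tq q')
    rw [Finset.disjoint_left]
    intro v hv hv'
    rw [hTq q hqp.ne_zero] at hv
    rw [hTq q' hqp'.ne_zero] at hv'
    have hc := (Nat.coprime_primes hqp hqp').2 hne
    have h1 : IsCoprime (q : ℤ) (q' : ℤ) := Nat.isCoprime_iff_coprime.2 hc
    obtain ⟨a, b, hab⟩ := h1
    apply v.isPrime.ne_top
    rw [Ideal.eq_top_iff_one]
    have := v.asIdeal.add_mem (v.asIdeal.mul_mem_left (a : 𝓞 K) hv) (v.asIdeal.mul_mem_left (b : 𝓞 K) hv')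
    have h2 : (a : 𝓞 K) * q + b * q' = 1 := by exact_mod_cast congrArg (Int.cast : ℤ → 𝓞 K) hab
    rwa [h2] at this
  have hT : ∀ v, ∀ᶠ n in atTop, v ∈ T n := by
    intro v
    obtain ⟨q, hq, hqv⟩ : ∃ q : ℕ, q.Prime ∧ (q : 𝓞 K) ∈ v.asIdeal := by
      have hN0 : Ideal.absNorm v.asIdeal ≠ 0 := fun h => v.ne_bot (Ideal.absNorm_eq_zero_iff.1 h)
      have hmem : ((Ideal.absNorm v.asIdeal : ℕ) : 𝓞 K) ∈ v.asIdeal := Ideal.absNorm_mem _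
      by_contra hcon
      push Not at hcon
      have key : ∀ n : ℕ, n ≠ 0 → (n : 𝓞 K) ∉ v.asIdeal := by
        intro n
        induction n using Nat.recOnMul with
        | zero => simp
        | one => intro _ h; exact v.isPrime.ne_top ((Ideal.eq_top_iff_one _).2 (by simpa using h))
        | prime q hq => intro _; exact hcon q hq
        | mul a b iha ihb =>
          intro h
          rw [Nat.cast_mul]
          intro h'
          rcases v.isPrime.mem_or_mem h' with h' | h'
          · exact iha (left_ne_zero_of_mul h) h'
          · exact ihb (right_ne_zero_of_mul h) h'
      exact key _ hN0 hmem
    filter_upwards [eventually_gt_atTop q] with n hn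
    exact Finset.mem_biUnion.2 ⟨q, Nat.mem_primesBelow.2 ⟨hn, hq⟩, (hTq q hq.ne_zero v).2 hqv⟩
  have hE := euler_tendsto (wN K s) atTop T hT
  have hprod : ∀ n, ∏ v ∈ T n, (1 - wN K s v.asIdeal)⁻¹ = ENNReal.ofReal (P n) := by
    intro n
    rw [Finset.prod_biUnion (hdisj n), hP, ENNReal.ofReal_prod_of_nonneg (fun q hq => hr0 q (Nat.prime_of_mem_primesBelow hq))]
    refine Finset.prod_congr rfl fun q hq => ?_
    have hqp := Nat.prime_of_mem_primesBelow hq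
    rw [← hr q hqp]
    simp only [Tq, dif_pos hqp.ne_zero]
  simp only [hprod] at hE
  have hval := tendsto_nhds_unique hE (ENNReal.tendsto_ofReal hPr)
  rw [tsum_wN K s hs] at hval
  have hnn : ∀ n : ℕ, 0 ≤ Nat.card {I : Ideal (𝓞 K) // Ideal.absNorm I = n} * (n : ℝ) ^ (-s) := fun n => by positivity
  have hsum : Summable (fun n : ℕ => Nat.card {I : Ideal (𝓞 K) // Ideal.absNorm I = n} * (n : ℝ) ^ (-s)) := by
    have h1 : ∑' n : ℕ, ENNReal.ofReal (Nat.card {I : Ideal (𝓞 K) // Ideal.absNorm I = n} * (n : ℝ) ^ (-s)) ≠ ⊤ := by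
      rw [hval]; exact ENNReal.ofReal_ne_top
    have := ENNReal.summable_toReal h1
    refine this.congr fun n => ?_
    rw [ENNReal.toReal_ofReal (hnn n)]
  rw [← ENNReal.ofReal_tsum_of_nonneg hnn hsum] at hval
  have hval' := (ENNReal.ofReal_eq_ofReal_iff (tsum_nonneg hnn) hZ0).1 hval
  rw [hZr, ← hval', Complex.ofReal_tsum]
  unfold dedekindZeta LSeries
  refine tsum_congr fun n => ?_
  rcases eq_or_ne n 0 with rfl | hn
  · simp [Real.zero_rpow (show -s ≠ 0 by linarith)]
  · rw [LSeries.term_of_ne_zero hn]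
    push_cast
    rw [Complex.ofReal_cpow (Nat.cast_nonneg _)]
    push_cast
    rw [Complex.cpow_neg, div_eq_mul_inv]

include hχ in
theorem residue_prod : (dedekindZeta_residue K : ℂ) = ∏ k ∈ Finset.Icc 1 (p - 2), DirichletCharacter.LFunction (χ ^ k) 1 := by
  have h1 := tendsto_sub_one_mul_dedekindZeta_nhdsGT K
  have hne : ∀ k ∈ Finset.Icc 1 (p - 2), χ ^ k ≠ 1 := by
    intro k hk h
    rw [Finset.mem_Icc] at hk
    have := Nat.le_of_dvd (by omega) (orderOf_dvd_of_pow_eq_one h)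
    rw [hχ] at this
    omega
  have hemb : Tendsto (fun s : ℝ => (s : ℂ)) (𝓝[>] 1) (𝓝[≠] 1) := by
    refine tendsto_nhdsWithin_iff.2 ⟨?_, ?_⟩
    · exact (Complex.continuous_ofReal.tendsto' 1 1 (by simp)).mono_left nhdsWithin_le_nhds
    · filter_upwards [self_mem_nhdsWithin] with s hs
      have : (1 : ℝ) < s := hs
      simpa using this.ne'
  have h2 : Tendsto (fun s : ℝ => ((s : ℂ) - 1) * riemannZeta s * ∏ k ∈ Finset.Icc 1 (p - 2), DirichletCharacter.LFunction (χ ^ k) s) (𝓝[>] 1)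
      (𝓝 (1 * ∏ k ∈ Finset.Icc 1 (p - 2), DirichletCharacter.LFunction (χ ^ k) 1)) := by
    refine (riemannZeta_residue_one.comp hemb).mul (tendsto_finsetProd _ fun k hk => ?_)
    have := (DirichletCharacter.differentiable_LFunction (hne k hk)).continuous.tendsto 1
    exact this.comp (hemb.mono_right nhdsWithin_le_nhds)
  rw [one_mul] at h2
  refine tendsto_nhds_unique h1 (h2.congr' ?_)
  filter_upwards [self_mem_nhdsWithin] with s hs
  have hs : (1 : ℝ) < s := hs
  rw [zeta_factor χ hχ K s hs, mul_assoc]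
  congr 2
  refine Finset.prod_congr rfl fun k _ => ?_
  rw [DirichletCharacter.LFunction_eq_LSeries _ (by simpa)]

end ZetaFactor

end PartC3

section PartC4

open IsDedekindDomain nonZeroDivisors
open scoped ENNReal
open Filter Topology

section AbelLimit

/-- differences of `n ^ (-s)` -/
noncomputable def cdf (s : ℝ) (n : ℕ) : ℝ := ((n + 1 : ℕ) : ℝ) ^ (-s) - (n : ℝ) ^ (-s)

theorem cdf_bound (s : ℝ) (h1 : 1 ≤ s) (h2 : s ≤ 2) (n : ℕ) : ‖cdf s n‖ ≤ 4 * (1 / ((n + 1 : ℕ) : ℝ) ^ 2) := by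
  unfold cdf
  rcases Nat.eq_zero_or_pos n with rfl | hn
  · simp [Real.zero_rpow (show -s ≠ 0 by linarith)]
  have hn' : (0 : ℝ) < n := by exact_mod_cast hn
  have hn1 : (1 : ℝ) ≤ n := by exact_mod_cast hn
  have hB := one_add_mul_self_le_rpow_one_add (s := -(1 / ((n : ℝ) + 1))) (p := s) (by
    rw [neg_le_neg_iff, div_le_one (by positivity)]; linarith) h1
  have e1 : ((n + 1 : ℕ) : ℝ) ^ (-s) = (n : ℝ) ^ (-s) * (1 + -(1 / ((n : ℝ) + 1))) ^ s := by
    have : 1 + -(1 / ((n : ℝ) + 1)) = n / ((n + 1 : ℕ) : ℝ) := by push_cast; field_simp; ring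
    rw [this, Real.div_rpow hn'.le (by positivity), Real.rpow_neg (by positivity), Real.rpow_neg (by positivity)]
    have : (n : ℝ) ^ s ≠ 0 := (Real.rpow_pos_of_pos hn' _).ne'
    field_simp
  have hpos : 0 < (n : ℝ) ^ (-s) := Real.rpow_pos_of_pos hn' _
  have hle1 : ((n + 1 : ℕ) : ℝ) ^ (-s) ≤ (n : ℝ) ^ (-s) :=
    Real.rpow_le_rpow_of_nonpos hn' (by push_cast; linarith) (by linarith)
  rw [Real.norm_eq_abs, abs_of_nonpos (by linarith), neg_sub, e1]
  have hle : (n : ℝ) ^ (-s) ≤ 1 / n := by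
    rw [one_div, ← Real.rpow_neg_one]
    exact Real.rpow_le_rpow_of_exponent_le hn1 (by linarith)
  calc (n : ℝ) ^ (-s) - (n : ℝ) ^ (-s) * (1 + -(1 / ((n : ℝ) + 1))) ^ s
      = (n : ℝ) ^ (-s) * (1 - (1 + -(1 / ((n : ℝ) + 1))) ^ s) := by ring
    _ ≤ (n : ℝ) ^ (-s) * (s * (1 / ((n : ℝ) + 1))) := by
        apply mul_le_mul_of_nonneg_left _ hpos.le; linarith
    _ ≤ 1 / n * (2 * (1 / ((n : ℝ) + 1))) := by gcongr
    _ ≤ 4 * (1 / ((n + 1 : ℕ) : ℝ) ^ 2) := by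
        push_cast
        rw [div_mul_eq_mul_div, one_mul, mul_one_div, mul_one_div, div_div, div_le_div_iff₀ (by positivity) (by positivity)]
        nlinarith

theorem cdf_bound_summable : Summable (fun n : ℕ => 4 * (1 / ((n + 1 : ℕ) : ℝ) ^ 2)) := by
  have := (summable_nat_add_iff 1).2 (Real.summable_one_div_nat_pow.2 (one_lt_two))
  exact this.mul_left 4

theorem cdf_mul (z : ℂ) (s : ℝ) (hs : 0 < s) (F : ℂ) (hF : HasSum (fun n : ℕ => z ^ n * ((n : ℝ) ^ (-s) : ℝ)) F) :
    (1 - z) * F = ∑' n : ℕ, z ^ (n + 1) * (cdf s n : ℂ) := by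
  have h0 : z ^ 0 * (((0 : ℕ) : ℝ) ^ (-s) : ℝ) = 0 := by simp [Real.zero_rpow (show -s ≠ 0 by linarith)]
  have h1 : HasSum (fun n : ℕ => z ^ (n + 1) * (((n + 1 : ℕ) : ℝ) ^ (-s) : ℝ)) F := by
    have := (hasSum_nat_add_iff' 1).2 hF
    rw [Finset.sum_range_one, h0, sub_zero] at this
    exact this
  have h2 := (h1.sub (hF.mul_left z)).tsum_eq
  rw [show (1 - z) * F = F - z * F by ring, ← h2]
  refine tsum_congr fun n => ?_
  unfold cdf
  push_cast
  ring

theorem abel_pow (z : ℂ) (hz : ‖z‖ = 1) (hz1 : z ≠ 1) :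
    (1 - z) * (- Complex.log (1 - z)) = ∑' n : ℕ, z ^ (n + 1) * (cdf 1 n : ℂ) := by
  have hr : Tendsto (fun r : ℝ => (r : ℂ) * z) (𝓝[<] 1) (𝓝 z) := by
    have : Tendsto (fun r : ℝ => (r : ℂ) * z) (𝓝 1) (𝓝 (((1 : ℝ) : ℂ) * z)) :=
      ((Complex.continuous_ofReal.mul continuous_const).tendsto 1)
    simp only [Complex.ofReal_one, one_mul] at this
    exact this.mono_left nhdsWithin_le_nhds
  have hre : z.re < 1 := by
    rcases (Complex.re_le_norm z).lt_or_eq with h | h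
    · rwa [hz] at h
    · exfalso; apply hz1
      have h2 := Complex.sq_norm_sub_sq_re z
      rw [← h, sub_self] at h2
      have him : z.im = 0 := by nlinarith
      apply Complex.ext
      · rw [h, hz]; simp
      · rw [him]; simp
  have hslit : (1 - z) ∈ Complex.slitPlane := Or.inl (by simp; exact hre)
  have hL : Tendsto (fun r : ℝ => (1 - (r : ℂ) * z) * (- Complex.log (1 - r * z))) (𝓝[<] 1) (𝓝 ((1 - z) * (- Complex.log (1 - z)))) := by
    have h1 := hr.const_sub 1
    exact h1.mul (h1.clog hslit).neg
  have hR : Tendsto (fun r : ℝ => ∑' n : ℕ, ((r : ℂ) * z) ^ (n + 1) * (cdf 1 n : ℂ)) (𝓝[<] 1) (𝓝 (∑' n : ℕ, z ^ (n + 1) * (cdf 1 n : ℂ))) := by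
    refine tendsto_tsum_of_dominated_convergence cdf_bound_summable ?_ ?_
    · intro n
      exact (hr.pow _).mul_const _
    · filter_upwards [Ioo_mem_nhdsLT (show (0 : ℝ) < 1 by norm_num)] with r hr n
      rw [norm_mul, norm_pow, norm_mul, hz, mul_one, Complex.norm_real, Complex.norm_real, Real.norm_of_nonneg hr.1.le]
      exact (mul_le_of_le_one_left (norm_nonneg _) (pow_le_one₀ hr.1.le hr.2.le)).trans (cdf_bound 1 le_rfl one_le_two n)
  refine tendsto_nhds_unique hL (hR.congr' ?_)
  filter_upwards [Ioo_mem_nhdsLT (show (0 : ℝ) < 1 by norm_num)] with r hr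
  symm
  apply cdf_mul _ _ one_pos
  have hlt : ‖(r : ℂ) * z‖ < 1 := by rw [norm_mul, hz, mul_one, Complex.norm_real, Real.norm_of_nonneg hr.1.le]; exact hr.2
  refine (Complex.hasSum_taylorSeries_neg_log hlt).congr_fun ?_
  intro n
  rw [Real.rpow_neg_one]; push_cast; rw [div_eq_mul_inv]

theorem abel_dirichlet (z : ℂ) (hz : ‖z‖ = 1) (hz1 : z ≠ 1) (F : ℝ → ℂ)
    (hF : ∀ s : ℝ, 1 < s → HasSum (fun n : ℕ => z ^ n * ((n : ℝ) ^ (-s) : ℝ)) (F s)) :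
    Tendsto F (𝓝[>] 1) (𝓝 (- Complex.log (1 - z))) := by
  have h0 : (1 - z) ≠ 0 := sub_ne_zero.2 hz1.symm
  have hR : Tendsto (fun s : ℝ => ∑' n : ℕ, z ^ (n + 1) * (cdf s n : ℂ)) (𝓝[>] 1) (𝓝 (∑' n : ℕ, z ^ (n + 1) * (cdf 1 n : ℂ))) := by
    refine tendsto_tsum_of_dominated_convergence cdf_bound_summable ?_ ?_
    · intro n
      refine Tendsto.const_mul _ ?_
      refine Tendsto.mono_left ?_ nhdsWithin_le_nhds
      refine (Complex.continuous_ofReal.tendsto _).comp ?_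
      unfold cdf
      refine Tendsto.sub ?_ ?_
      · exact Tendsto.rpow tendsto_const_nhds (tendsto_id.neg) (Or.inl (by positivity))
      · rcases Nat.eq_zero_or_pos n with rfl | hn
        · refine Tendsto.congr' ?_ (tendsto_const_nhds (x := (((0 : ℕ) : ℝ) ^ (-1 : ℝ) : ℝ)))
          filter_upwards [Ioi_mem_nhds (show (0 : ℝ) < 1 by norm_num)] with s hs
          have hs : 0 < s := hs
          simp [Real.zero_rpow (show -s ≠ 0 by linarith)]
        · exact Tendsto.rpow tendsto_const_nhds (tendsto_id.neg) (Or.inl (by positivity))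
    · filter_upwards [Ioo_mem_nhdsGT (show (1 : ℝ) < 2 by norm_num)] with s hs n
      rw [norm_mul, norm_pow, hz, one_pow, one_mul, Complex.norm_real]
      exact cdf_bound s hs.1.le hs.2.le n
  rw [← abel_pow z hz hz1] at hR
  have := hR.const_mul ((1 - z)⁻¹)
  rw [inv_mul_cancel_left₀ h0] at this
  refine this.congr' ?_
  filter_upwards [self_mem_nhdsWithin] with s hs
  have hs : (1 : ℝ) < s := hs
  rw [← cdf_mul z s (by linarith) (F s) (hF s hs), inv_mul_cancel_left₀ h0]

end AbelLimit

end PartC4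

section PartC5

open IsDedekindDomain nonZeroDivisors
open scoped ENNReal
open Filter Topology

section LOne
variable {p : ℕ} [hp : Fact p.Prime]

theorem expZeta_one (j : ZMod p) (hj : j ≠ 0) :
    HurwitzZeta.expZeta (ZMod.toAddCircle j) 1 = - Complex.log (1 - ZMod.stdAddChar j) := by
  set z : ℂ := ZMod.stdAddChar j with hz
  have hz' : z = Complex.exp (2 * Real.pi * Complex.I * ((j.val / p : ℝ) : ℂ)) := by
    rw [hz, ZMod.stdAddChar_apply, ZMod.toCircle_apply]
    congr 1
    push_cast
    ring
  have hnorm : ‖z‖ = 1 := by rw [hz]; rw [ZMod.stdAddChar_apply]; exact Circle.norm_coe _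
  have hz1 : z ≠ 1 := by
    intro h
    apply hj
    have h2 : ZMod.stdAddChar j = ZMod.stdAddChar (0 : ZMod p) := by rw [← hz, h]; simp
    exact ZMod.injective_stdAddChar h2
  have key := abel_dirichlet z hnorm hz1 (fun s => HurwitzZeta.expZeta (ZMod.toAddCircle j) s) (by
    intro s hs
    have := HurwitzZeta.hasSum_expZeta_of_one_lt_re (j.val / p : ℝ) (s := (s : ℂ)) (by simpa)
    rw [← ZMod.toAddCircle_apply] at this
    refine this.congr_fun ?_
    intro n
    rw [hz', ← Complex.exp_nat_mul, Complex.ofReal_cpow (Nat.cast_nonneg _), div_eq_mul_inv]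
    push_cast
    rw [Complex.cpow_neg]
    congr 2
    ring)
  have hc : Tendsto (fun s : ℝ => HurwitzZeta.expZeta (ZMod.toAddCircle j) s) (𝓝[>] 1) (𝓝 (HurwitzZeta.expZeta (ZMod.toAddCircle j) ((1 : ℝ) : ℂ))) := by
    have h1 := (HurwitzZeta.differentiable_expZeta_of_ne_zero (a := ZMod.toAddCircle j) (by simpa using hj)).continuous
    exact ((h1.comp Complex.continuous_ofReal).tendsto 1).mono_left nhdsWithin_le_nhds
  have := tendsto_nhds_unique hc key
  simpa using this

theorem prim_of_ne_one (χ : DirichletCharacter ℂ p) (hχ : χ ≠ 1) : χ.IsPrimitive := by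
  rcases (Nat.dvd_prime hp.out).1 (DirichletCharacter.conductor_dvd_level χ) with h | h
  · exact absurd ((DirichletCharacter.eq_one_iff_conductor_eq_one (χ := χ)).2 h) hχ
  · exact h

theorem gauss_norm (χ : DirichletCharacter ℂ p) (hχ : χ ≠ 1) : ‖gaussSum χ ZMod.stdAddChar‖ = Real.sqrt p := by
  have h := gaussSum_mul_gaussSum_eq_card hχ (ZMod.isPrimitive_stdAddChar p)
  rw [← star_gaussSum_eq, ZMod.card] at h
  have h2 := congrArg norm h
  rw [norm_mul, norm_star] at h2
  rw [eq_comm, Real.sqrt_eq_iff_mul_self_eq (by positivity) (norm_nonneg _), h2]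
  simp

/-- the log sum `∑ χ(j) log (1 - e(j))` -/
noncomputable def logSum (χ : DirichletCharacter ℂ p) : ℂ := ∑ j : ZMod p, χ j * Complex.log (1 - ZMod.stdAddChar j)

theorem L_one_norm (χ : DirichletCharacter ℂ p) (hχ : χ ≠ 1) :
    ‖DirichletCharacter.LFunction χ⁻¹ 1‖ * Real.sqrt p = ‖logSum χ‖ := by
  have h0 : χ 0 = 0 := MulChar.map_nonunit _ not_isUnit_zero
  have h1 := ZMod.LFunction_dft (fun j : ZMod p => (χ j : ℂ)) (s := 1) (Or.inl h0)
  have h2 : ZMod.LFunction (ZMod.dft (fun j : ZMod p => (χ j : ℂ))) 1 = χ⁻¹ (-1) * gaussSum χ ZMod.stdAddChar * DirichletCharacter.LFunction χ⁻¹ 1 := by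
    have hd : ZMod.dft (fun j : ZMod p => (χ j : ℂ)) = fun j => (χ⁻¹ (-1) * gaussSum χ ZMod.stdAddChar) * χ⁻¹ j := by
      funext j
      refine ((prim_of_ne_one χ hχ).fourierTransform_eq_inv_mul_gaussSum j).trans ?_
      rw [← neg_one_mul j, map_mul]
      ring
    rw [hd]
    unfold DirichletCharacter.LFunction ZMod.LFunction
    simp only [mul_assoc, ← Finset.mul_sum]
    ring
  have h3 : ∑ j : ZMod p, χ j * HurwitzZeta.expZeta (ZMod.toAddCircle (-j)) 1 = - (χ (-1) * logSum χ) := by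
    unfold logSum
    rw [Finset.mul_sum, ← Finset.sum_neg_distrib, ← Equiv.sum_comp (Equiv.neg (ZMod p))]
    refine Finset.sum_congr rfl fun j _ => ?_
    by_cases hj : j = 0
    · subst hj; simp [h0]
    · rw [Equiv.neg_apply, neg_neg, expZeta_one j hj, ← neg_one_mul j, map_mul]; ring
  rw [h2, h3] at h1
  have h4 := congrArg norm h1
  have hn : ∀ ψ : DirichletCharacter ℂ p, ‖ψ (-1)‖ = 1 := fun ψ => by
    simpa using DirichletCharacter.unit_norm_eq_one ψ (-1)
  rw [norm_neg, norm_mul, norm_mul, norm_mul, hn, hn, one_mul, one_mul, gauss_norm χ hχ] at h4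
  rw [mul_comm, h4]

theorem residue_eq (χ : DirichletCharacter ℂ p) (hχ : orderOf χ = p - 1) (K : Type*) [Field K] [NumberField K] [IsCyclotomicExtension {p} ℚ K] :
    dedekindZeta_residue K * Real.sqrt p ^ (p - 2) = ∏ k ∈ Finset.Icc 1 (p - 2), ‖logSum (χ ^ k)‖ := by
  have h2p := hp.out.two_le
  have h1 := congrArg norm (residue_prod χ hχ K)
  rw [Complex.norm_real, Real.norm_of_nonneg (dedekindZeta_residue_pos K).le, norm_prod] at h1
  have h2 : ∏ k ∈ Finset.Icc 1 (p - 2), ‖DirichletCharacter.LFunction (χ ^ k) 1‖ = ∏ k ∈ Finset.Icc 1 (p - 2), ‖DirichletCharacter.LFunction (χ ^ k)⁻¹ 1‖ := by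
    refine Finset.prod_bij (fun k _ => p - 1 - k) ?_ ?_ ?_ ?_
    · intro k hk; simp at hk ⊢; omega
    · intro a ha b hb h; simp at ha hb h; omega
    · intro b hb; simp at hb; exact ⟨p - 1 - b, by simp; omega, by omega⟩
    · intro k hk
      simp at hk
      congr 2
      rw [eq_inv_iff_mul_eq_one, ← pow_add, show k + (p - 1 - k) = p - 1 by omega, ← hχ, pow_orderOf_eq_one]
  rw [h1, h2]
  have h3 : Real.sqrt p ^ (p - 2) = ∏ k ∈ Finset.Icc 1 (p - 2), Real.sqrt p := by simp
  rw [h3, ← Finset.prod_mul_distrib]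
  refine Finset.prod_congr rfl fun k hk => L_one_norm _ ?_
  intro h
  rw [Finset.mem_Icc] at hk
  have := Nat.le_of_dvd (by omega) (orderOf_dvd_of_pow_eq_one h)
  rw [hχ] at this
  omega
end LOne

end PartC5

section PartC6

open IsDedekindDomain nonZeroDivisors
open scoped ENNReal
open Filter Topology

section Parity
variable {p : ℕ} [hp : Fact p.Prime]

theorem log_im (j : ZMod p) (hj : j ≠ 0) :
    (Complex.log (1 - ZMod.stdAddChar j)).im = Real.pi * (j.val / p - 1 / 2) := by
  have hp0 : (0 : ℝ) < p := by exact_mod_cast hp.out.pos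
  set t : ℝ := j.val / p with ht
  have hv : 0 < j.val := Nat.pos_of_ne_zero (by rwa [Ne, ZMod.val_eq_zero])
  have ht0 : 0 < t := div_pos (by exact_mod_cast hv) hp0
  have ht1 : t < 1 := by rw [ht, div_lt_one hp0]; exact_mod_cast ZMod.val_lt j
  have hz : (ZMod.stdAddChar j : ℂ) = Complex.exp (2 * Real.pi * Complex.I * (t : ℂ)) := by
    rw [ZMod.stdAddChar_apply, ZMod.toCircle_apply]
    congr 1
    rw [ht]
    push_cast
    ring
  have hpi := Real.pi_pos
  have hsin : 0 < 2 * Real.sin (Real.pi * t) := by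
    have := Real.sin_pos_of_pos_of_lt_pi (x := Real.pi * t) (by positivity) (by nlinarith)
    linarith
  rw [Complex.log_im]
  have : (1 : ℂ) - ZMod.stdAddChar j = ((2 * Real.sin (Real.pi * t) : ℝ) : ℂ) *
      (Complex.cos ((Real.pi * (t - 1 / 2) : ℝ) : ℂ) + Complex.sin ((Real.pi * (t - 1 / 2) : ℝ) : ℂ) * Complex.I) := by
    have e1 : Real.cos (Real.pi * (t - 1 / 2)) = Real.sin (Real.pi * t) := by
      rw [← Real.cos_sub_pi_div_two]; congr 1; ring
    have e2 : Real.sin (Real.pi * (t - 1 / 2)) = - Real.cos (Real.pi * t) := by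
      rw [← Real.sin_sub_pi_div_two]; congr 1; ring
    rw [hz, ← Complex.ofReal_cos, ← Complex.ofReal_sin, e1, e2,
      show 2 * (Real.pi : ℂ) * Complex.I * t = ((2 * (Real.pi * t) : ℝ) : ℂ) * Complex.I by push_cast; ring,
      Complex.exp_mul_I, ← Complex.ofReal_cos, ← Complex.ofReal_sin, Real.cos_two_mul, Real.sin_two_mul]
    have := Real.sin_sq_add_cos_sq (Real.pi * t)
    apply Complex.ext
    · simp [-Complex.ofReal_sin, -Complex.ofReal_cos, pow_two]; nlinarith
    · simp [-Complex.ofReal_sin, -Complex.ofReal_cos, pow_two]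
  rw [this, Complex.arg_mul_cos_add_sin_mul_I hsin]
  constructor <;> nlinarith

theorem log_re_neg (j : ZMod p) : ‖(1 : ℂ) - ZMod.stdAddChar (-j)‖ = ‖(1 : ℂ) - ZMod.stdAddChar j‖ := by
  rw [AddChar.map_neg_eq_conj, ← map_one (starRingEnd ℂ), ← map_sub, RCLike.norm_conj, map_one]

theorem chi_zero (χ : DirichletCharacter ℂ p) : χ 0 = 0 := MulChar.map_nonunit _ not_isUnit_zero

theorem chi_neg (χ : DirichletCharacter ℂ p) (j : ZMod p) : χ (-j) = χ (-1) * χ j := by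
  rw [← map_mul, neg_one_mul]

theorem sum_zero_of_odd (f : ZMod p → ℂ) (h : ∀ j, f (-j) = - f j) : ∑ j, f j = 0 := by
  have h1 : ∑ j, f j = - ∑ j, f j := by
    conv_lhs => rw [← Equiv.sum_comp (Equiv.neg (ZMod p))]
    rw [← Finset.sum_neg_distrib]
    exact Finset.sum_congr rfl fun j _ => h j
  have h2 : (2 : ℂ) * ∑ j, f j = 0 := by linear_combination h1
  simpa using h2

/-- `∑ χ(j) log |1 - e(j)|` -/
noncomputable def evS (χ : DirichletCharacter ℂ p) : ℂ := ∑ j : ZMod p, χ j * (Real.log ‖(1 : ℂ) - ZMod.stdAddChar j‖ : ℂ)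

/-- `∑ χ(j) j` -/
noncomputable def odB (χ : DirichletCharacter ℂ p) : ℂ := ∑ j : ZMod p, χ j * (j.val : ℂ)

theorem logSum_split (χ : DirichletCharacter ℂ p) (hχ1 : χ ≠ 1) :
    logSum χ = evS χ + Complex.I * ∑ j : ZMod p, χ j * ((if j = 0 then 0 else Real.pi * (j.val / p - 1 / 2) : ℝ) : ℂ) := by
  unfold logSum evS
  rw [Finset.mul_sum, ← Finset.sum_add_distrib]
  refine Finset.sum_congr rfl fun j _ => ?_
  by_cases hj : j = 0
  · subst hj; simp [chi_zero]
  · rw [if_neg hj, ← log_im j hj, ← Complex.log_re]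
    conv_lhs => rw [← Complex.re_add_im (Complex.log (1 - ZMod.stdAddChar j))]
    ring

theorem logSum_even (χ : DirichletCharacter ℂ p) (hχ1 : χ ≠ 1) (h : χ (-1) = 1) : logSum χ = evS χ := by
  rw [logSum_split χ hχ1, sum_zero_of_odd, mul_zero, add_zero]
  intro j
  rw [chi_neg, h, one_mul]
  by_cases hj : j = 0
  · subst hj; simp
  · have hj' : -j ≠ 0 := neg_ne_zero.2 hj
    rw [if_neg hj, if_neg hj', ZMod.neg_val, if_neg hj]
    have := (ZMod.val_lt j).le
    have hp0 : (p : ℂ) ≠ 0 := by exact_mod_cast hp.out.ne_zero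
    push_cast [Nat.cast_sub this]
    field_simp
    ring

theorem logSum_odd (χ : DirichletCharacter ℂ p) (hχ1 : χ ≠ 1) (h : χ (-1) = -1) : ‖logSum χ‖ = Real.pi / p * ‖odB χ‖ := by
  have hS : evS χ = 0 := by
    apply sum_zero_of_odd
    intro j
    rw [chi_neg, h, log_re_neg]; ring
  rw [logSum_split χ hχ1, hS, zero_add, norm_mul, Complex.norm_I, one_mul]
  have : ∑ j : ZMod p, χ j * ((if j = 0 then 0 else Real.pi * (j.val / p - 1 / 2) : ℝ) : ℂ) =
      ((Real.pi / p : ℝ) : ℂ) * odB χ - (Real.pi / 2 : ℝ) * ∑ j : ZMod p, χ j := by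
    unfold odB
    rw [Finset.mul_sum, Finset.mul_sum, ← Finset.sum_sub_distrib]
    refine Finset.sum_congr rfl fun j _ => ?_
    by_cases hj : j = 0
    · subst hj; simp [chi_zero]
    · rw [if_neg hj]; push_cast; ring
  rw [this, MulChar.sum_eq_zero_of_ne_one hχ1, mul_zero, sub_zero, norm_mul, Complex.norm_real, Real.norm_of_nonneg (by positivity)]

theorem chi_neg_one (χ : DirichletCharacter ℂ p) (hχ : orderOf χ = p - 1) (hp2 : 2 < p) : χ (-1) = -1 := by
  have h1 : χ (-1) * χ (-1) = 1 := by rw [← map_mul]; simp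
  rcases mul_self_eq_one_iff.1 h1 with h | h
  · exfalso
    have h2 : χ.toUnitHom (-1) = 1 := by
      ext; rw [MulChar.coe_toUnitHom]; simpa using h
    have h3 := (injective_iff_map_eq_one _).1 (chi_inj χ hχ) _ h2
    have h4 : (-1 : ZMod p) = 1 := by simpa using congrArg Units.val h3
    haveI : Fact (2 < p) := ⟨hp2⟩
    exact ZMod.neg_one_ne_one h4
  · exact h

theorem prod_odd_even (f : ℕ → ℝ) (m : ℕ) : ∏ k ∈ Finset.Icc 1 (2 * m + 1), f k = (∏ i ∈ Finset.range (m + 1), f (2 * i + 1)) * ∏ i ∈ Finset.range m, f (2 * i + 2) := by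
  induction m with
  | zero => simp
  | succ m ih =>
    rw [show 2 * (m + 1) + 1 = 2 * m + 1 + 1 + 1 by ring, Finset.prod_Icc_succ_top (by omega), Finset.prod_Icc_succ_top (by omega), ih, Finset.prod_range_succ (fun i => f (2 * i + 1)) (m + 1), Finset.prod_range_succ (fun i => f (2 * i + 2)) m, show 2 * (m + 1) + 1 = 2 * m + 1 + 1 + 1 by ring]
    ring

theorem class_formula (χ : DirichletCharacter ℂ p) (hχ : orderOf χ = p - 1) (K : Type*) [Field K] [NumberField K] [IsCyclotomicExtension {p} ℚ K]
    (m : ℕ) (hm : p = 2 * m + 3) :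
    2 ^ (m + 1) * Units.regulator K * Nat.card (ClassGroup (𝓞 K)) * p ^ (m + 1) =
      2 * p * (∏ i ∈ Finset.range (m + 1), ‖odB (χ ^ (2 * i + 1))‖) * ∏ i ∈ Finset.range m, ‖evS (χ ^ (2 * i + 2))‖ := by
  haveI : NeZero p := ⟨hp.out.ne_zero⟩
  have hp2 : 2 < p := by omega
  have hp0 : (0 : ℝ) < p := by exact_mod_cast hp.out.pos
  have h1 := residue_eq χ hχ K
  have hne : ∀ k, 0 < k → k < p - 1 → χ ^ k ≠ 1 := by
    intro k h0 hk h
    have := Nat.le_of_dvd (by omega) (orderOf_dvd_of_pow_eq_one h)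
    rw [hχ] at this
    omega
  have hm1 := chi_neg_one χ hχ hp2
  have hpar : ∀ k, k ≠ 0 → (χ ^ k) (-1) = (-1) ^ k := fun k hk => by rw [MulChar.pow_apply' _ hk, hm1]
  rw [show p - 2 = 2 * m + 1 by omega, prod_odd_even] at h1
  have hev : ∏ i ∈ Finset.range m, ‖logSum (χ ^ (2 * i + 2))‖ = ∏ i ∈ Finset.range m, ‖evS (χ ^ (2 * i + 2))‖ :=
    Finset.prod_congr rfl (fun i hi => by rw [logSum_even (χ ^ (2 * i + 2)) (hne _ (by omega) (by rw [Finset.mem_range] at hi; omega))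
      (by rw [hpar _ (by omega), Even.neg_one_pow ⟨i + 1, by ring⟩])])
  rw [Finset.prod_congr rfl (fun i hi => logSum_odd (χ ^ (2 * i + 1)) (hne _ (by omega) (by rw [Finset.mem_range] at hi; omega))
      (by rw [hpar _ (by omega), Odd.neg_one_pow ⟨i, rfl⟩])), Finset.prod_mul_distrib, Finset.prod_const, Finset.card_range,
    hev,
    dedekindZeta_residue_def, IsCyclotomicExtension.Rat.nrRealPlaces_eq_zero K hp2,
    IsCyclotomicExtension.Rat.nrComplexPlaces_eq_totient_div_two p, Nat.totient_prime hp.out,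
    IsCyclotomicExtension.Rat.torsionOrder_eq (n := p) (K := K), if_neg (by rw [Nat.not_even_iff_odd]; exact ⟨m + 1, by omega⟩),
    IsCyclotomicExtension.Rat.discr_prime p K, show (p - 1) / 2 = m + 1 by omega, show p - 2 = 2 * m + 1 by omega] at h1
  have hcl : (classNumber K : ℝ) = Nat.card (ClassGroup (𝓞 K)) := by
    rw [classNumber, Nat.card_eq_fintype_card]
  have hsq : Real.sqrt |(((-1) ^ (m + 1) * p ^ (2 * m + 1) : ℤ) : ℝ)| = Real.sqrt p ^ (2 * m + 1) := by
    push_cast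
    rw [abs_mul, abs_pow, abs_neg, abs_one, one_pow, one_mul, abs_of_nonneg (by positivity)]
    rw [Real.sqrt_eq_iff_mul_self_eq (by positivity) (by positivity), ← mul_pow, Real.mul_self_sqrt hp0.le]
  rw [hcl] at h1
  rw [hsq] at h1
  have hs : Real.sqrt p ^ (2 * m + 1) ≠ 0 := (pow_pos (Real.sqrt_pos.2 hp0) _).ne'
  have hpi : Real.pi ≠ 0 := Real.pi_ne_zero
  push_cast at h1
  rw [pow_zero, one_mul, div_mul_eq_mul_div, mul_div_mul_right _ _ hs, mul_pow, div_pow, div_eq_iff (by positivity)] at h1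
  have hpm : (p : ℝ) ^ (m + 1) ≠ 0 := by positivity
  have hpim : Real.pi ^ (m + 1) ≠ 0 := by positivity
  apply mul_left_cancel₀ hpim
  field_simp at h1 ⊢
  linear_combination h1
end Parity

end PartC6

section PartC7

open IsDedekindDomain nonZeroDivisors
open scoped ENNReal
open Filter Topology

section CycReg
variable {p : ℕ} [hp : Fact p.Prime]

theorem sum_zmod_range {M : Type*} [AddCommMonoid M] (F : ZMod p → M) : ∑ j : ZMod p, F j = ∑ n ∈ Finset.range p, F (n : ZMod p) := by
  refine Finset.sum_nbij' ZMod.val (fun n => (n : ZMod p)) ?_ ?_ ?_ ?_ ?_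
  · intro a _; exact Finset.mem_range.2 (ZMod.val_lt a)
  · intro a _; exact Finset.mem_univ _
  · intro a _; simp
  · intro a ha; exact ZMod.val_cast_of_lt (Finset.mem_range.1 ha)
  · intro a _; simp

theorem sum_even_zmod (F : ZMod p → ℂ) (h0 : F 0 = 0) (hF : ∀ j, F (-j) = F j) (m : ℕ) (hm : p = 2 * m + 3) :
    ∑ j, F j = 2 * F 1 + 2 * ∑ i : Fin m, F ((i : ℕ) + 2 : ℕ) := by
  have h1 : ∑ n ∈ Finset.range (m + 1), F ((n + 1 : ℕ) : ZMod p) = F 1 + ∑ i : Fin m, F ((i : ℕ) + 2 : ℕ) := by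
    rw [Finset.sum_range_succ', Fin.sum_univ_eq_sum_range (fun i => F ((i + 2 : ℕ) : ZMod p))]
    rw [add_comm]; simp [add_assoc, one_add_one_eq_two]
  have h2 : ∑ n ∈ Finset.range (m + 1), F ((m + 1 + n + 1 : ℕ) : ZMod p) = ∑ n ∈ Finset.range (m + 1), F ((n + 1 : ℕ) : ZMod p) := by
    rw [← Finset.sum_range_reflect (fun n => F ((n + 1 : ℕ) : ZMod p))]
    refine Finset.sum_congr rfl fun n hn => ?_
    rw [Finset.mem_range] at hn
    rw [← hF]
    congr 1
    rw [neg_eq_iff_add_eq_zero, ← Nat.cast_add, ZMod.natCast_eq_zero_iff]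
    exact ⟨1, by omega⟩
  rw [sum_zmod_range, show Finset.range p = Finset.range ((m + 1) + (m + 1) + 1) by congr 1; omega,
    Finset.sum_range_succ', Finset.sum_range_add, h2, h1, Nat.cast_zero, h0]
  ring

/-- `log |1 - e(j)|` -/
noncomputable def gl (j : ZMod p) : ℝ := Real.log ‖(1 : ℂ) - ZMod.stdAddChar j‖

theorem gl_neg (j : ZMod p) : gl (-j) = gl j := by unfold gl; rw [log_re_neg]

theorem gl_zero : gl (0 : ZMod p) = 0 := by unfold gl; simp

theorem evS_gl (χ : DirichletCharacter ℂ p) : evS χ = ∑ j : ZMod p, χ j * (gl j : ℂ) := rfl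

theorem coe_ne_zero' (m : ℕ) (hm : p = 2 * m + 3) (i : Fin m) : (((i : ℕ) + 2 : ℕ) : ZMod p) ≠ 0 := by
  rw [Ne, ZMod.natCast_eq_zero_iff]
  intro h
  have := Nat.le_of_dvd (by omega) h
  omega

theorem eq_of_pm (m : ℕ) (hm : p = 2 * m + 3) (i j : ℕ) (hi : i ≤ m) (hj : j ≤ m)
    (h : ((i + 1 : ℕ) : ZMod p) = (j + 1 : ℕ) ∨ ((i + 1 : ℕ) : ZMod p) = -((j + 1 : ℕ) : ZMod p)) : i = j := by
  rcases h with h | h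
  · rw [ZMod.natCast_eq_natCast_iff'] at h
    rw [Nat.mod_eq_of_lt (by omega), Nat.mod_eq_of_lt (by omega)] at h
    omega
  · rw [eq_neg_iff_add_eq_zero, ← Nat.cast_add, ZMod.natCast_eq_zero_iff] at h
    have := Nat.le_of_dvd (by omega) h
    omega

theorem det_cyc (χ : DirichletCharacter ℂ p) (hχ : orderOf χ = p - 1) (m : ℕ) (hm : p = 2 * m + 3) :
    |(Matrix.of fun c a : Fin m => (2 : ℝ) * (gl ((((c : ℕ) + 2 : ℕ) : ZMod p) * (((a : ℕ) + 2 : ℕ) : ZMod p)) - gl (((c : ℕ) + 2 : ℕ) : ZMod p))).det| =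
      ∏ i ∈ Finset.range m, ‖evS (χ ^ (2 * i + 2))‖ := by
  haveI : NeZero p := ⟨hp.out.ne_zero⟩
  set M : Matrix (Fin m) (Fin m) ℝ := Matrix.of fun c a : Fin m => (2 : ℝ) * (gl ((((c : ℕ) + 2 : ℕ) : ZMod p) * (((a : ℕ) + 2 : ℕ) : ZMod p)) - gl (((c : ℕ) + 2 : ℕ) : ZMod p)) with hM
  have hm1 := chi_neg_one χ hχ (by omega)
  set V : Matrix (Fin m) (Fin m) ℂ := Matrix.of fun a j : Fin m => (χ (((a : ℕ) + 2 : ℕ) : ZMod p)) ^ (2 * (j : ℕ) + 2) with hV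
  have hkey : ∀ (j : ℕ), j < m → ∀ c : ZMod p, c ≠ 0 →
      ∑ a : Fin m, ((2 * (gl (c * (((a : ℕ) + 2 : ℕ) : ZMod p)) - gl c) : ℝ) : ℂ) * (χ (((a : ℕ) + 2 : ℕ) : ZMod p)) ^ (2 * j + 2) =
        (starRingEnd ℂ) (χ c ^ (2 * j + 2)) * evS (χ ^ (2 * j + 2)) := by
    intro j hj c hc
    have hne : χ ^ (2 * j + 2) ≠ 1 := by
      intro h
      have := Nat.le_of_dvd (by omega) (orderOf_dvd_of_pow_eq_one h)
      rw [hχ] at this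
      omega
    have h1 := sum_even_zmod (fun a : ZMod p => ((gl (c * a) - gl c : ℝ) : ℂ) * (χ a) ^ (2 * j + 2))
      (by simp [chi_zero]) (fun a => by
        rw [chi_neg, hm1, mul_neg, gl_neg, mul_pow, Even.neg_one_pow ⟨j + 1, by ring⟩, one_mul]) m hm
    simp only [mul_one, sub_self, Complex.ofReal_zero, zero_mul, mul_zero, zero_add] at h1
    have h2 : ∑ a : Fin m, ((2 * (gl (c * (((a : ℕ) + 2 : ℕ) : ZMod p)) - gl c) : ℝ) : ℂ) * (χ (((a : ℕ) + 2 : ℕ) : ZMod p)) ^ (2 * j + 2) =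
        2 * ∑ a : Fin m, ((gl (c * (((a : ℕ) + 2 : ℕ) : ZMod p)) - gl c : ℝ) : ℂ) * (χ (((a : ℕ) + 2 : ℕ) : ZMod p)) ^ (2 * j + 2) := by
      rw [Finset.mul_sum]
      refine Finset.sum_congr rfl fun a _ => ?_
      push_cast
      ring
    rw [h2, ← h1]
    have h3 : ∑ a : ZMod p, (χ a) ^ (2 * j + 2) = 0 := by
      rw [← MulChar.sum_eq_zero_of_ne_one hne]
      exact Finset.sum_congr rfl fun a _ => (MulChar.pow_apply' _ (by omega) a).symm
    have h4 : ∑ a : ZMod p, ((gl (c * a) - gl c : ℝ) : ℂ) * (χ a) ^ (2 * j + 2) = ∑ a : ZMod p, (gl (c * a) : ℂ) * (χ a) ^ (2 * j + 2) := by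
      rw [← sub_eq_zero, ← Finset.sum_sub_distrib]
      rw [← mul_zero (-(gl c : ℂ)), ← h3, Finset.mul_sum]
      refine Finset.sum_congr rfl fun a _ => ?_
      push_cast
      ring
    rw [h4, evS_gl, Finset.mul_sum, ← Equiv.sum_comp (Equiv.mulLeft₀ c hc) (fun j' => (starRingEnd ℂ) (χ c ^ (2 * j + 2)) * ((χ ^ (2 * j + 2)) j' * (gl j' : ℂ)))]
    refine Finset.sum_congr rfl fun a _ => ?_
    rw [show (Equiv.mulLeft₀ c hc) a = c * a from rfl, MulChar.pow_apply' _ (by omega), map_mul, mul_pow]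
    have h5 : (starRingEnd ℂ) (χ c ^ (2 * j + 2)) * χ c ^ (2 * j + 2) = 1 := by
      rw [mul_comm, Complex.mul_conj, Complex.normSq_eq_norm_sq, norm_pow]
      have : ‖χ c‖ = 1 := by
        obtain ⟨u, rfl⟩ := (isUnit_iff_ne_zero.2 hc)
        exact DirichletCharacter.unit_norm_eq_one χ u
      rw [this]; simp
    linear_combination (-(gl (c * a) : ℂ) * χ a ^ (2 * j + 2)) * h5
  have hMV : (M.map Complex.ofRealHom) * V = Matrix.of fun c j : Fin m => evS (χ ^ (2 * (j : ℕ) + 2)) * (V.map (starRingEnd ℂ)) c j := by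
    ext c j
    rw [Matrix.mul_apply, Matrix.of_apply, Matrix.map_apply, mul_comm]
    exact hkey j j.2 _ (coe_ne_zero' m hm c)
  have hdet := congrArg Matrix.det hMV
  rw [Matrix.det_mul, Matrix.det_mul_row] at hdet
  have e1 : (M.map Complex.ofRealHom).det = ((M.det : ℝ) : ℂ) := (RingHom.map_det Complex.ofRealHom M).symm
  have e2 : (V.map (starRingEnd ℂ)).det = (starRingEnd ℂ) V.det := (RingHom.map_det (starRingEnd ℂ) V).symm
  rw [e1, e2] at hdet
  have hn := congrArg norm hdet
  rw [norm_mul, norm_mul, RCLike.norm_conj, Complex.norm_real, norm_prod] at hn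
  have hVd : V.det ≠ 0 := by
    have : V = Matrix.of fun a j : Fin m => (χ (((a : ℕ) + 2 : ℕ) : ZMod p)) ^ 2 * (Matrix.vandermonde fun a : Fin m => (χ (((a : ℕ) + 2 : ℕ) : ZMod p)) ^ 2) a j := by
      ext a j
      rw [hV, Matrix.of_apply, Matrix.of_apply, Matrix.vandermonde_apply, ← pow_mul, ← pow_add]
      congr 1; ring
    rw [this, Matrix.det_mul_column]
    refine mul_ne_zero (Finset.prod_ne_zero_iff.2 fun a _ => pow_ne_zero _ ?_) (Matrix.det_vandermonde_ne_zero_iff.2 ?_)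
    · obtain ⟨u, hu⟩ := (isUnit_iff_ne_zero.2 (coe_ne_zero' m hm a))
      rw [← hu]
      exact fun h => one_ne_zero (α := ℝ) (by rw [← DirichletCharacter.unit_norm_eq_one χ u, h, norm_zero])
    · intro a b hab
      have hinj : ∀ x y : ZMod p, x ≠ 0 → y ≠ 0 → χ x = χ y → x = y := by
        intro x y hx hy hxy
        obtain ⟨u, rfl⟩ := (isUnit_iff_ne_zero.2 hx)
        obtain ⟨v, rfl⟩ := (isUnit_iff_ne_zero.2 hy)
        congr 1
        apply chi_inj χ hχ
        ext
        rw [MulChar.coe_toUnitHom, MulChar.coe_toUnitHom, hxy]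
      have ha := coe_ne_zero' m hm a
      have hb := coe_ne_zero' m hm b
      have : (((a : ℕ) + 1 + 1 : ℕ) : ZMod p) = ((b : ℕ) + 1 + 1 : ℕ) ∨ (((a : ℕ) + 1 + 1 : ℕ) : ZMod p) = -(((b : ℕ) + 1 + 1 : ℕ) : ZMod p) := by
        rcases sq_eq_sq_iff_eq_or_eq_neg.1 hab with h | h
        · exact Or.inl (hinj _ _ ha hb h)
        · right
          refine hinj _ _ ha (neg_ne_zero.2 hb) ?_
          rw [chi_neg, hm1, neg_one_mul]
          exact h
      have := eq_of_pm m hm _ _ (by omega) (by omega) this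
      exact Fin.ext (by omega)
  have := mul_right_cancel₀ (norm_ne_zero_iff.2 hVd) hn
  rw [← Real.norm_eq_abs, this, ← Fin.prod_univ_eq_prod_range (fun i => ‖evS (χ ^ (2 * i + 2))‖)]
end CycReg

end PartC7

section PartC8

open IsDedekindDomain nonZeroDivisors
open scoped ENNReal
open Filter Topology

section CycUnits
variable {p : ℕ} [hp : Fact p.Prime] {K : Type*} [Field K] [NumberField K] [IsCyclotomicExtension {p} ℚ K]
variable {ζ : K} (hζ : IsPrimitiveRoot ζ p)

open Classical in
/-- the cyclotomic unit `(1 - ζ^a)/(1 - ζ)` -/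
noncomputable def cyc (a : ℕ) : (𝓞 K)ˣ :=
  if h : IsUnit (∑ i ∈ Finset.range a, hζ.toInteger ^ i) then h.unit else 1

theorem cyc_spec (a : ℕ) (ha : ¬ p ∣ a) : ((cyc hζ a : (𝓞 K)ˣ) : 𝓞 K) * (1 - hζ.toInteger) = 1 - hζ.toInteger ^ a := by
  have h : IsUnit (∑ i ∈ Finset.range a, hζ.toInteger ^ i) :=
    hζ.toInteger_isPrimitiveRoot.geom_sum_isUnit hp.out.two_le (Nat.coprime_comm.1 ((Nat.Prime.coprime_iff_not_dvd hp.out).2 ha))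
  unfold cyc
  rw [dif_pos h, IsUnit.unit_spec, geom_sum_mul_neg]

include hζ in
theorem exists_emb (c : ZMod p) (hc : c ≠ 0) : ∃ φ : K →+* ℂ, φ ζ = ZMod.stdAddChar c := by
  haveI : NeZero p := ⟨hp.out.ne_zero⟩
  have h1 : IsPrimitiveRoot (ZMod.stdAddChar c : ℂ) p := by
    rw [IsPrimitiveRoot.iff_orderOf]
    refine orderOf_eq_prime ?_ ?_
    · rw [← AddChar.map_nsmul_eq_pow, nsmul_eq_mul, CharP.cast_eq_zero, zero_mul, AddChar.map_zero_eq_one]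
    · intro h
      rw [← AddChar.map_zero_eq_one (ZMod.stdAddChar (N := p))] at h
      exact hc (ZMod.injective_stdAddChar h)
  have hirr : Irreducible (cyclotomic p ℚ) := cyclotomic.irreducible_rat hp.out.pos
  let φ := (hζ.embeddingsEquivPrimitiveRoots ℂ hirr).symm ⟨_, (mem_primitiveRoots hp.out.pos).2 h1⟩
  refine ⟨φ.toRingHom, ?_⟩
  have := hζ.embeddingsEquivPrimitiveRoots_apply_coe ℂ hirr φ
  rw [Equiv.apply_symm_apply] at this
  exact this.symm

theorem places_card (m : ℕ) (hm : p = 2 * m + 3) : Fintype.card (InfinitePlace K) = m + 1 := by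
  haveI : NeZero p := ⟨hp.out.ne_zero⟩
  rw [InfinitePlace.card_eq_nrRealPlaces_add_nrComplexPlaces, IsCyclotomicExtension.Rat.nrRealPlaces_eq_zero K (n := p) (by omega),
    IsCyclotomicExtension.Rat.nrComplexPlaces_eq_totient_div_two p, Nat.totient_prime hp.out]
  omega

theorem rank_eq' (m : ℕ) (hm : p = 2 * m + 3) : Units.rank K = m := by
  rw [Units.rank, places_card (p := p) m hm]; omega

include hζ in
theorem exists_place (m : ℕ) (hm : p = 2 * m + 3) : ∃ w : Fin (m + 1) ≃ InfinitePlace K, ∀ i : Fin (m + 1), ∀ x : 𝓞 K, ∀ a : ℕ,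
    (x : K) * (1 - ζ) = 1 - ζ ^ a → ¬ p ∣ a →
    Real.log (w i (x : K)) = gl ((((i : ℕ) + 1 : ℕ) : ZMod p) * (a : ZMod p)) - gl (((i : ℕ) + 1 : ℕ) : ZMod p) := by
  haveI : NeZero p := ⟨hp.out.ne_zero⟩
  have hne : ∀ i : Fin (m + 1), (((i : ℕ) + 1 : ℕ) : ZMod p) ≠ 0 := by
    intro i h
    rw [ZMod.natCast_eq_zero_iff] at h
    have := Nat.le_of_dvd (by omega) h
    omega
  choose φ hφ using fun i : Fin (m + 1) => exists_emb hζ _ (hne i)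
  have hinj : Function.Injective fun i => InfinitePlace.mk (φ i) := by
    intro i j hij
    have : (((i : ℕ) + 1 : ℕ) : ZMod p) = ((j : ℕ) + 1 : ℕ) ∨ (((i : ℕ) + 1 : ℕ) : ZMod p) = -(((j : ℕ) + 1 : ℕ) : ZMod p) := by
      rcases InfinitePlace.mk_eq_iff.1 hij with h | h
      · left
        apply ZMod.injective_stdAddChar
        rw [← hφ, ← hφ, h]
      · right
        apply ZMod.injective_stdAddChar
        rw [AddChar.map_neg_eq_conj, ← hφ, ← hφ, ← h]
        simp [ComplexEmbedding.conjugate_coe_eq]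
    exact Fin.ext (eq_of_pm m hm _ _ (by omega) (by omega) this)
  have hbij : Function.Bijective fun i => InfinitePlace.mk (φ i) := by
    rw [Fintype.bijective_iff_injective_and_card]
    exact ⟨hinj, by rw [Fintype.card_fin, places_card (p := p) m hm]⟩
  refine ⟨Equiv.ofBijective _ hbij, fun i x a hx ha => ?_⟩
  rw [Equiv.ofBijective_apply, InfinitePlace.apply]
  have ha' : (a : ZMod p) ≠ 0 := by rwa [Ne, ZMod.natCast_eq_zero_iff]
  have h1 := congrArg (fun y => ‖φ i y‖) hx
  simp only [map_mul, map_sub, map_one, map_pow, hφ, norm_mul] at h1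
  rw [← AddChar.map_nsmul_eq_pow, nsmul_eq_mul, mul_comm (a : ZMod p)] at h1
  have hnz : ∀ c : ZMod p, c ≠ 0 → ‖(1 : ℂ) - ZMod.stdAddChar c‖ ≠ 0 := by
    intro c hc h
    rw [norm_eq_zero, sub_eq_zero, ← AddChar.map_zero_eq_one (ZMod.stdAddChar (N := p))] at h
    exact hc (ZMod.injective_stdAddChar h.symm)
  unfold gl
  rw [← h1, Real.log_mul _ (hnz _ (hne i))]
  · ring
  · intro h
    rw [h, zero_mul] at h1
    exact hnz _ (mul_ne_zero (hne i) ha') h1.symm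

theorem reg_cyc (χ : DirichletCharacter ℂ p) (hχ : orderOf χ = p - 1) (m : ℕ) (hm : p = 2 * m + 3) :
    Units.regOfFamily (fun i : Fin (Units.rank K) => cyc hζ ((i : ℕ) + 2)) = ∏ i ∈ Finset.range m, ‖evS (χ ^ (2 * i + 2))‖ := by
  haveI : NeZero p := ⟨hp.out.ne_zero⟩
  classical
  obtain ⟨w, hw⟩ := exists_place hζ m hm
  have hr : Units.rank K = m := rank_eq' (p := p) m hm
  let q : Fin m ≃ {v : InfinitePlace K // v ≠ w 0} :=
    (finSuccAboveEquiv (0 : Fin (m + 1))).trans (w.subtypeEquiv fun a => by simp)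
  have hq : ∀ i : Fin m, ((q i : {v : InfinitePlace K // v ≠ w 0}) : InfinitePlace K) = w i.succ := fun i => rfl
  haveI := IsCyclotomicExtension.Rat.isTotallyComplex K (n := p) (by omega)
  rw [Units.regOfFamily_eq_det _ (w 0) (q.symm.trans (finCongr hr.symm)), ← det_cyc χ hχ m hm, ← Matrix.det_transpose, ← Matrix.det_submatrix_equiv_self q]
  congr 2
  ext c a
  have had : ¬ p ∣ (a : ℕ) + 2 := fun h => coe_ne_zero' m hm a ((ZMod.natCast_eq_zero_iff _ _).2 h)
  rw [Matrix.submatrix_apply, Matrix.transpose_apply, Matrix.of_apply, Matrix.of_apply, IsTotallyComplex.mult_eq, hq,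
    hw c.succ _ ((a : ℕ) + 2) _ had]
  · push_cast; simp only [Fin.val_succ]; push_cast; ring_nf
  · have := congrArg (algebraMap (𝓞 K) K) (cyc_spec hζ ((a : ℕ) + 2) had)
    rw [map_mul, map_sub, map_sub, map_pow, map_one] at this
    have hqa : (((q.symm.trans (finCongr hr.symm)) (q a) : Fin (Units.rank K)) : ℕ) = a := by simp
    rw [hqa]
    exact this
end CycUnits

end PartC8

section PartC9

open IsDedekindDomain nonZeroDivisors
open scoped ENNReal
open Filter Topology

section Stick
variable {p : ℕ} [hp : Fact p.Prime]

theorem stick (χ : DirichletCharacter ℂ p) (c : ℕ) (hc : ¬ p ∣ c) :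
    ((c : ℂ) - (χ c)⁻¹) * odB χ = p * ∑ j : ZMod p, χ j * ((c * j.val / p : ℕ) : ℂ) := by
  have hc0 : (c : ZMod p) ≠ 0 := by rwa [Ne, ZMod.natCast_eq_zero_iff]
  have hx : χ c ≠ 0 := by
    obtain ⟨u, hu⟩ := isUnit_iff_ne_zero.2 hc0
    rw [← hu]
    exact fun h => one_ne_zero (α := ℝ) (by rw [← DirichletCharacter.unit_norm_eq_one χ u, h, norm_zero])
  have h1 : ∀ j : ZMod p, (c : ℂ) * (j.val : ℂ) = (((c : ZMod p) * j).val : ℂ) + p * ((c * j.val / p : ℕ) : ℂ) := by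
    intro j
    have : ((c : ZMod p) * j).val = c * j.val % p := by
      conv_lhs => rw [← ZMod.natCast_zmod_val j, ← Nat.cast_mul, ZMod.val_natCast]
    rw [this, ← Nat.cast_mul, ← Nat.cast_mul, ← Nat.cast_add, Nat.mod_add_div]
  have h2 : (χ c)⁻¹ * odB χ = ∑ j : ZMod p, χ j * (((c : ZMod p) * j).val : ℂ) := by
    unfold odB
    rw [← Equiv.sum_comp (Equiv.mulLeft₀ (c : ZMod p) hc0), Finset.mul_sum]
    refine Finset.sum_congr rfl fun a _ => ?_
    rw [show (Equiv.mulLeft₀ (c : ZMod p) hc0) a = c * a from rfl, map_mul]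
    field_simp
  rw [sub_mul, h2, odB, Finset.mul_sum, Finset.mul_sum, ← Finset.sum_sub_distrib]
  refine Finset.sum_congr rfl fun a _ => ?_
  linear_combination χ a * h1 a

theorem stick_int (χ : DirichletCharacter ℂ p) (c : ℕ) : IsIntegral ℤ (∑ j : ZMod p, χ j * ((c * j.val / p : ℕ) : ℂ)) := by
  refine IsIntegral.sum _ fun j _ => IsIntegral.mul ?_ (by exact_mod_cast isIntegral_algebraMap (R := ℤ) (A := ℂ) (x := ((c * j.val / p : ℕ) : ℤ)))
  by_cases hj : j = 0
  · subst hj; rw [chi_zero]; exact isIntegral_zero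
  · obtain ⟨u, rfl⟩ := isUnit_iff_ne_zero.2 hj
    have : (χ u) ^ (p - 1) = 1 := by
      rw [← map_pow, ← Units.val_pow_eq_pow_val, ZMod.units_pow_card_sub_one_eq_one]; simp
    exact IsIntegral.of_pow (Nat.sub_pos_of_lt hp.out.one_lt) (this ▸ isIntegral_one)

theorem exists_c (m : ℕ) (hm : p = 2 * m + 3) : ∃ c : ℕ, ¬ p ∣ c ∧ orderOf (c : ZMod p) = p - 1 ∧ ∃ k : ℕ, c ^ (m + 1) + 1 = p * k ∧ ¬ p ∣ k := by
  haveI : NeZero p := ⟨hp.out.ne_zero⟩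
  obtain ⟨g, hg⟩ := IsCyclic.exists_generator (α := (ZMod p)ˣ)
  have hg' : orderOf g = p - 1 := by
    rw [orderOf_eq_card_of_forall_mem_zpowers hg, Nat.card_eq_fintype_card, ZMod.card_units]
  set c0 := (g : ZMod p).val with hc0
  have hcz : ((c0 : ℕ) : ZMod p) = g := by rw [hc0]; simp
  have hcp : ∀ c : ℕ, (c : ZMod p) = g → ¬ p ∣ c := by
    intro c h hd
    rw [(ZMod.natCast_eq_zero_iff _ _).2 hd] at h
    exact g.ne_zero h.symm
  have hord : ∀ c : ℕ, (c : ZMod p) = g → orderOf (c : ZMod p) = p - 1 := fun c h => by rw [h, orderOf_units, hg']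
  have hdiv : ∀ c : ℕ, (c : ZMod p) = g → p ∣ c ^ (m + 1) + 1 := by
    intro c h
    rw [← ZMod.natCast_eq_zero_iff]
    push_cast
    rw [h]
    have h1 : ((g : ZMod p) ^ (m + 1)) * ((g : ZMod p) ^ (m + 1)) = 1 := by
      rw [← pow_add, show m + 1 + (m + 1) = p - 1 by omega, ← hg', ← Units.val_pow_eq_pow_val, pow_orderOf_eq_one, Units.val_one]
    rcases mul_self_eq_one_iff.1 h1 with h | h
    · exfalso
      have h2 : g ^ (m + 1) = 1 := by ext; simpa using h
      have := Nat.le_of_dvd (by omega) (orderOf_dvd_of_pow_eq_one h2)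
      omega
    · rw [h]; ring
  by_cases hs : p * p ∣ c0 ^ (m + 1) + 1
  · have hc1 : ((c0 + p : ℕ) : ZMod p) = g := by push_cast; rw [hcz]; simp
    refine ⟨c0 + p, hcp _ hc1, hord _ hc1, ?_⟩
    obtain ⟨k, hk⟩ := hdiv _ hc1
    refine ⟨k, hk, ?_⟩
    rintro ⟨k', rfl⟩
    obtain ⟨q, hq⟩ := Polynomial.powAddExpansion (c0 : ℤ) (p : ℤ) (m + 1)
    obtain ⟨s, hs⟩ := hs
    zify at hk hs
    rw [hq] at hk
    have h3 : (p : ℤ) * ((m + 1 : ℕ) * c0 ^ m) = p * (p * (k' - s - q)) := by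
      push_cast at hk ⊢
      linear_combination hk - hs
    have h4 := mul_left_cancel₀ (by exact_mod_cast hp.out.ne_zero) h3
    have h5 : (p : ℤ) ∣ ((m + 1) * c0 ^ m : ℕ) := ⟨_, by push_cast at h4 ⊢; exact h4⟩
    rw [Int.natCast_dvd_natCast] at h5
    rcases hp.out.dvd_mul.1 h5 with h | h
    · have := Nat.le_of_dvd (by omega) h
      omega
    · exact hcp _ hcz (hp.out.dvd_of_dvd_pow h)
  · obtain ⟨k, hk⟩ := hdiv _ hcz
    exact ⟨c0, hcp _ hcz, hord _ hcz, k, hk, fun ⟨k', h⟩ => hs ⟨k', by rw [hk, h]; ring⟩⟩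

theorem prod_c (χ : DirichletCharacter ℂ p) (hχ : orderOf χ = p - 1) (m : ℕ) (hm : p = 2 * m + 3) (c : ℕ) (hc : ¬ p ∣ c) (ho : orderOf (c : ZMod p) = p - 1) :
    ∏ i ∈ Finset.range (m + 1), ((c : ℂ) - ((χ ^ (2 * i + 1)) c)⁻¹) = c ^ (m + 1) + 1 := by
  have hc0 : (c : ZMod p) ≠ 0 := by rwa [Ne, ZMod.natCast_eq_zero_iff]
  have hcc : (c : ℂ) ≠ 0 := by
    intro h
    rw [Nat.cast_eq_zero] at h
    exact hc (h ▸ dvd_zero p)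
  obtain ⟨u, hu⟩ := isUnit_iff_ne_zero.2 hc0
  have h1 : IsPrimitiveRoot ((χ c)⁻¹) (p - 1) := by
    have := chi_prim χ hχ u
    rw [hu, ho] at this
    exact this.inv
  set ω := (χ c)⁻¹ with hω
  have hω1 : ω ^ (m + 1) = -1 := by
    have h2 : ω ^ (m + 1) * ω ^ (m + 1) = 1 := by
      rw [← pow_add, show m + 1 + (m + 1) = p - 1 by omega, h1.pow_eq_one]
    rcases mul_self_eq_one_iff.1 h2 with h | h
    · exact absurd h (h1.pow_ne_one_of_pos_of_lt (by omega) (by omega))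
    · exact h
  have h2 : IsPrimitiveRoot (ω ^ 2) (m + 1) := h1.pow (by omega) (by omega)
  have h3 := cyc_prod (by omega : 0 < m + 1) h2 1 (ω / c)
  rw [mul_one, pow_one, div_pow, hω1] at h3
  have h4 : ∏ i ∈ Finset.range (m + 1), ((c : ℂ) - ((χ ^ (2 * i + 1)) c)⁻¹) = ∏ i ∈ Finset.range (m + 1), ((c : ℂ) * (1 - (ω ^ 2) ^ i * (ω / c))) := by
    refine Finset.prod_congr rfl fun i _ => ?_
    rw [MulChar.pow_apply' _ (by omega), ← inv_pow, ← hω]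
    field_simp
    ring
  rw [h4, Finset.prod_mul_distrib, h3, Finset.prod_const, Finset.card_range]
  field_simp
  ring

theorem index_coprime (K : Type*) [Field K] [NumberField K] [IsCyclotomicExtension {p} ℚ K] {ζ : K} (hζ : IsPrimitiveRoot ζ p)
    (m : ℕ) (hm : p = 2 * m + 3) (hreg : ¬ p ∣ Nat.card (ClassGroup (𝓞 K))) :
    ¬ p ∣ (Subgroup.closure (Set.range fun i : Fin (Units.rank K) => cyc hζ ((i : ℕ) + 2)) ⊔ Units.torsion K).index := by
  obtain ⟨χ, hχ⟩ := orderOf_chi_exists (p := p)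
  obtain ⟨c, hc, ho, k, hk, hpk⟩ := exists_c (p := p) m hm
  set I := (Subgroup.closure (Set.range fun i : Fin (Units.rank K) => cyc hζ ((i : ℕ) + 2)) ⊔ Units.torsion K).index with hI
  set h := Nat.card (ClassGroup (𝓞 K)) with hh
  have h1 := class_formula χ hχ K m hm
  rw [← reg_cyc hζ χ hχ m hm] at h1
  have h2 := Units.regOfFamily_div_regulator (fun i : Fin (Units.rank K) => cyc hζ ((i : ℕ) + 2))
  rw [← hI, div_eq_iff (Units.regulator_ne_zero K)] at h2
  rw [h2, ← hh] at h1
  set B : ℂ := ∏ i ∈ Finset.range (m + 1), odB (χ ^ (2 * i + 1)) with hB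
  set T : ℂ := ∏ i ∈ Finset.range (m + 1), ∑ j : ZMod p, (χ ^ (2 * i + 1)) j * ((c * j.val / p : ℕ) : ℂ) with hT
  have hTi : IsIntegral ℤ T := IsIntegral.prod _ fun i _ => stick_int _ _
  have h3 : ((c : ℂ) ^ (m + 1) + 1) * B = p ^ (m + 1) * T := by
    rw [← prod_c χ hχ m hm c hc ho, hB, hT, ← Finset.prod_mul_distrib, Finset.prod_congr rfl (fun i _ => stick (χ ^ (2 * i + 1)) c hc),
      Finset.prod_mul_distrib, Finset.prod_const, Finset.card_range]
  have h4 : ((p * k : ℕ) : ℝ) * ‖B‖ = p ^ (m + 1) * ‖T‖ := by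
    have := congrArg norm h3
    rw [norm_mul, norm_mul, norm_pow, Complex.norm_natCast] at this
    rw [← this, ← hk]
    congr 1
    rw [← Complex.norm_natCast]; push_cast; rfl
  rw [← norm_prod, ← hB] at h1
  have hp0 : (p : ℝ) ≠ 0 := by exact_mod_cast hp.out.ne_zero
  have hR := Units.regulator_ne_zero K
  have h5 : (I : ℝ) * ‖T‖ = 2 ^ m * h * k := by
    apply mul_left_cancel₀ (pow_ne_zero (m + 1) hp0)
    apply mul_left_cancel₀ hR
    apply mul_left_cancel₀ (two_ne_zero (α := ℝ))
    push_cast at h4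
    linear_combination (-k : ℝ) * h1 - 2 * Units.regulator K * I * h4
  have hh0 : h ≠ 0 := fun h0 => hreg (h0 ▸ dvd_zero p)
  have hk0 : k ≠ 0 := fun h0 => hpk (h0 ▸ dvd_zero p)
  have hI0 : (I : ℝ) ≠ 0 := by
    intro h0
    rw [h0, zero_mul] at h5
    have : (2 : ℝ) ^ m * h * k ≠ 0 := by positivity
    exact this h5.symm
  have hTT : IsIntegral ℤ ((‖T‖ ^ 2 : ℝ) : ℂ) := by
    rw [← Complex.normSq_eq_norm_sq, ← Complex.mul_conj]
    exact hTi.mul (hTi.map (starRingEnd ℂ).toIntAlgHom)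
  have hq : ((‖T‖ ^ 2 : ℝ) : ℂ) = algebraMap ℚ ℂ (((2 ^ m * h * k : ℕ) : ℚ) ^ 2 / (I : ℚ) ^ 2) := by
    have : ‖T‖ = 2 ^ m * h * k / I := by rw [eq_div_iff hI0, ← h5, mul_comm]
    rw [this]
    simp
    ring
  rw [hq, isIntegral_algebraMap_iff (algebraMap ℚ ℂ).injective, IsIntegrallyClosed.isIntegral_iff] at hTT
  obtain ⟨t, ht⟩ := hTT
  have hIQ : (I : ℚ) ≠ 0 := by exact_mod_cast (Nat.cast_ne_zero (R := ℝ)).1 hI0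
  rw [eq_div_iff (pow_ne_zero 2 hIQ)] at ht
  have ht' : t * (I : ℤ) ^ 2 = ((2 ^ m * h * k : ℕ) : ℤ) ^ 2 := by
    apply Int.cast_injective (α := ℚ)
    push_cast at ht ⊢
    exact ht
  intro hd
  have h6 : (p : ℤ) ∣ ((2 ^ m * h * k : ℕ) : ℤ) ^ 2 := by
    rw [← ht']
    exact Dvd.dvd.mul_left (Dvd.dvd.pow (Int.natCast_dvd_natCast.2 hd) two_ne_zero) t
  have h7 := hp.out.dvd_of_dvd_pow (by exact_mod_cast h6 : p ∣ (2 ^ m * h * k) ^ 2)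
  rcases hp.out.dvd_mul.1 h7 with h8 | h8
  · rcases hp.out.dvd_mul.1 h8 with h9 | h9
    · have := Nat.le_of_dvd two_pos (hp.out.dvd_of_dvd_pow h9)
      omega
    · exact hreg h9
  · exact hpk h8
end Stick

end PartC9

section PartD1

open IsDedekindDomain nonZeroDivisors

section Fourier
variable {p : ℕ} [hp : Fact p.Prime]

/-- Fourier coefficient -/
def lam (g : (ZMod p)ˣ → ZMod p) (j : ℕ) : ZMod p := ∑ a : (ZMod p)ˣ, g a * ((a⁻¹ : (ZMod p)ˣ) : ZMod p) ^ j

/-- the power function -/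
def ePow (j : ℕ) : (ZMod p)ˣ → ZMod p := fun c => (c : ZMod p) ^ j

theorem sum_units_pow (j : ℕ) : ∑ a : (ZMod p)ˣ, (a : ZMod p) ^ j = if p - 1 ∣ j then -1 else 0 := by
  have := FiniteField.sum_pow_units (ZMod p) j
  rw [ZMod.card] at this
  convert this using 1

theorem sum_units_inv_pow (j : ℕ) : ∑ a : (ZMod p)ˣ, ((a⁻¹ : (ZMod p)ˣ) : ZMod p) ^ j = if p - 1 ∣ j then -1 else 0 := by
  rw [← sum_units_pow, ← Equiv.sum_comp (Equiv.inv (ZMod p)ˣ)]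
  simp

theorem four_inv (g : (ZMod p)ˣ → ZMod p) (c : (ZMod p)ˣ) : ∑ j ∈ Finset.range (p - 1), lam g j * ePow j c = - g c := by
  have h1 : ∀ a : (ZMod p)ˣ, ∑ j ∈ Finset.range (p - 1), ((a⁻¹ * c : (ZMod p)ˣ) : ZMod p) ^ j = if a = c then -1 else 0 := by
    intro a
    split_ifs with h
    · subst h
      simp [Nat.cast_sub hp.out.one_le]
    · have h2 : ((a⁻¹ * c : (ZMod p)ˣ) : ZMod p) - 1 ≠ 0 := by
        rw [sub_ne_zero]
        intro h3
        apply h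
        have : a⁻¹ * c = 1 := Units.ext (by rw [Units.val_one]; exact h3)
        exact (inv_mul_eq_one.1 this)
      apply mul_right_cancel₀ h2
      rw [geom_sum_mul, ← Units.val_pow_eq_pow_val, ZMod.units_pow_card_sub_one_eq_one, Units.val_one, sub_self, zero_mul]
  unfold lam ePow
  simp only [Finset.sum_mul]
  rw [Finset.sum_comm]
  have h2 : ∀ a : (ZMod p)ˣ, ∑ j ∈ Finset.range (p - 1), g a * ((a⁻¹ : (ZMod p)ˣ) : ZMod p) ^ j * (c : ZMod p) ^ j = g a * if a = c then -1 else 0 := by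
    intro a
    rw [← h1 a, Finset.mul_sum]
    refine Finset.sum_congr rfl fun j _ => ?_
    rw [Units.val_mul, mul_pow, mul_assoc]
  rw [Finset.sum_congr rfl fun a _ => h2 a, Finset.sum_eq_single c (fun a _ ha => by rw [if_neg ha, mul_zero]) (fun h => absurd (Finset.mem_univ c) h), if_pos rfl, mul_neg_one]

theorem ePow_indep : LinearIndependent (ZMod p) (fun j : Fin (p - 1) => (ePow (j : ℕ) : (ZMod p)ˣ → ZMod p)) := by
  let F : ℕ → ((ZMod p)ˣ →* ZMod p) := fun j => (Units.coeHom (ZMod p)).comp (powMonoidHom j)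
  have hF : Function.Injective fun j : Fin (p - 1) => F j := by
    intro i j h
    obtain ⟨g, hg⟩ := IsCyclic.exists_generator (α := (ZMod p)ˣ)
    have hg' : orderOf g = p - 1 := by
      rw [orderOf_eq_card_of_forall_mem_zpowers hg, Nat.card_eq_fintype_card, ZMod.card_units]
    have h1 : F i g = F j g := DFunLike.congr_fun h g
    have h2 : g ^ (i : ℕ) = g ^ (j : ℕ) := Units.ext h1
    exact Fin.ext (pow_injOn_Iio_orderOf (by rw [Set.mem_Iio, hg']; exact i.2) (by rw [Set.mem_Iio, hg']; exact j.2) h2)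
  have := (linearIndependent_monoidHom (ZMod p)ˣ (ZMod p)).comp _ hF
  have e : (fun j : Fin (p - 1) => (ePow (j : ℕ) : (ZMod p)ˣ → ZMod p)) = (fun f : (ZMod p)ˣ →* ZMod p => (f : (ZMod p)ˣ → ZMod p)) ∘ fun j : Fin (p - 1) => F j := by
    funext j c
    show (c : ZMod p) ^ (j : ℕ) = ((c ^ (j : ℕ) : (ZMod p)ˣ) : ZMod p)
    rw [Units.val_pow_eq_pow_val]
  rw [e]
  exact this

theorem card_W (hp2 : 2 < p) (g : (ZMod p)ˣ → ZMod p) (s : ZMod p) (W : Submodule (ZMod p) ((ZMod p)ˣ → ZMod p))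
    (h1 : ∀ a, (fun c => g (c * a) - g c) ∈ W)
    (h2 : W ≤ Submodule.span (ZMod p) (insert (fun c : (ZMod p)ˣ => (c : ZMod p) * s) (Set.range fun a : (ZMod p)ˣ => (fun c : (ZMod p)ˣ => g (c * a) - g c))))
    (h3 : s ≠ 0 → lam g 1 ≠ 0) :
    Nat.card W = p ^ ((Finset.range (p - 1)).filter fun j => 0 < j ∧ lam g j ≠ 0).card := by
  classical
  set J := (Finset.range (p - 1)).filter fun j => 0 < j ∧ lam g j ≠ 0 with hJ
  have hW : W = Submodule.span (ZMod p) (Set.range fun j : J => (ePow (j : ℕ) : (ZMod p)ˣ → ZMod p)) := by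
    apply le_antisymm
    · refine h2.trans (Submodule.span_le.2 ?_)
      have hmem : ∀ j, 0 < j → j < p - 1 → lam g j ≠ 0 → (ePow j : (ZMod p)ˣ → ZMod p) ∈ Submodule.span (ZMod p) (Set.range fun j : J => (ePow (j : ℕ) : (ZMod p)ˣ → ZMod p)) := by
        intro j h0 hj hl
        exact Submodule.subset_span ⟨⟨j, by rw [hJ, Finset.mem_filter, Finset.mem_range]; exact ⟨hj, h0, hl⟩⟩, rfl⟩
      rintro x (rfl | ⟨a, rfl⟩)
      · by_cases hs : s = 0
        · subst hs
          simp only [mul_zero]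
          exact Submodule.zero_mem _
        · have := Submodule.smul_mem _ s (hmem 1 one_pos (by omega) (h3 hs))
          have e : (fun c : (ZMod p)ˣ => (c : ZMod p) * s) = s • (ePow 1 : (ZMod p)ˣ → ZMod p) := by
            funext c
            show (c : ZMod p) * s = s * (c : ZMod p) ^ 1
            ring
          rw [e]
          exact this
      · have : (fun c => g (c * a) - g c) = ∑ j ∈ Finset.range (p - 1), (lam g j * (1 - (a : ZMod p) ^ j)) • (ePow j : (ZMod p)ˣ → ZMod p) := by
          ext c
          have e1 := four_inv g (c * a)
          have e2 := four_inv g c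
          rw [Finset.sum_apply, ← neg_eq_iff_eq_neg] at *
          rw [← e1, ← e2, neg_sub_neg, ← Finset.sum_sub_distrib]
          refine Finset.sum_congr rfl fun j _ => ?_
          simp only [ePow, Pi.smul_apply, smul_eq_mul, Units.val_mul, mul_pow]
          ring
        simp only [this]
        refine Submodule.sum_mem _ fun j hj => ?_
        by_cases h0 : j = 0
        · subst h0; simp
        · by_cases hl : lam g j = 0
          · rw [hl]; simp
          · exact Submodule.smul_mem _ _ (hmem j (Nat.pos_of_ne_zero h0) (Finset.mem_range.1 hj) hl)
    · refine Submodule.span_le.2 ?_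
      rintro _ ⟨⟨j, hj⟩, rfl⟩
      rw [hJ, Finset.mem_filter, Finset.mem_range] at hj
      have h4 : lam g j • (ePow j : (ZMod p)ˣ → ZMod p) ∈ W := by
        have : lam g j • (ePow j : (ZMod p)ˣ → ZMod p) = ∑ a : (ZMod p)ˣ, (((a⁻¹ : (ZMod p)ˣ) : ZMod p) ^ j) • (fun c => g (c * a) - g c) := by
          ext c
          simp only [Finset.sum_apply, Pi.smul_apply, smul_eq_mul, ePow, mul_sub]
          rw [Finset.sum_sub_distrib, ← Finset.sum_mul, sum_units_inv_pow, if_neg (fun hd => by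
            have := Nat.le_of_dvd hj.2.1 hd
            omega), zero_mul, sub_zero, lam, Finset.sum_mul, ← Equiv.sum_comp (Equiv.mulLeft c)]
          refine Finset.sum_congr rfl fun a _ => ?_
          have h3 : (c : ZMod p) ^ j * ((c⁻¹ : (ZMod p)ˣ) : ZMod p) ^ j = 1 := by
            rw [← mul_pow, ← Units.val_mul, mul_inv_cancel, Units.val_one, one_pow]
          rw [Equiv.coe_mulLeft, mul_inv, Units.val_mul, mul_pow]
          linear_combination (g (c * a) * ((a⁻¹ : (ZMod p)ˣ) : ZMod p) ^ j) * h3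
        rw [this]
        exact Submodule.sum_mem _ fun a _ => Submodule.smul_mem _ _ (h1 a)
      exact (Submodule.smul_mem_iff _ hj.2.2).1 h4
  have hli : LinearIndependent (ZMod p) (fun j : J => (ePow (j : ℕ) : (ZMod p)ˣ → ZMod p)) :=
    (ePow_indep (p := p)).comp (fun j : J => (⟨j, Finset.mem_range.1 (Finset.mem_filter.1 j.2).1⟩ : Fin (p - 1)))
      (fun i j h => Subtype.ext (by simpa using h))
  rw [Module.natCard_eq_pow_finrank (K := ZMod p), Nat.card_zmod, hW, finrank_span_eq_card hli, Fintype.card_coe]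

theorem lam_odd (hp2 : 2 < p) (g : (ZMod p)ˣ → ZMod p) (s : ZMod p) (hg : ∀ a, g (-a) = g a - (a : ZMod p) * s)
    (j : ℕ) (hj : Odd j) : 2 * lam g j = s * ∑ a : (ZMod p)ˣ, ((a⁻¹ : (ZMod p)ˣ) : ZMod p) ^ (j - 1) := by
  have h1 : lam g j = ∑ a : (ZMod p)ˣ, g (-a) * (((-a)⁻¹ : (ZMod p)ˣ) : ZMod p) ^ j := by
    unfold lam
    rw [← Equiv.sum_comp (Equiv.neg (ZMod p)ˣ)]
    rfl
  have h2 : lam g j = - lam g j + s * ∑ a : (ZMod p)ˣ, ((a⁻¹ : (ZMod p)ˣ) : ZMod p) ^ (j - 1) := by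
    have h1' := h1
    conv_lhs => rw [h1]
    unfold lam
    rw [Finset.mul_sum, ← Finset.sum_neg_distrib, ← Finset.sum_add_distrib]
    refine Finset.sum_congr rfl fun a _ => ?_
    obtain ⟨i, rfl⟩ := hj
    have h3 : (a : ZMod p) * ((a⁻¹ : (ZMod p)ˣ) : ZMod p) = 1 := Units.mul_inv a
    rw [hg, inv_neg, Units.val_neg, Odd.neg_pow ⟨i, rfl⟩, Nat.add_sub_cancel, pow_succ]
    linear_combination (s * ((a⁻¹ : (ZMod p)ˣ) : ZMod p) ^ (2 * i)) * h3
  linear_combination h2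

theorem lam_odd_iff (hp2 : 2 < p) (g : (ZMod p)ˣ → ZMod p) (s : ZMod p) (hg : ∀ a, g (-a) = g a - (a : ZMod p) * s)
    (j : ℕ) (hj : Odd j) (hj1 : j < p - 1) : lam g j ≠ 0 ↔ j = 1 ∧ s ≠ 0 := by
  have h2 : (2 : ZMod p) ≠ 0 := by
    intro h
    have h' : ((2 : ℕ) : ZMod p) = 0 := h
    rw [ZMod.natCast_eq_zero_iff] at h'
    have := Nat.le_of_dvd two_pos h'
    omega
  have h1 := lam_odd hp2 g s hg j hj
  rw [sum_units_inv_pow] at h1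
  have hj0 := hj.pos
  by_cases h : j = 1
  · subst h
    rw [if_pos (by simp)] at h1
    constructor
    · intro h3
      refine ⟨rfl, fun hs => ?_⟩
      rw [hs, zero_mul] at h1
      exact (mul_ne_zero h2 h3) h1
    · rintro ⟨_, hs⟩ h3
      rw [h3, mul_zero] at h1
      exact mul_ne_zero hs (neg_ne_zero.2 one_ne_zero) h1.symm
  · rw [if_neg (fun hd => by have := Nat.le_of_dvd (by omega) hd; omega), mul_zero] at h1
    exact ⟨fun h3 => absurd h1 (mul_ne_zero h2 h3), fun h3 => absurd h3.1 h⟩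

theorem card_J (m : ℕ) (hm : p = 2 * m + 3) (g : (ZMod p)ˣ → ZMod p) (s : ZMod p) (hg : ∀ a, g (-a) = g a - (a : ZMod p) * s) :
    ((Finset.range (p - 1)).filter fun j => 0 < j ∧ lam g j ≠ 0).card +
      ((Finset.range (p - 1)).filter fun j => 0 < j ∧ Even j ∧ lam g j = 0).card = m + if s = 0 then 0 else 1 := by
  have h1 : (Finset.range (p - 1)).filter (fun j => 0 < j ∧ lam g j ≠ 0) =
      (Finset.range (p - 1)).filter (fun j => 0 < j ∧ Even j ∧ lam g j ≠ 0) ∪ (if s = 0 then ∅ else {1}) := by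
    ext j
    rw [Finset.mem_union, Finset.mem_filter, Finset.mem_filter, Finset.mem_range]
    rcases Nat.even_or_odd j with he | ho
    · have : j ≠ 1 := by rintro rfl; exact absurd he (by decide)
      split_ifs <;> simp [he, this]
    · have ho' : ¬ Even j := Nat.not_even_iff_odd.2 ho
      have h0 := ho.pos
      by_cases hj : j < p - 1
      · have := lam_odd_iff (by omega) g s hg j ho hj
        split_ifs with hs
        · simp [ho', this, hs]
        · simp [ho', hj, h0, this, hs]
      · have : j ≠ 1 := by omega
        split_ifs <;> simp [ho', hj, this]
  have h2 : ((Finset.range (p - 1)).filter (fun j => 0 < j ∧ Even j ∧ lam g j ≠ 0)).card +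
      ((Finset.range (p - 1)).filter fun j => 0 < j ∧ Even j ∧ lam g j = 0).card = m := by
    rw [← Finset.card_union_of_disjoint]
    · have : (Finset.range (p - 1)).filter (fun j => 0 < j ∧ Even j ∧ lam g j ≠ 0) ∪ (Finset.range (p - 1)).filter (fun j => 0 < j ∧ Even j ∧ lam g j = 0) =
          (Finset.range m).image (fun i => 2 * i + 2) := by
        ext j
        simp only [Finset.mem_union, Finset.mem_filter, Finset.mem_range, Finset.mem_image]
        constructor
        · rintro (⟨a, b, ⟨i, c⟩, d⟩ | ⟨a, b, ⟨i, c⟩, d⟩) <;> exact ⟨i - 1, by omega, by omega⟩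
        · rintro ⟨i, hi, rfl⟩
          by_cases h : lam g (2 * i + 2) = 0
          · exact Or.inr ⟨by omega, by omega, ⟨i + 1, by omega⟩, h⟩
          · exact Or.inl ⟨by omega, by omega, ⟨i + 1, by omega⟩, h⟩
      rw [this, Finset.card_image_of_injective _ (fun i j h => by simpa using h), Finset.card_range]
    · rw [Finset.disjoint_left]
      intro j h3 h4
      exact (Finset.mem_filter.1 h3).2.2.2 (Finset.mem_filter.1 h4).2.2.2
  rw [h1, Finset.card_union_of_disjoint]
  · split_ifs
    · rw [Finset.card_empty]; omega
    · rw [Finset.card_singleton]; omega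
  · rw [Finset.disjoint_left]
    intro j h3 h4
    split_ifs at h4 with hs
    · exact absurd h4 (Finset.notMem_empty j)
    · rw [Finset.mem_singleton] at h4
      subst h4
      exact absurd (Finset.mem_filter.1 h3).2.2.1 (by decide)
end Fourier

end PartD1

section PartD2

open IsDedekindDomain nonZeroDivisors

section Ell
variable {p : ℕ} [hp : Fact p.Prime] {N : ℕ} [hN : Fact N.Prime]

theorem exists_ell (hd : p ∣ N - 1) : ∃ l : Additive (ZMod N)ˣ →+ ZMod p,
    ∀ x : (ZMod N)ˣ, l (Additive.ofMul x) = 0 ↔ ∃ y : (ZMod N)ˣ, y ^ p = x := by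
  have hc : Nat.card (ZMod N)ˣ = N - 1 := by
    rw [Nat.card_eq_fintype_card, ZMod.card_units]
  have hd' : p ∣ Nat.card (ZMod N)ˣ := by rwa [hc]
  have hN0 : NeZero (Nat.card (ZMod N)ˣ) := ⟨Nat.card_pos.ne'⟩
  let e : Multiplicative (ZMod (Nat.card (ZMod N)ˣ)) ≃* (ZMod N)ˣ := zmodCyclicMulEquiv inferInstance
  let l : Additive (ZMod N)ˣ →+ ZMod p :=
    (ZMod.castHom hd' (ZMod p)).toAddMonoidHom.comp (MonoidHom.toAdditiveLeft e.symm.toMonoidHom)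
  have hl : ∀ x, l (Additive.ofMul x) = ZMod.castHom hd' (ZMod p) (Multiplicative.toAdd (e.symm x)) := fun x => rfl
  refine ⟨l, fun x => ⟨fun h => ?_, ?_⟩⟩
  · rw [hl] at h
    obtain ⟨k, hk⟩ : ∃ k : ℕ, ((Multiplicative.toAdd (e.symm x)).val) = p * k := by
      rw [ZMod.castHom_apply, ← ZMod.natCast_val, ZMod.natCast_eq_zero_iff] at h
      exact h
    refine ⟨e (Multiplicative.ofAdd (k : ZMod _)), ?_⟩
    rw [← map_pow, ← ofAdd_nsmul]
    apply e.symm.injective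
    rw [MulEquiv.symm_apply_apply]
    apply Multiplicative.toAdd.injective
    rw [toAdd_ofAdd, nsmul_eq_mul, ← Nat.cast_mul, ← hk, ZMod.natCast_zmod_val]
  · rintro ⟨y, rfl⟩
    rw [ofMul_pow, map_nsmul, nsmul_eq_mul, CharP.cast_eq_zero, zero_mul]

/-- the discrete log mod `p` -/
noncomputable def ell (hd : p ∣ N - 1) : Additive (ZMod N)ˣ →+ ZMod p := (exists_ell hd).choose

theorem ell_zero (hd : p ∣ N - 1) (x : (ZMod N)ˣ) : ell hd (Additive.ofMul x) = 0 ↔ ∃ y : (ZMod N)ˣ, y ^ p = x :=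
  (exists_ell hd).choose_spec x

/-- discrete log of a nonzero element; `0` at zero -/
noncomputable def el (hd : p ∣ N - 1) (x : ZMod N) : ZMod p :=
  if h : x = 0 then 0 else ell hd (Additive.ofMul (Units.mk0 x h))

theorem el_unit (hd : p ∣ N - 1) (x : (ZMod N)ˣ) : el hd (x : ZMod N) = ell hd (Additive.ofMul x) := by
  rw [el, dif_neg x.ne_zero, Units.mk0_val]

theorem el_mul (hd : p ∣ N - 1) (x y : ZMod N) (hx : x ≠ 0) (hy : y ≠ 0) : el hd (x * y) = el hd x + el hd y := by
  obtain ⟨x, rfl⟩ := hx.isUnit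
  obtain ⟨y, rfl⟩ := hy.isUnit
  rw [← Units.val_mul, el_unit, el_unit, el_unit, ofMul_mul, map_add]

theorem el_pow (hd : p ∣ N - 1) (x : ZMod N) (hx : x ≠ 0) (n : ℕ) : el hd (x ^ n) = n * el hd x := by
  obtain ⟨x, rfl⟩ := hx.isUnit
  rw [← Units.val_pow_eq_pow_val, el_unit, el_unit, ofMul_pow, map_nsmul, nsmul_eq_mul]

theorem el_prod (hd : p ∣ N - 1) {ι : Type*} (s : Finset ι) (F : ι → ZMod N) (hF : ∀ i ∈ s, F i ≠ 0) :
    el hd (∏ i ∈ s, F i) = ∑ i ∈ s, el hd (F i) := by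
  classical
  induction s using Finset.induction_on with
  | empty =>
    have := el_unit hd 1
    rw [Finset.prod_empty, Finset.sum_empty]
    rw [Units.val_one, ofMul_one, map_zero] at this
    exact this
  | insert a s ha ih =>
    rw [Finset.prod_insert ha, Finset.sum_insert ha, el_mul, ih]
    · exact fun i hi => hF i (Finset.mem_insert_of_mem hi)
    · exact hF a (Finset.mem_insert_self _ _)
    · exact Finset.prod_ne_zero_iff.2 fun i hi => hF i (Finset.mem_insert_of_mem hi)

theorem el_zero_iff (hd : p ∣ N - 1) (x : ZMod N) (hx : x ≠ 0) :
    el hd x = 0 ↔ ∃ y : (ZMod N)ˣ, (y : ZMod N) ^ p = x := by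
  obtain ⟨x, rfl⟩ := hx.isUnit
  rw [el_unit, ell_zero]
  refine exists_congr fun y => ?_
  rw [← Units.val_pow_eq_pow_val, Units.val_inj]

theorem el_neg_one (hd : p ∣ N - 1) (hpodd : Odd p) : el hd (-1) = 0 := by
  rw [el_zero_iff hd (-1) (neg_ne_zero.2 one_ne_zero)]
  exact ⟨-1, by rw [Units.val_neg, Units.val_one]; exact hpodd.neg_one_pow⟩

theorem el_f (hd : p ∣ N - 1) (f : (ZMod N)ˣ) (hf : orderOf f = p) : el hd (f : ZMod N) = 0 ↔ p ^ 2 ∣ N - 1 := by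
  have hc : Nat.card (ZMod N)ˣ = N - 1 := by
    rw [Nat.card_eq_fintype_card, ZMod.card_units]
  rw [el_unit, ell_zero]
  constructor
  · rintro ⟨y, hy⟩
    have : orderOf y = p ^ 2 := by
      refine orderOf_eq_prime_pow (n := 1) ?_ ?_
      · rw [pow_one, hy]; intro h; rw [h, orderOf_one] at hf; exact hp.out.one_lt.ne hf
      · rw [pow_succ, pow_one, pow_mul, hy, ← hf, pow_orderOf_eq_one]
    rw [← this, ← hc]
    exact orderOf_dvd_natCard y
  · rintro ⟨k, hk⟩
    obtain ⟨γ, hγ⟩ := IsCyclic.exists_generator (α := (ZMod N)ˣ)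
    obtain ⟨j, rfl⟩ : ∃ j : ℕ, γ ^ j = f := by
      have := hγ f
      rw [← mem_powers_iff_mem_zpowers] at this
      exact this
    have ho : orderOf γ = N - 1 := by rw [orderOf_eq_card_of_forall_mem_zpowers hγ, hc]
    have h1 : (γ ^ j) ^ p = 1 := by rw [← orderOf_dvd_iff_pow_eq_one, hf]
    rw [← pow_mul, ← orderOf_dvd_iff_pow_eq_one, ho, hk, pow_two, mul_assoc, mul_comm j p] at h1
    obtain ⟨i, hi⟩ := (Nat.mul_dvd_mul_iff_left hp.out.pos).1 h1
    exact ⟨γ ^ (k * i), by rw [← pow_mul, hi]; congr 1; ring⟩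
end Ell

end PartD2

section PartD3

open IsDedekindDomain nonZeroDivisors

section Phi
variable {p : ℕ} [hp : Fact p.Prime] {N : ℕ} [hN : Fact N.Prime]

theorem fpow_val {f : ZMod N} (hf : IsPrimitiveRoot f p) (n : ℕ) : f ^ ((n : ZMod p)).val = f ^ n := by
  rw [ZMod.val_natCast]
  conv_lhs => rw [hf.eq_orderOf]
  exact pow_mod_orderOf f n

theorem fpow_mul {f : ZMod N} (hf : IsPrimitiveRoot f p) (x y : ZMod p) : f ^ (x * y).val = (f ^ x.val) ^ y.val := by
  rw [← pow_mul, ← fpow_val hf (x.val * y.val), Nat.cast_mul, ZMod.natCast_zmod_val, ZMod.natCast_zmod_val]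

theorem fpow_prim {f : ZMod N} (hf : IsPrimitiveRoot f p) (c : (ZMod p)ˣ) : IsPrimitiveRoot (f ^ (c : ZMod p).val) p :=
  hf.pow_of_coprime _ (ZMod.val_coe_unit_coprime c)

theorem one_sub_ne {f : ZMod N} (hf : IsPrimitiveRoot f p) : 1 - f ≠ 0 :=
  sub_ne_zero.2 (hf.ne_one hp.out.one_lt).symm

theorem f_ne {f : ZMod N} (hf : IsPrimitiveRoot f p) : f ≠ 0 := hf.ne_zero hp.out.ne_zero

/-- the function `c ↦ log (1 - f^c)` -/
noncomputable def gf (hd : p ∣ N - 1) (f : ZMod N) (c : (ZMod p)ˣ) : ZMod p := el hd (1 - f ^ (c : ZMod p).val)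

theorem gf_neg (hd : p ∣ N - 1) (hpodd : Odd p) {f : ZMod N} (hf : IsPrimitiveRoot f p) (a : (ZMod p)ˣ) :
    gf hd f (-a) = gf hd f a - (a : ZMod p) * el hd f := by
  have h1 : f ^ ((-a : (ZMod p)ˣ) : ZMod p).val * f ^ (a : ZMod p).val = 1 := by
    rw [← pow_add, ← fpow_val hf, Nat.cast_add, ZMod.natCast_zmod_val, ZMod.natCast_zmod_val, Units.val_neg,
      neg_add_cancel, ZMod.val_zero, pow_zero]
  have h2 : (1 - f ^ ((-a : (ZMod p)ˣ) : ZMod p).val) * f ^ (a : ZMod p).val = (-1) * (1 - f ^ (a : ZMod p).val) := by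
    linear_combination -h1
  have h3 := congrArg (el hd) h2
  rw [el_mul hd _ _ (one_sub_ne (fpow_prim hf _)) (f_ne (fpow_prim hf _)),
    el_mul hd _ _ (neg_ne_zero.2 one_ne_zero) (one_sub_ne (fpow_prim hf _)), el_neg_one hd hpodd, zero_add,
    el_pow hd _ (f_ne hf), ZMod.natCast_zmod_val] at h3
  rw [gf, gf, ← h3, add_sub_cancel_right]

theorem lam_gf (hd : p ∣ N - 1) {f : ZMod N} (hf : IsPrimitiveRoot f p) (i : ℕ) (hi : i < p - 1) :
    lam (gf hd f) i = el hd (∏ a ∈ Finset.Icc 1 (p - 1), (1 - f ^ a) ^ (a ^ (p - 1 - i))) := by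
  have hne : ∀ a ∈ Finset.Icc 1 (p - 1), 1 - f ^ a ≠ 0 := by
    intro a ha
    rw [Finset.mem_Icc] at ha
    have hp1 := hp.out.pos
    refine one_sub_ne (hf.pow_of_coprime _ ?_)
    exact (Nat.coprime_of_lt_prime (by omega) (by omega) hp.out).symm
  rw [el_prod hd _ _ fun a ha => pow_ne_zero _ (hne a ha), lam]
  refine Finset.sum_bij' (fun (c : (ZMod p)ˣ) _ => (c : ZMod p).val)
    (fun (a : ℕ) ha => ZMod.unitOfCoprime a (by
      rw [Finset.mem_Icc] at ha
      exact (Nat.coprime_of_lt_prime (by omega) (by have := hp.out.pos; omega) hp.out).symm)) ?_ ?_ ?_ ?_ ?_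
  · intro c _
    rw [Finset.mem_Icc]
    have h1 := ZMod.val_lt (c : ZMod p)
    have h2 : (c : ZMod p).val ≠ 0 := by
      rw [Ne, ZMod.val_eq_zero]; exact c.ne_zero
    omega
  · intro a _; exact Finset.mem_univ _
  · intro c _
    ext
    rw [ZMod.coe_unitOfCoprime, ZMod.natCast_zmod_val]
  · intro a ha
    rw [Finset.mem_Icc] at ha
    rw [ZMod.coe_unitOfCoprime, ZMod.val_natCast, Nat.mod_eq_of_lt (by have := hp.out.pos; omega)]
  · intro c hc
    rw [el_pow hd _ (one_sub_ne (fpow_prim hf c)), gf, Nat.cast_pow, ZMod.natCast_zmod_val, mul_comm]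
    congr 1
    have h1 : ((c : ZMod p)) ^ (p - 1 - i) * (c : ZMod p) ^ i = 1 := by
      rw [← pow_add, Nat.sub_add_cancel hi.le, ZMod.pow_card_sub_one_eq_one c.ne_zero]
    have h2 : (c : ZMod p) ^ i * ((c⁻¹ : (ZMod p)ˣ) : ZMod p) ^ i = 1 := by
      rw [← mul_pow, Units.mul_inv, one_pow]
    exact (left_inv_eq_right_inv h1 h2).symm

variable {K : Type*} [Field K] [NumberField K] [IsCyclotomicExtension {p} ℚ K] {ζ : K} (hζ : IsPrimitiveRoot ζ p)

theorem rho_ne (g : ZMod N) (hg : IsPrimitiveRoot g p) (u : (𝓞 K)ˣ) : rho hζ g hg (u : 𝓞 K) ≠ 0 :=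
  (u.isUnit.map (rho hζ g hg)).ne_zero

/-- residue-symbol map on units -/
noncomputable def Phi (hd : p ∣ N - 1) (f : ZMod N) (hf : IsPrimitiveRoot f p) :
    Additive (𝓞 K)ˣ →+ ((ZMod p)ˣ → ZMod p) :=
  AddMonoidHom.mk' (fun u c => el hd (rho hζ (f ^ (c : ZMod p).val) (fpow_prim hf c) (u.toMul : 𝓞 K))) (by
    intro u v
    funext c
    rw [Pi.add_apply, toMul_add, Units.val_mul, map_mul, el_mul hd _ _ (rho_ne hζ _ _ _) (rho_ne hζ _ _ _)])

theorem Phi_apply (hd : p ∣ N - 1) (f : ZMod N) (hf : IsPrimitiveRoot f p) (u : (𝓞 K)ˣ) (c : (ZMod p)ˣ) :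
    Phi hζ hd f hf (Additive.ofMul u) c = el hd (rho hζ (f ^ (c : ZMod p).val) (fpow_prim hf c) (u : 𝓞 K)) := rfl

theorem Phi_cyc (hd : p ∣ N - 1) (f : ZMod N) (hf : IsPrimitiveRoot f p) (n : ℕ) (hn : ¬ p ∣ n) (a : (ZMod p)ˣ)
    (ha : (a : ZMod p) = n) :
    Phi hζ hd f hf (Additive.ofMul (cyc hζ n)) = fun c => gf hd f (c * a) - gf hd f c := by
  funext c
  rw [Phi_apply]
  have h := congrArg (rho hζ (f ^ (c : ZMod p).val) (fpow_prim hf c)) (cyc_spec hζ n hn)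
  rw [map_mul, map_sub, map_one, map_sub, map_one, map_pow, rho_zeta, ← fpow_val (fpow_prim hf c), ← ha,
    ← fpow_mul hf, ← Units.val_mul] at h
  have h1 := congrArg (el hd) h
  rw [el_mul hd _ _ (rho_ne hζ _ _ _) (one_sub_ne (fpow_prim hf c))] at h1
  rw [gf, gf, ← h1, add_sub_cancel_right]

theorem Phi_tors (hp2 : 2 < p) (hd : p ∣ N - 1) (f : ZMod N) (hf : IsPrimitiveRoot f p) (t : (𝓞 K)ˣ)
    (ht : t ∈ Units.torsion K) :
    ∃ k : ZMod p, Phi hζ hd f hf (Additive.ofMul t) = k • fun c : (ZMod p)ˣ => (c : ZMod p) * el hd f := by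
  have hpo : Odd p := hp.out.odd_of_ne_two (by omega)
  have h2 : (2 : ZMod p) ≠ 0 := by
    intro h
    have h' : ((2 : ℕ) : ZMod p) = 0 := h
    rw [ZMod.natCast_eq_zero_iff] at h'
    have := Nat.le_of_dvd two_pos h'
    omega
  have h1 : (t ^ 2) ^ p = 1 := by
    have h := IsCyclotomicExtension.Rat.torsionOrder_eq (n := p) (K := K)
    rw [if_neg (Nat.not_even_iff_odd.2 hpo)] at h
    have := Units.rootsOfUnity_eq_torsion K
    rw [← this, h, mem_rootsOfUnity] at ht
    rw [← pow_mul]; exact ht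
  have h3 : ((t : 𝓞 K) ^ 2) ^ p = 1 := by
    rw [← Units.val_pow_eq_pow_val, ← Units.val_pow_eq_pow_val, h1, Units.val_one]
  obtain ⟨k, _, hk⟩ := hζ.toInteger_isPrimitiveRoot.eq_pow_of_pow_eq_one h3
  refine ⟨2⁻¹ * k, ?_⟩
  funext c
  rw [Phi_apply, Pi.smul_apply, smul_eq_mul]
  have h4 := congrArg (fun x => el hd (rho hζ (f ^ (c : ZMod p).val) (fpow_prim hf c) x)) hk
  simp only [map_pow] at h4
  rw [rho_zeta, el_pow hd _ (f_ne (fpow_prim hf c)), el_pow hd _ (f_ne hf), el_pow hd _ (rho_ne hζ _ _ _),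
    ZMod.natCast_zmod_val] at h4
  rw [mul_assoc, h4, Nat.cast_ofNat, inv_mul_cancel_left₀ h2]

theorem card_range_Phi (m : ℕ) (hm : p = 2 * m + 3) (hreg : ¬ p ∣ Nat.card (ClassGroup (𝓞 K)))
    (hd : p ∣ N - 1) (f : ZMod N) (hf : IsPrimitiveRoot f p) :
    Nat.card (Phi hζ hd f hf).range = p ^ ((Finset.range (p - 1)).filter fun j => 0 < j ∧ lam (gf hd f) j ≠ 0).card := by
  have hpo : Odd p := ⟨m + 1, by omega⟩
  refine card_W (by omega) (gf hd f) (el hd f) (AddSubgroup.toZModSubmodule p (Phi hζ hd f hf).range) ?_ ?_ ?_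
  · intro a
    refine ⟨Additive.ofMul (cyc hζ (a : ZMod p).val), Phi_cyc hζ hd f hf _ ?_ a (by rw [ZMod.natCast_zmod_val])⟩
    rw [← ZMod.natCast_eq_zero_iff, ZMod.natCast_zmod_val]
    exact a.ne_zero
  · set S := Submodule.span (ZMod p) (insert (fun c : (ZMod p)ˣ => (c : ZMod p) * el hd f) (Set.range fun a : (ZMod p)ˣ => (fun c : (ZMod p)ˣ => gf hd f (c * a) - gf hd f c))) with hS
    let T : Subgroup (𝓞 K)ˣ := AddSubgroup.toSubgroup' (S.toAddSubgroup.comap (Phi hζ hd f hf))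
    have hT : ∀ u, u ∈ T ↔ Phi hζ hd f hf (Additive.ofMul u) ∈ S := fun u => Iff.rfl
    have hle : Subgroup.closure (Set.range fun i : Fin (Units.rank K) => cyc hζ (i+2)) ⊔ Units.torsion K ≤ T := by
      refine sup_le ?_ ?_
      · rw [Subgroup.closure_le]
        rintro _ ⟨i, rfl⟩
        have hi : (i : ℕ) + 2 < p := by
          have h1 := i.2
          have h2 := rank_eq' (p := p) (K := K) m hm
          omega
        have hnd : ¬ p ∣ (i : ℕ) + 2 := fun h => by have := Nat.le_of_dvd (by omega) h; omega
        refine (hT _).2 ?_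
        rw [Phi_cyc hζ hd f hf _ hnd (ZMod.unitOfCoprime (i + 2) (((Nat.Prime.coprime_iff_not_dvd hp.out).2 hnd).symm))
          (ZMod.coe_unitOfCoprime _ _)]
        exact Submodule.subset_span (Set.mem_insert_of_mem _ ⟨_, rfl⟩)
      · intro t ht
        obtain ⟨k, hk⟩ := Phi_tors hζ (by omega) hd f hf t ht
        rw [hT, hk]
        exact S.smul_mem _ (Submodule.subset_span (Set.mem_insert _ _))
    have hidx : ¬ p ∣ T.index := fun h =>
      index_coprime K hζ m hm hreg (h.trans (Subgroup.index_dvd_of_le hle))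
    rintro _ ⟨u, rfl⟩
    have h1 : (Additive.toMul u) ^ T.index ∈ T := Subgroup.pow_index_mem T _
    rw [hT, ofMul_pow, map_nsmul, ← Nat.cast_smul_eq_nsmul (ZMod p)] at h1
    rw [← ZMod.natCast_eq_zero_iff] at hidx
    exact (S.smul_mem_iff hidx).1 h1
  · intro hs
    exact (lam_odd_iff (by omega) (gf hd f) (el hd f) (gf_neg hd hpo hf) 1 odd_one (by omega)).2 ⟨rfl, hs⟩

end Phi

end PartD3

section PartD4

open IsDedekindDomain nonZeroDivisors

section Fin
variable {K L : Type*} [Field K] [NumberField K] [Field L] [NumberField L] [Algebra K L]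
 {p : ℕ} [hp : Fact p.Prime] [IsCyclotomicExtension {p} ℚ K]
  {ζ : K} (hζ : IsPrimitiveRoot ζ p) {N : ℕ} [hN : Fact N.Prime]

theorem prim_eq_fpow {f : ZMod N} (hf : IsPrimitiveRoot f p) (g : ZMod N) (hg : IsPrimitiveRoot g p) :
    ∃ c : (ZMod p)ˣ, g = f ^ (c : ZMod p).val := by
  obtain ⟨i, hi, rfl⟩ := hf.eq_pow_of_pow_eq_one hg.pow_eq_one
  have hc : i.Coprime p := (hf.pow_iff_coprime hp.out.pos i).1 hg
  exact ⟨ZMod.unitOfCoprime i hc, by rw [ZMod.coe_unitOfCoprime, fpow_val hf]⟩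

theorem mem_nrmU_iff [IsGalois K L] (hdeg : Module.finrank K L = p) (hp2 : 2 < p)
    (τ : L ≃ₐ[K] L) (hreg : ¬ p ∣ Nat.card (ClassGroup (𝓞 K))) (hNp : N ≠ p) (α : L) (hα : α ^ p = (N : L))
    (hgen : IntermediateField.adjoin K {α} = ⊤) (hτ : τ α = algebraMap K L ζ * α)
    (hd : p ∣ N - 1) (f : ZMod N) (hf : IsPrimitiveRoot f p) (u : (𝓞 K)ˣ) :
    u ∈ nrmU τ p ↔ Phi hζ hd f hf (Additive.ofMul u) = 0 := by
  constructor
  · intro hu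
    funext c
    rw [Phi_apply, Pi.zero_apply, el_zero_iff hd _ (rho_ne hζ _ _ _)]
    obtain ⟨P, hP⟩ := prBelow_surj (K := K) (L := L) (vN hζ (f ^ (c : ZMod p).val) (fpow_prim hf c))
    have hNP : (N : 𝓞 L) ∈ P.asIdeal := by
      have h := N_mem_vN hζ (f ^ (c : ZMod p).val) (fpow_prim hf c)
      rw [← hP, mem_prBelow, map_natCast] at h
      exact h
    obtain ⟨y, hy⟩ := norm_residue hdeg τ u hu P (ram_at_N hζ hdeg τ hNp α hα P hNP)
    rw [hP, mem_vN, map_sub, map_pow, sub_eq_zero] at hy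
    have hy0 : rho hζ (f ^ (c : ZMod p).val) (fpow_prim hf c) y ≠ 0 := by
      intro h
      rw [h, zero_pow hp.out.ne_zero] at hy
      exact rho_ne hζ _ _ _ hy
    exact ⟨Units.mk0 _ hy0, by rw [Units.val_mk0, hy]⟩
  · intro h
    refine norm_of_residue hζ hdeg hp2 τ hreg hNp α hα hgen hτ u fun v hv => ?_
    obtain ⟨g, hg, rfl⟩ := exists_vN hζ ⟨f, hf⟩ v hv
    obtain ⟨c, rfl⟩ := prim_eq_fpow hf g hg
    have h1 := congrFun h c
    rw [Phi_apply, Pi.zero_apply, el_zero_iff hd _ (rho_ne hζ _ _ _)] at h1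
    obtain ⟨y, hy⟩ := h1
    refine ⟨((y : ZMod N).val : 𝓞 K), ?_⟩
    rw [mem_vN, map_sub, map_pow, map_natCast, ZMod.natCast_zmod_val, hy, sub_self]

include hζ in
theorem nrmU_index_eq [IsGalois K L] (m : ℕ) (hm : p = 2 * m + 3) (hdeg : Module.finrank K L = p)
    (τ : L ≃ₐ[K] L) (hreg : ¬ p ∣ Nat.card (ClassGroup (𝓞 K))) (hNp : N ≠ p) (α : L) (hα : α ^ p = (N : L))
    (hgen : IntermediateField.adjoin K {α} = ⊤) (hτ : τ α = algebraMap K L ζ * α)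
    (hd : p ∣ N - 1) (f : ZMod N) (hf : IsPrimitiveRoot f p) :
    (nrmU τ p).index = p ^ ((Finset.range (p - 1)).filter fun j => 0 < j ∧ lam (gf hd f) j ≠ 0).card := by
  rw [← card_range_Phi hζ m hm hreg hd f hf, ← AddSubgroup.index_ker, ← Subgroup.index_toAddSubgroup]
  congr 1
  ext u
  exact mem_nrmU_iff hζ hdeg (by omega) τ hreg hNp α hα hgen hτ hd f hf (Additive.toMul u)

include hζ in
theorem not_pow (hNp : N ≠ p) (hroot : ∃ f : ZMod N, IsPrimitiveRoot f p) (c : K) : c ^ p ≠ (N : K) := by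
  intro h
  obtain ⟨f, hf⟩ := hroot
  have h1 := val_N hζ hNp (vN hζ f hf) (N_mem_vN hζ f hf)
  rw [← h, map_pow] at h1
  have hc : (vN hζ f hf).valuation K c ≠ 0 := by
    intro h0
    rw [h0, zero_pow hp.out.ne_zero] at h1
    exact WithZero.exp_ne_zero h1.symm
  rw [← WithZero.exp_log hc, ← WithZero.exp_nsmul, WithZero.exp_inj, nsmul_eq_mul] at h1
  have h2 : (p : ℤ) ∣ 1 := ⟨-WithZero.log ((vN hζ f hf).valuation K c), by linarith⟩
  have h3 : p ∣ 1 := by exact_mod_cast h2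
  exact hp.out.one_lt.ne' (Nat.dvd_one.1 h3)

include hζ in
theorem main_core (m : ℕ) (hm : p = 2 * m + 3) (hreg : ¬ p ∣ Nat.card (ClassGroup (𝓞 K)))
    (hNp : N ≠ p) (hmod : N ≡ 1 [MOD p]) (α : L) (hα : α ^ p = (N : L))
    (hgen : IntermediateField.adjoin K {α} = ⊤)
    (f : (ZMod N)ˣ) (hf : orderOf f = p)
    (M : ℕ → ZMod N)
    (hM : ∀ k, M k = ∏ a ∈ Finset.Icc 1 (p - 1), (1 - (f : ZMod N) ^ a) ^ (a ^ k))
    (a : ℕ)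
    (ha : a = {i : ℕ | 0 < i ∧ i < p - 1 ∧ Even i ∧
        ∃ y : (ZMod N)ˣ, ((y : ZMod N)) ^ p = M (p - 1 - i)}.ncard) :
    m + 1 + a ≤ pRank p (ClassGroup (𝓞 L)) ∧ pRank p (ClassGroup (𝓞 L)) ≤ (m + 1 + a) * (p - 1) := by
  have hp2 : 2 < p := by omega
  have hpo : Odd p := ⟨m + 1, by omega⟩
  have hd : p ∣ N - 1 := (Nat.modEq_iff_dvd' hN.out.one_lt.le).1 hmod.symm
  have hf0 : IsPrimitiveRoot (f : ZMod N) p := by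
    rw [IsPrimitiveRoot.coe_units_iff, ← hf]
    exact IsPrimitiveRoot.orderOf f
  have hroot : ∃ f : ZMod N, IsPrimitiveRoot f p := ⟨_, hf0⟩
  obtain ⟨hG, hdeg, σ, hσ, hσα⟩ := kummer_data (L := L) p hp.out ζ hζ (N : K) (not_pow hζ hNp hroot) α
    (by rw [map_natCast]; exact hα) hgen
  obtain ⟨hfin, hcard⟩ := card_ram hζ hdeg hpo σ hσ hNp hmod hroot α hα hσα
  have hamb := ambig_formula p hp.out hdeg σ hσ hfin ζ hζ (units_rank_eq p hp2 hdeg ζ hζ)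
  obtain ⟨hlo, hhi⟩ := class_bounds p hp.out hdeg σ hσ hreg
  rw [nrmU_index p hp.out hdeg σ hσ, hcard,
    nrmU_index_eq hζ m hm hdeg σ hreg hNp α hα hgen hσα hd f hf0] at hamb
  have hJ := card_J m hm (gf hd (f : ZMod N)) (el hd (f : ZMod N)) (gf_neg hd hpo hf0)
  have ha' : a = ((Finset.range (p - 1)).filter fun j => 0 < j ∧ Even j ∧ lam (gf hd (f : ZMod N)) j = 0).card := by
    rw [ha, ← Set.ncard_coe_finset]
    congr 1
    ext i
    rw [Finset.mem_coe, Finset.mem_filter, Finset.mem_range]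
    have key : i < p - 1 → (lam (gf hd (f : ZMod N)) i = 0 ↔ ∃ y : (ZMod N)ˣ, ((y : ZMod N)) ^ p = M (p - 1 - i)) := by
      intro hi
      rw [lam_gf hd hf0 i hi, el_zero_iff, hM]
      refine Finset.prod_ne_zero_iff.2 fun a ha => pow_ne_zero _ ?_
      rw [Finset.mem_Icc] at ha
      exact one_sub_ne (hf0.pow_of_coprime _ (Nat.coprime_of_lt_prime (by omega) (by omega) hp.out).symm)
    constructor
    · rintro ⟨h1, h2, h3, h4⟩
      exact ⟨h2, h1, h3, (key h2).2 h4⟩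
    · rintro ⟨h2, h1, h3, h4⟩
      exact ⟨h1, h2, h3, (key h2).1 h4⟩
  rw [← ha'] at hJ
  set δ : ℕ := if el hd (f : ZMod N) = 0 then 0 else 1 with hδ
  have hδ' : (if p ^ 2 ∣ N - 1 then 0 else 1) = δ := by
    rw [hδ]
    exact if_congr (el_f hd f hf).symm rfl rfl
  rw [hδ'] at hamb
  set C := (dvr L).range.relIndex ((dvr L).range.comap (diffDiv (sP σ))) with hC
  have hh : Nat.card (ClassGroup (𝓞 K)) ≠ 0 := Nat.card_pos.ne'
  have hC0 : C ≠ 0 := by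
    intro h0
    rw [h0, zero_mul] at hamb
    exact (mul_ne_zero (pow_ne_zero _ hp.out.ne_zero) hh) hamb.symm
  have hfac := congrArg (fun n => n.factorization p) hamb
  rw [← pow_succ', Nat.factorization_mul hC0 (pow_ne_zero _ hp.out.ne_zero),
    Nat.factorization_mul (pow_ne_zero _ hp.out.ne_zero) hh, Finsupp.add_apply, Finsupp.add_apply,
    hp.out.factorization_pow, hp.out.factorization_pow, Finsupp.single_eq_same, Finsupp.single_eq_same,
    Nat.factorization_eq_zero_of_not_dvd hreg] at hfac
  have hval : C.factorization p = m + 1 + a := by omega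
  rw [hval] at hlo hhi
  exact ⟨hlo, hhi⟩

end Fin

end PartD4

/-- Let `p` be a regular prime and `N ≡ 1 (mod p)` prime; let
`L = ℚ(ζ_p, N^{1/p})`.  Fix `f` of order `p` in `𝔽_N^×` and set
`M_k = ∏_{a=1}^{p-1} (1 - f^a)^{a^k}`.  If `α` is the number of even `i` with
`0 < i < p-1` such that `M_{p-1-i}` is a `p`-th power in `𝔽_N^×`, then
`(p-1)/2 + α ≤ rk_p(Cl(L)) ≤ (p-1)(p-2) - (p-1)((p-1)/2 - 1 - α)`. -/
theorem stmt15 (p N : ℕ) (hp : p.Prime) (hpodd : Odd p) (hN : N.Prime) (hNp : N ≠ p)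
    (hmod : N ≡ 1 [MOD p])
    (K : Type) [Field K] [NumberField K]
    (ζK : K) (hζK : IsPrimitiveRoot ζK p)
    (hKgen : Algebra.adjoin ℚ {ζK} = (⊤ : Subalgebra ℚ K))
    (hreg : ¬ p ∣ Nat.card (ClassGroup (𝓞 K)))
    (L : Type) [Field L] [NumberField L]
    (ζ : L) (hζ : IsPrimitiveRoot ζ p)
    (α : L) (hα : α ^ p = (N : L))
    (hLgen : Algebra.adjoin ℚ {ζ, α} = (⊤ : Subalgebra ℚ L))
    (f : (ZMod N)ˣ) (hf : orderOf f = p)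
    (M : ℕ → ZMod N)
    (hM : ∀ k, M k = ∏ a ∈ Finset.Icc 1 (p - 1), (1 - (f : ZMod N) ^ a) ^ (a ^ k))
    (a : ℕ)
    (ha : a = {i : ℕ | 0 < i ∧ i < p - 1 ∧ Even i ∧
        ∃ y : (ZMod N)ˣ, ((y : ZMod N)) ^ p = M (p - 1 - i)}.ncard) :
    ((p : ℤ) - 1) / 2 + a ≤ (pRank p (ClassGroup (𝓞 L)) : ℤ) ∧
    (pRank p (ClassGroup (𝓞 L)) : ℤ) ≤
      ((p : ℤ) - 1) * ((p : ℤ) - 2) - ((p : ℤ) - 1) * (((p : ℤ) - 1) / 2 - 1 - a) := by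
  haveI : Fact p.Prime := ⟨hp⟩
  haveI : Fact N.Prime := ⟨hN⟩
  obtain ⟨m, hm⟩ : ∃ m, p = 2 * m + 3 := by
    obtain ⟨k, hk⟩ := hpodd
    have := hp.two_le
    exact ⟨k - 1, by omega⟩
  haveI : IsCyclotomicExtension {p} ℚ K := by
    rw [IsCyclotomicExtension.iff_singleton]
    refine ⟨⟨ζK, hζK⟩, fun x => ?_⟩
    have hx : x ∈ Algebra.adjoin ℚ {ζK} := by rw [hKgen]; trivial
    refine Algebra.adjoin_mono ?_ hx
    rw [Set.singleton_subset_iff]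
    exact hζK.pow_eq_one
  let pb := hζK.powerBasis ℚ
  have hpb : pb.gen = ζK := hζK.powerBasis_gen ℚ
  have haev : aeval ζ (minpoly ℚ pb.gen) = 0 := by
    rw [hpb, ← cyclotomic_eq_minpoly_rat hζK hp.pos, aeval_def, eval₂_eq_eval_map, map_cyclotomic]
    exact hζ.isRoot_cyclotomic hp.pos
  let φ : K →ₐ[ℚ] L := pb.lift ζ haev
  have hφ : φ ζK = ζ := by
    rw [← hpb]; exact pb.lift_gen ζ haev
  letI : Algebra K L := φ.toRingHom.toAlgebra
  have hal : algebraMap K L ζK = ζ := hφ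
  have hgen : IntermediateField.adjoin K {α} = ⊤ := by
    rw [eq_top_iff]
    intro x _
    have hx : x ∈ Algebra.adjoin ℚ {ζ, α} := by rw [hLgen]; trivial
    induction hx using Algebra.adjoin_induction with
    | mem x hx =>
      rcases hx with rfl | hx
      · rw [← hal]; exact IntermediateField.algebraMap_mem _ _
      · exact IntermediateField.subset_adjoin K _ hx
    | algebraMap r =>
      rw [eq_ratCast]
      exact SubfieldClass.ratCast_mem _ r
    | add x y _ _ h1 h2 => exact add_mem (h1 trivial) (h2 trivial)
    | mul x y _ _ h1 h2 => exact mul_mem (h1 trivial) (h2 trivial)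
  obtain ⟨h1, h2⟩ := main_core (L := L) hζK m hm hreg hNp hmod α hα hgen f hf M hM a ha
  have hpz : (p : ℤ) = 2 * m + 3 := by exact_mod_cast hm
  have hdiv : ((p : ℤ) - 1) / 2 = m + 1 := by omega
  constructor
  · rw [hdiv]; exact_mod_cast h1
  · have h2' : (pRank p (ClassGroup (𝓞 L)) : ℤ) ≤ (m + 1 + a) * ((p - 1 : ℕ) : ℤ) := by exact_mod_cast h2
    refine h2'.trans (le_of_eq ?_)
    rw [hdiv, Nat.cast_sub hp.one_lt.le, hpz]
    push_cast
    ring
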